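/- There is an absolute constant C with the following property. Let Q ∈ C¹(ℝ³; ℝ³) and V := div Q with ‖V‖_{ℓ²(ℤ⁺),L∞} + ‖Q‖_{ℓ²(ℤ⁺),L∞} < ∞. Let k ∈ ℂ⁺, R ≥ 0, and let μ be a bounded C² complex-valued function on {x : |x| > R} satisfying −Δμ − 2(ik − 1/|x|) ∂_rμ + V μ = 0 there (∂_rμ := x̂·∇μ), with |∇μ(x)| → 0 as |x| → ∞. For r > R set m(r) := r^{−2} ∫_{|x|=r} |μ|² dσ_x, m₁(r) := r^{−2} ∫_{|x|=r} |∂_rμ|² dσ_x, A(r) := ∫_{|x|>r} |∇μ|²/|x|² dx, M(r) := sup_{ρ>r} ∫_ρ^{ρ+1} m(t) dt, and assume A(r) < ∞ and M(r) < ∞. Then for every r > R, writing q(r) := ‖Q‖_{ℓ²([r],∞),L∞}: (i) A(r) ≤ C [ M(r) q(r)² + M(r) q(r) (r+1)^{−1/2} + m(r) q(r) + (|k|²/Im k)( m(r) + √(m(r) m₁(r))/|k| ) ]; and (ii) M(r) ≤ C [ (Im k/|k|²)( √(A(r) M(r)) q(r) + m(r) q(r) + M(r) q(r) (r+1)^{−1/2}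 ) + m(r) + √(m(r) m₁(r))/|k| + √(M(r) A(r))/|k| ]. -/

import Mathlib

open MeasureTheory Metric Filter

noncomputable section

/-- The Laplacian of a complex-valued function on `ℝ³`. -/
def lap (u : EuclideanSpace ℝ (Fin 3) → ℂ) (x : EuclideanSpace ℝ (Fin 3)) : ℂ :=
  ∑ i : Fin 3,
    fderiv ℝ (fun y => fderiv ℝ u y (EuclideanSpace.single i 1)) x (EuclideanSpace.single i 1)

/-- The radial derivative `∂_r μ = x̂·∇μ`. -/
def rad (μ : EuclideanSpace ℝ (Fin 3) → ℂ) (x : EuclideanSpace ℝ (Fin 3)) : ℂ :=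
  fderiv ℝ μ x (‖x‖⁻¹ • x)

/-- Divergence of a real vector field on `ℝ³`. -/
def rdiv (Q : EuclideanSpace ℝ (Fin 3) → EuclideanSpace ℝ (Fin 3))
    (x : EuclideanSpace ℝ (Fin 3)) : ℝ :=
  ∑ i : Fin 3, fderiv ℝ (fun y => Q y i) x (EuclideanSpace.single i 1)

/-- `sup_{n < |x| < n+1} |V(x)|` for a scalar function `V`. -/
def annSup (V : EuclideanSpace ℝ (Fin 3) → ℝ) (n : ℕ) : ℝ :=
  sSup ((fun x => |V x|) '' {x : EuclideanSpace ℝ (Fin 3) | (n : ℝ) < ‖x‖ ∧ ‖x‖ < (n : ℝ) + 1})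

/-- `sup_{n < |x| < n+1} |Q(x)|` for a vector field `Q`. -/
def annSupV (Q : EuclideanSpace ℝ (Fin 3) → EuclideanSpace ℝ (Fin 3)) (n : ℕ) : ℝ :=
  sSup ((fun x => ‖Q x‖) '' {x : EuclideanSpace ℝ (Fin 3) | (n : ℝ) < ‖x‖ ∧ ‖x‖ < (n : ℝ) + 1})

/-- The tail norm `‖Q‖_{ℓ²([r],∞),L∞}`, with `[r]` the integer part of `r`. -/
def l2LinfTail (Q : EuclideanSpace ℝ (Fin 3) → EuclideanSpace ℝ (Fin 3)) (r : ℝ) : ℝ :=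
  Real.sqrt (∑' n : ℕ, (annSupV Q (Nat.floor r + n)) ^ 2)

/-- `m(r) = r⁻² ∫_{|x|=r} |μ|² dσ`. -/
def sphAvg (μ : EuclideanSpace ℝ (Fin 3) → ℂ) (r : ℝ) : ℝ :=
  (r ^ 2)⁻¹ * ∫ x in sphere (0 : EuclideanSpace ℝ (Fin 3)) r, ‖μ x‖ ^ 2 ∂μH[2]

/-- `m₁(r) = r⁻² ∫_{|x|=r} |∂_rμ|² dσ`. -/
def sphAvg1 (μ : EuclideanSpace ℝ (Fin 3) → ℂ) (r : ℝ) : ℝ :=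
  (r ^ 2)⁻¹ * ∫ x in sphere (0 : EuclideanSpace ℝ (Fin 3)) r, ‖rad μ x‖ ^ 2 ∂μH[2]

/-- `A(r) = ∫_{|x|>r} |∇μ|²/|x|² dx`. -/
def Aint (μ : EuclideanSpace ℝ (Fin 3) → ℂ) (r : ℝ) : ℝ :=
  ∫ x in {x : EuclideanSpace ℝ (Fin 3) | r < ‖x‖}, ‖fderiv ℝ μ x‖ ^ 2 / ‖x‖ ^ 2

/-- The set of values `∫_ρ^{ρ+1} m(t) dt` for `ρ > r`, whose supremum is `M(r)`. -/
def Mset (μ : EuclideanSpace ℝ (Fin 3) → ℂ) (r : ℝ) : Set ℝ :=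
  {y : ℝ | ∃ ρ : ℝ, r < ρ ∧ y = ∫ t in ρ..(ρ + 1), sphAvg μ t}

/-- `M(r) = sup_{ρ>r} ∫_ρ^{ρ+1} m(t) dt`. -/
def Msup (μ : EuclideanSpace ℝ (Fin 3) → ℂ) (r : ℝ) : ℝ := sSup (Mset μ r)

end


section PartA1
open scoped ENNReal Topology

/-- half of Christensen's argument -/
lemma christ_half {X : Type*} [MetricSpace X] [CompactSpace X] [MeasurableSpace X] [BorelSpace X]
    (μ ν : Measure X) [IsFiniteMeasure μ] [IsFiniteMeasure ν] [ν.IsOpenPosMeasure]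
    (g h : ℝ → ℝ≥0∞) (hg : ∀ x r, μ (ball x r) = g r) (hh : ∀ x r, ν (ball x r) = h r)
    (s : ℕ → ℝ) (hs : ∀ n, 0 < s n) (hs0 : Tendsto s atTop (𝓝 0)) (l : ℝ≥0∞)
    (hl : Tendsto (fun n => g (s n) / h (s n)) atTop (𝓝 l)) (U : Set X) (hU : IsOpen U) :
    μ U ≤ l * ν U := by
  rcases U.eq_empty_or_nonempty with rfl | ⟨x0, hx0⟩
  · simp
  have hpos : ∀ n, h (s n) ≠ 0 := fun n => by
    rw [← hh x0]; exact (isOpen_ball.measure_pos ν ⟨x0, mem_ball_self (hs n)⟩).ne'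
  have hfin : ∀ n, h (s n) ≠ ∞ := fun n => by
    rw [← hh x0]; exact measure_ne_top _ _
  set W : ℕ → Set (X × X) := fun n => {p | p.1 ∈ U ∧ p.2 ∈ U ∧ dist p.1 p.2 < s n} with hW
  have hWo : ∀ n, MeasurableSet (W n) := fun n => by
    refine IsOpen.measurableSet ?_
    refine (hU.preimage continuous_fst).inter ((hU.preimage continuous_snd).inter ?_)
    exact isOpen_lt (continuous_fst.dist continuous_snd) continuous_const
  set f : ℕ → X → ℝ≥0∞ := fun n x => (h (s n))⁻¹ * ν (Prod.mk x ⁻¹' W n) with hf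
  have hfm : ∀ n, Measurable (f n) := fun n =>
    (measurable_measure_prodMk_left (hWo n)).const_mul _
  have h1 : ∀ x ∈ U, (1:ℝ≥0∞) ≤ liminf (fun n => f n x) atTop := by
    intro x hx
    obtain ⟨ε, hε, hb⟩ := Metric.isOpen_iff.1 hU x hx
    refine le_liminf_of_le (by isBoundedDefault) ?_
    filter_upwards [hs0.eventually (gt_mem_nhds hε)] with n hn
    have : Prod.mk x ⁻¹' W n = ball x (s n) := by
      ext y
      simp only [hW, Set.mem_preimage, Set.mem_ofPred_eq, mem_ball, dist_comm y x]
      refine ⟨fun h => h.2.2, fun h => ⟨hx, hb ?_, h⟩⟩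
      rw [mem_ball, dist_comm]; exact h.trans hn
    simp only [hf, this, hh]
    rw [ENNReal.inv_mul_cancel (hpos n) (hfin n)]
  have h2 : ∀ n, ∫⁻ x, f n x ∂μ ≤ g (s n) / h (s n) * ν U := by
    intro n
    rw [lintegral_const_mul _ (measurable_measure_prodMk_left (hWo n)),
      ← Measure.prod_apply (hWo n), Measure.prod_apply_symm (hWo n), ENNReal.div_eq_inv_mul,
      mul_assoc]
    gcongr
    calc ∫⁻ y, μ ((fun x => (x, y)) ⁻¹' W n) ∂ν ≤ ∫⁻ y, U.indicator (fun _ => g (s n)) y ∂ν := by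
          refine lintegral_mono fun y => ?_
          by_cases hy : y ∈ U
          · rw [Set.indicator_of_mem hy, ← hg y]
            exact measure_mono fun x hx => hx.2.2
          · rw [Set.indicator_of_notMem hy]
            have : (fun x => (x, y)) ⁻¹' W n = ∅ := by
              ext x; simp [hW, hy]
            simp [this]
      _ = g (s n) * ν U := by
          rw [lintegral_indicator hU.measurableSet]; simp
  calc μ U = ∫⁻ x in U, 1 ∂μ := by simp
    _ ≤ ∫⁻ x in U, liminf (fun n => f n x) atTop ∂μ :=
        setLIntegral_mono' hU.measurableSet h1
    _ ≤ ∫⁻ x, liminf (fun n => f n x) atTop ∂μ := setLIntegral_le_lintegral _ _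
    _ ≤ liminf (fun n => ∫⁻ x, f n x ∂μ) atTop := lintegral_liminf_le hfm
    _ ≤ liminf (fun n => g (s n) / h (s n) * ν U) atTop :=
        liminf_le_liminf (Eventually.of_forall h2)
    _ = l * ν U := by
        exact (ENNReal.Tendsto.mul_const hl (Or.inr (measure_ne_top ν U))).liminf_eq

lemma christ {X : Type*} [MetricSpace X] [CompactSpace X] [Nonempty X]
    [MeasurableSpace X] [BorelSpace X]
    (μ ν : Measure X) [IsFiniteMeasure μ] [IsFiniteMeasure ν]
    [μ.IsOpenPosMeasure] [ν.IsOpenPosMeasure]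
    (hg : ∀ x y r, μ (ball x r) = μ (ball y r)) (hh : ∀ x y r, ν (ball x r) = ν (ball y r)) :
    ∃ c : ℝ≥0∞, c ≠ 0 ∧ c ≠ ∞ ∧ μ = c • ν := by
  obtain ⟨x0⟩ := ‹Nonempty X›
  set g := fun r => μ (ball x0 r) with hgd
  set h := fun r => ν (ball x0 r) with hhd
  set s : ℕ → ℝ := fun n => 1 / ((n : ℝ) + 1) with hs
  have hspos : ∀ n, 0 < s n := fun n => by positivity
  obtain ⟨l, φ, hφ, hl⟩ := CompactSpace.tendsto_subseq (fun n => g (s n) / h (s n))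
  have hs0 : Tendsto (fun n => s (φ n)) atTop (𝓝 0) :=
    tendsto_one_div_add_atTop_nhds_zero_nat.comp hφ.tendsto_atTop
  have hl' : Tendsto (fun n => h (s (φ n)) / g (s (φ n))) atTop (𝓝 l⁻¹) := by
    have := (continuous_inv.tendsto l).comp hl
    refine this.congr fun n => ?_
    simp only [Function.comp]
    rw [ENNReal.inv_div]
    · left; exact measure_ne_top _ _
    · left; exact (isOpen_ball.measure_pos ν ⟨x0, mem_ball_self (hspos _)⟩).ne'
  have A := christ_half μ ν g h (fun x r => hg x x0 r) (fun x r => hh x x0 r) (fun n => s (φ n))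
    (fun n => hspos _) hs0 l hl
  have B := christ_half ν μ h g (fun x r => hh x x0 r) (fun x r => hg x x0 r) (fun n => s (φ n))
    (fun n => hspos _) hs0 l⁻¹ hl'
  have p1 : μ Set.univ ≠ 0 := (isOpen_univ.measure_pos μ ⟨x0, trivial⟩).ne'
  have p2 : ν Set.univ ≠ 0 := (isOpen_univ.measure_pos ν ⟨x0, trivial⟩).ne'
  have l0 : l ≠ 0 := by
    rintro rfl; have := A _ isOpen_univ; simp at this; exact p1 (by simp [this])
  have l1 : l ≠ ∞ := by
    rintro rfl; have := B _ isOpen_univ; simp at this; exact p2 (by simp [this])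
  refine ⟨l, l0, l1, ?_⟩
  refine ext_of_generate_finite (C := {U | IsOpen U}) ?_ isPiSystem_isOpen ?_ ?_
  · exact BorelSpace.measurable_eq
  · intro U hU
    apply le_antisymm
    · exact A U hU
    · have := B U hU
      calc l * ν U ≤ l * (l⁻¹ * μ U) := by gcongr
        _ = μ U := by rw [← mul_assoc, ENNReal.mul_inv_cancel l0 l1, one_mul]
  · apply le_antisymm
    · exact A _ isOpen_univ
    · have := B _ isOpen_univ
      calc l * ν Set.univ ≤ l * (l⁻¹ * μ Set.univ) := by gcongr
        _ = μ Set.univ := by rw [← mul_assoc, ENNReal.mul_inv_cancel l0 l1, one_mul]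

end PartA1

section PartA2
open scoped ENNReal Topology Pointwise

abbrev E3 := EuclideanSpace ℝ (Fin 3)
abbrev S2 := sphere (0 : E3) 1

/-- restrict a linear isometry to the sphere -/
noncomputable def sphIso (g : E3 ≃ₗᵢ[ℝ] E3) : S2 ≃ᵢ S2 where
  toFun ω := ⟨g ω, by have := ω.2; simp at this; simp [this]⟩
  invFun ω := ⟨g.symm ω, by have := ω.2; simp at this; simp [this]⟩
  left_inv ω := by ext1; simp
  right_inv ω := by ext1; simp
  isometry_toFun := by
    intro x y
    exact g.isometry.edist_eq x y

lemma sph_trans (x y : S2) : ∃ g : E3 ≃ₗᵢ[ℝ] E3, sphIso g x = y := by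
  have h : ‖(x : E3)‖ = ‖(y : E3)‖ := by
    have := x.2; have := y.2; simp_all
  refine ⟨(Submodule.span ℝ {((x:E3) - (y:E3))})ᗮ.reflection, ?_⟩
  ext1
  exact Submodule.reflection_sub h

lemma hausS_ball (x y : S2) (r : ℝ) : (μH[2] : Measure S2) (ball x r) = μH[2] (ball y r) := by
  obtain ⟨g, hg⟩ := sph_trans x y
  rw [← hg, ← (sphIso g).image_ball, IsometryEquiv.hausdorffMeasure_image]

lemma toS_ball (x y : S2) (r : ℝ) :
    (volume : Measure E3).toSphere (ball x r) = (volume : Measure E3).toSphere (ball y r) := by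
  obtain ⟨g, hg⟩ := sph_trans x y
  rw [← hg, ← (sphIso g).image_ball, Measure.toSphere_apply' _ measurableSet_ball,
    Measure.toSphere_apply' _ ?_]
  swap
  · rw [(sphIso g).image_ball]; exact measurableSet_ball
  congr 1
  have : Set.Ioo (0:ℝ) 1 • (Subtype.val '' ((sphIso g) '' (ball x r)))
      = g '' (Set.Ioo (0:ℝ) 1 • (Subtype.val '' (ball x r))) := by
    ext z
    constructor
    · rintro ⟨t, ht, _, ⟨_, ⟨w, hw, rfl⟩, rfl⟩, rfl⟩
      exact ⟨t • (w : E3), ⟨t, ht, w, ⟨w, hw, rfl⟩, rfl⟩, g.map_smul t (w : E3)⟩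
    · rintro ⟨_, ⟨t, ht, _, ⟨w, hw, rfl⟩, rfl⟩, rfl⟩
      exact ⟨t, ht, g w, ⟨_, ⟨w, hw, rfl⟩, rfl⟩, (g.map_smul t (w : E3)).symm⟩
  rw [this, g.image_eq_preimage_symm]
  exact (g.symm.measurePreserving.measure_preimage_emb
    g.symm.toHomeomorph.measurableEmbedding _).symm

lemma hausS_fin : (μH[2] : Measure S2) Set.univ < ∞ := by
  have h0 : (μH[2] : Measure S2) Set.univ = (μH[2] : Measure E3) (Subtype.val '' (Set.univ : Set S2)) :=
    (isometry_subtype_coe.hausdorffMeasure_image (Or.inl (by norm_num)) _).symm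
  rw [h0]
  set Φ : ℝ × ℝ → E3 := fun p => !₂[Real.sin p.1 * Real.cos p.2, Real.sin p.1 * Real.sin p.2,
    Real.cos p.1] with hΦ
  have hc : ContDiff ℝ 1 Φ := by
    rw [contDiff_piLp]
    intro i
    fin_cases i <;> simp [hΦ] <;> fun_prop
  set K : Set (ℝ × ℝ) := Set.Icc (0 : ℝ) Real.pi ×ˢ Set.Icc (-Real.pi) Real.pi
  have hK : IsCompact K := isCompact_Icc.prod isCompact_Icc
  obtain ⟨C, hC⟩ := hc.locallyLipschitz.locallyLipschitzOn.exists_lipschitzOnWith_of_compact hK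
  have hsub : (Subtype.val '' (Set.univ : Set S2)) ⊆ Φ '' K := by
    rintro _ ⟨ω, -, rfl⟩
    have hω : ‖(ω : E3)‖ = 1 := by simpa using ω.2
    have hω2 : (ω : E3) 0 ^ 2 + (ω : E3) 1 ^ 2 + (ω : E3) 2 ^ 2 = 1 := by
      have := EuclideanSpace.norm_sq_eq (ω : E3)
      rw [hω] at this
      simp [Fin.sum_univ_three] at this
      linarith
    set z : ℂ := ⟨(ω : E3) 0, (ω : E3) 1⟩ with hz
    have hnz : ‖z‖ = Real.sqrt (1 - (ω : E3) 2 ^ 2) := by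
      rw [Complex.norm_def, Complex.normSq_apply]
      congr 1
      simp [hz]; nlinarith
    have h2 : -1 ≤ (ω : E3) 2 ∧ (ω : E3) 2 ≤ 1 := by
      constructor <;> nlinarith [sq_nonneg ((ω : E3) 0), sq_nonneg ((ω : E3) 1)]
    refine ⟨(Real.arccos ((ω : E3) 2), Complex.arg z),
      ⟨⟨Real.arccos_nonneg _, Real.arccos_le_pi _⟩, ⟨(Complex.neg_pi_lt_arg z).le, Complex.arg_le_pi z⟩⟩, ?_⟩
    ext i
    fin_cases i
    · simp only [hΦ, Real.sin_arccos, ← hnz]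
      simpa [hz] using Complex.norm_mul_cos_arg z
    · simp only [hΦ, Real.sin_arccos, ← hnz]
      simpa [hz] using Complex.norm_mul_sin_arg z
    · simp [hΦ, Real.cos_arccos h2.1 h2.2]
  refine (measure_mono hsub).trans_lt ((hC.hausdorffMeasure_image_le (by norm_num)).trans_lt ?_)
  refine ENNReal.mul_lt_top (by simp) ?_
  rw [hausdorffMeasure_prod_real]
  exact hK.measure_lt_top

lemma hausS_pos : 0 < (μH[2] : Measure S2) Set.univ := by
  set π : S2 → ℝ × ℝ := fun ω => ((ω : E3) 0, (ω : E3) 1)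
  have hπ : LipschitzWith 1 π := by
    refine LipschitzWith.of_dist_le_mul fun x y => ?_
    rw [Prod.dist_eq, NNReal.coe_one, one_mul, Subtype.dist_eq]
    refine max_le ?_ ?_
    · simpa [dist_eq_norm] using PiLp.norm_apply_le ((x : E3) - (y : E3)) (0 : Fin 3)
    · simpa [dist_eq_norm] using PiLp.norm_apply_le ((x : E3) - (y : E3)) (1 : Fin 3)
  have h1 := (hπ.hausdorffMeasure_image_le (d := 2) (by norm_num) Set.univ)
  have hsub : ball (0 : ℝ × ℝ) (1/2) ⊆ π '' Set.univ := by
    rintro ⟨a, b⟩ hab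
    rw [mem_ball_zero_iff, Prod.norm_def, max_lt_iff] at hab
    simp only [Real.norm_eq_abs, abs_lt] at hab
    have : 0 ≤ 1 - a^2 - b^2 := by nlinarith
    refine ⟨⟨!₂[a, b, Real.sqrt (1 - a^2 - b^2)], ?_⟩, trivial, by simp [π]⟩
    simp [EuclideanSpace.norm_eq, Fin.sum_univ_three, Real.sq_sqrt this]
  have h2 : 0 < (μH[2] : Measure (ℝ × ℝ)) (π '' Set.univ) := by
    refine lt_of_lt_of_le ?_ (measure_mono hsub)
    rw [hausdorffMeasure_prod_real]
    exact measure_ball_pos _ _ (by norm_num)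
  simpa using h2.trans_le h1

instance : Nonempty S2 := ⟨⟨EuclideanSpace.single 0 1, by simp⟩⟩

instance : IsFiniteMeasure (μH[2] : Measure S2) := ⟨hausS_fin⟩

instance : (μH[2] : Measure S2).IsOpenPosMeasure where
  open_pos := by
    rintro U hU ⟨x, hx⟩ h0
    obtain ⟨ε, hε, hb⟩ := Metric.isOpen_iff.1 hU x hx
    have hb0 : ∀ y : S2, (μH[2] : Measure S2) (ball y ε) = 0 := fun y => by
      rw [hausS_ball y x]; exact measure_mono_null hb h0
    obtain ⟨t, -, ht⟩ := (isCompact_univ (X := S2)).elim_nhds_subcover (fun y => ball y ε)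
      (fun y _ => ball_mem_nhds y hε)
    have := measure_mono_null (ht) ((measure_biUnion_null_iff (t.countable_toSet)).2 (fun y _ => hb0 y))
    exact hausS_pos.ne' this

lemma exists_haus : ∃ c : ℝ, 0 < c ∧
    (μH[2] : Measure S2) = ENNReal.ofReal c • (volume : Measure E3).toSphere := by
  obtain ⟨c, h0, h1, h⟩ := christ (μH[2] : Measure S2) (volume : Measure E3).toSphere hausS_ball toS_ball
  exact ⟨c.toReal, ENNReal.toReal_pos h0 h1, by rw [ENNReal.ofReal_toReal h1, h]⟩

lemma haus_sphere (r : ℝ) (hr : 0 < r) :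
    (μH[2] : Measure E3).restrict (sphere 0 r)
      = ENNReal.ofReal (r^2) • Measure.map (fun ω : S2 => r • (ω : E3)) μH[2] := by
  ext s hs
  rw [Measure.restrict_apply hs, Measure.smul_apply, Measure.map_apply (by fun_prop) hs]
  have h0 : ∀ T : Set S2, (μH[2] : Measure S2) T = (μH[2] : Measure E3) (Subtype.val '' T) :=
    fun T => (isometry_subtype_coe.hausdorffMeasure_image (Or.inl (by norm_num)) _).symm
  rw [h0]
  have : s ∩ sphere 0 r = r • (Subtype.val '' ((fun ω : S2 => r • (ω : E3)) ⁻¹' s)) := by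
    ext x
    simp only [Set.mem_smul_set, Set.mem_image, Set.mem_preimage]
    constructor
    · rintro ⟨hx, hxr⟩
      have hxr : ‖x‖ = r := by simpa using hxr
      have hx' : r • r⁻¹ • x = x := by rw [smul_smul, mul_inv_cancel₀ hr.ne', one_smul]
      exact ⟨r⁻¹ • x, ⟨⟨r⁻¹ • x, by simp [norm_smul, abs_of_pos hr, hxr, hr.ne']⟩, by simpa [hx'] using hx, rfl⟩, hx'⟩
    · rintro ⟨_, ⟨ω, hω, rfl⟩, rfl⟩
      refine ⟨hω, ?_⟩
      have : ‖(ω : E3)‖ = 1 := by simpa using ω.2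
      simp [norm_smul, this, abs_of_pos hr]
  rw [this, Measure.hausdorffMeasure_smul₀ (by norm_num) hr.ne', smul_eq_mul, ENNReal.smul_def, smul_eq_mul]
  congr 1
  rw [ENNReal.ofReal]
  congr 1
  ext
  simp [abs_of_pos hr, hr.le]

lemma exists_haus_int : ∃ c : ℝ, 0 < c ∧ ∀ r : ℝ, 0 < r → ∀ f : E3 → ℝ,
    ∫ x in sphere (0 : E3) r, f x ∂μH[2]
      = c * r^2 * ∫ ω : S2, f (r • (ω : E3)) ∂(volume : Measure E3).toSphere := by
  obtain ⟨c, hc, h⟩ := exists_haus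
  refine ⟨c, hc, fun r hr f => ?_⟩
  rw [haus_sphere r hr, integral_smul_measure, ENNReal.toReal_ofReal (by positivity), h]
  have hemb : MeasurableEmbedding (fun ω : S2 => r • (ω : E3)) :=
    (Homeomorph.smulOfNeZero r hr.ne').measurableEmbedding.comp
      (MeasurableEmbedding.subtype_coe isClosed_sphere.measurableSet)
  rw [hemb.integral_map, integral_smul_measure, ENNReal.toReal_ofReal hc.le]
  simp only [smul_eq_mul]; ring

end PartA2

section PartA3
open scoped ENNReal Topology Pointwise

noncomputable abbrev sig : Measure S2 := (volume : Measure E3).toSphere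

noncomputable def sm {F : Type*} [NormedAddCommGroup F] [NormedSpace ℝ F] (f : E3 → F) (ρ : ℝ) : F :=
  ∫ ω : S2, f (ρ • (ω : E3)) ∂sig

lemma S2_norm (ω : S2) : ‖(ω : E3)‖ = 1 := by simp

lemma norm_smul_S2 {ρ : ℝ} (h : 0 ≤ ρ) (ω : S2) : ‖ρ • (ω : E3)‖ = ρ := by
  simp [norm_smul, abs_of_nonneg h]

noncomputable def polMeas : Measure (S2 × ℝ) :=
  sig.prod ((volume.restrict (Set.Ioi (0:ℝ))).withDensity (fun ρ => ENNReal.ofReal (ρ^2)))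

lemma lintegral_polar (f : E3 → ℝ≥0∞) (hf : Measurable f) :
    ∫⁻ x, f x = ∫⁻ p : S2 × ℝ, f (p.2 • (p.1 : E3)) ∂polMeas := by
  have h1 : ∫⁻ x, f x = ∫⁻ x : ({(0 : E3)}ᶜ : Set E3), f x ∂((volume : Measure E3).comap (↑)) := by
    rw [lintegral_subtype_comap (measurableSet_singleton _).compl, restrict_compl_singleton]
  have h2 := (volume : Measure E3).measurePreserving_homeomorphUnitSphereProd
  have h3 : ∫⁻ x : ({(0 : E3)}ᶜ : Set E3), f x ∂((volume : Measure E3).comap (↑))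
      = ∫⁻ p : S2 × Set.Ioi (0:ℝ), f ((p.2 : ℝ) • (p.1 : E3))
        ∂(sig.prod (Measure.volumeIoiPow (Module.finrank ℝ E3 - 1))) := by
    rw [← h2.lintegral_comp (by fun_prop)]
    refine lintegral_congr fun x => ?_
    congr 1
    have hx : ‖(x : E3)‖ ≠ 0 := norm_ne_zero_iff.2 (fun h => x.2 (by simp [h]))
    simp [smul_smul, hx]
  rw [h1, h3, polMeas]
  have hd : Module.finrank ℝ E3 - 1 = 2 := by simp
  rw [hd]
  have : SFinite (Measure.volumeIoiPow 2) := inferInstance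
  rw [lintegral_prod _ (by fun_prop), lintegral_prod _ (by fun_prop)]
  refine lintegral_congr fun ω => ?_
  rw [Measure.volumeIoiPow, lintegral_withDensity_eq_lintegral_mul _ (by fun_prop) (by fun_prop),
    lintegral_withDensity_eq_lintegral_mul _ (by fun_prop) (by fun_prop)]
  have := lintegral_subtype_comap (μ := volume) (measurableSet_Ioi (a := (0:ℝ)))
    ((fun ρ : ℝ => ENNReal.ofReal (ρ^2)) * (fun ρ : ℝ => f (ρ • (ω : E3))))
  exact this

lemma polar_map : MeasurePreserving (fun p : S2 × ℝ => p.2 • (p.1 : E3)) polMeas volume := by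
  refine ⟨by fun_prop, ?_⟩
  refine Measure.ext_of_lintegral _ fun f hf => ?_
  rw [lintegral_map hf (by fun_prop), lintegral_polar f hf]

lemma lintegral_polar' (f : E3 → ℝ≥0∞) (hf : Measurable f) :
    ∫⁻ x, f x = ∫⁻ ρ in Set.Ioi (0:ℝ), ENNReal.ofReal (ρ^2) * ∫⁻ ω : S2, f (ρ • (ω : E3)) ∂sig := by
  rw [lintegral_polar f hf, polMeas, lintegral_prod_symm _ (by fun_prop),
    lintegral_withDensity_eq_lintegral_mul _ (by fun_prop)]
  · rfl
  · exact Measurable.lintegral_prod_left' (f := fun p : S2 × ℝ => f (p.2 • (p.1 : E3))) (by fun_prop)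

section
variable {F : Type*} [NormedAddCommGroup F] [NormedSpace ℝ F]

lemma integral_polar (f : E3 → F) (hf : Integrable f) :
    ∫ x, f x = ∫ ρ in Set.Ioi (0:ℝ), ρ^2 • sm f ρ := by
  have h := polar_map
  have h2 : Integrable (fun p : S2 × ℝ => f (p.2 • (p.1 : E3))) polMeas := by
    have := h.integrable_comp hf.1 |>.2 hf
    exact this
  have h1 : ∫ x, f x = ∫ p : S2 × ℝ, f (p.2 • (p.1 : E3)) ∂polMeas := by
    rw [← h.map_eq]
    refine integral_map h.measurable.aemeasurable ?_
    rw [h.map_eq]; exact hf.1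
  rw [h1, polMeas, integral_prod_symm _ h2]
  have := integral_withDensity_eq_integral_smul (μ := volume.restrict (Set.Ioi (0:ℝ)))
    (f := fun ρ => Real.toNNReal (ρ^2)) (by fun_prop) (fun ρ => sm f ρ)
  refine (this).trans ?_
  refine setIntegral_congr_fun measurableSet_Ioi fun ρ _ => ?_
  simp [NNReal.smul_def, sq_nonneg]

lemma loc_bound {R : ℝ} (hR : 0 ≤ R) {f : E3 → F} (hf : ContinuousOn f {x | R < ‖x‖})
    {ρ : ℝ} (hρ : R < ρ) : ∃ ε > 0, ρ - ε > R ∧ ∃ C, ∀ t ∈ ball ρ ε, ∀ ω : S2, ‖f (t • (ω : E3))‖ ≤ C := by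
  have hK : IsCompact (closedBall (0:E3) (ρ + 1) ∩ {x | (R + ρ)/2 ≤ ‖x‖}) :=
    (isCompact_closedBall _ _).inter_right (isClosed_le (by fun_prop) (by fun_prop))
  obtain ⟨C, hC⟩ := hK.exists_bound_of_continuousOn (hf.mono (by
    rintro x ⟨_, hx⟩
    simp only [Set.mem_ofPred_eq] at hx ⊢
    linarith))
  refine ⟨min 1 ((ρ - R)/2), lt_min one_pos (by linarith), by
    have := min_le_right 1 ((ρ-R)/2); linarith, C, fun t ht ω => hC _ ?_⟩
  rw [mem_ball, Real.dist_eq, abs_lt] at ht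
  have h1 := min_le_left 1 ((ρ-R)/2)
  have h2 := min_le_right 1 ((ρ-R)/2)
  have : 0 ≤ t := by linarith
  constructor
  · rw [mem_closedBall_zero_iff, norm_smul_S2 this]; linarith
  · simp only [Set.mem_ofPred_eq]; rw [norm_smul_S2 this]; linarith

lemma cont_slice {R : ℝ} (hR : 0 ≤ R) {f : E3 → F} (hf : ContinuousOn f {x | R < ‖x‖})
    {ρ : ℝ} (hρ : R < ρ) : Continuous (fun ω : S2 => f (ρ • (ω : E3))) := by
  refine hf.comp_continuous (by fun_prop) fun ω => ?_
  simp only [Set.mem_ofPred_eq]; rw [norm_smul_S2 (by linarith)]; exact hρ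

lemma int_of_cont {f : S2 → F} (hf : Continuous f) : Integrable f sig := by
  have := hf.continuousOn.integrableOn_compact (μ := sig) isCompact_univ
  simpa using this

lemma sm_int {R : ℝ} (hR : 0 ≤ R) {f : E3 → F} (hf : ContinuousOn f {x | R < ‖x‖})
    {ρ : ℝ} (hρ : R < ρ) : Integrable (fun ω : S2 => f (ρ • (ω : E3))) sig :=
  int_of_cont (cont_slice hR hf hρ)

lemma sm_cont {R : ℝ} (hR : 0 ≤ R) {f : E3 → F} (hf : ContinuousOn f {x | R < ‖x‖}) :
    ContinuousOn (sm f) (Set.Ioi R) := by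
  intro ρ hρ
  refine ContinuousAt.continuousWithinAt ?_
  obtain ⟨ε, hε, h1, C, hC⟩ := loc_bound hR hf hρ
  have hb : ∀ t ∈ ball ρ ε, R < t := fun t ht => by
    rw [mem_ball, Real.dist_eq, abs_lt] at ht; linarith
  refine continuousAt_of_dominated (bound := fun _ => C) ?_ ?_ (integrable_const _) ?_
  · filter_upwards [ball_mem_nhds ρ hε] with t ht
    exact (sm_int hR hf (hb t ht)).1
  · filter_upwards [ball_mem_nhds ρ hε] with t ht
    exact Eventually.of_forall (hC t ht)
  · refine Eventually.of_forall fun ω => ?_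
    have hx : ρ • (ω : E3) ∈ {x : E3 | R < ‖x‖} := by
      simp only [Set.mem_ofPred_eq]; rw [norm_smul_S2 (by linarith [hb ρ (mem_ball_self hε)])]; exact hρ
    have := hf.continuousAt ((isOpen_lt (by fun_prop) (by fun_prop)).mem_nhds hx)
    exact ContinuousAt.comp (f := fun t : ℝ => t • (ω : E3)) this (by fun_prop)

def Om (R : ℝ) : Set E3 := {x | R < ‖x‖}
lemma isOpen_Om (R : ℝ) : IsOpen (Om R) := isOpen_lt (by fun_prop) (by fun_prop)
lemma mem_Om {R ρ : ℝ} (hR : 0 ≤ R) (hρ : R < ρ) (ω : S2) : ρ • (ω : E3) ∈ Om R := by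
  simp only [Om, Set.mem_ofPred_eq]; rw [norm_smul_S2 (by linarith)]; exact hρ

lemma radial_smul {ρ : ℝ} (hρ : 0 < ρ) (ω : S2) : ‖ρ • (ω : E3)‖⁻¹ • (ρ • (ω : E3)) = ω := by
  rw [norm_smul_S2 hρ.le, smul_smul, inv_mul_cancel₀ hρ.ne', one_smul]

lemma cont_radial {R : ℝ} (hR : 0 ≤ R) {f : E3 → F} (hf : ContDiffOn ℝ 1 f (Om R)) :
    ContinuousOn (fun x => fderiv ℝ f x (‖x‖⁻¹ • x)) (Om R) := by
  have h := hf.continuousOn_fderiv_of_isOpen (isOpen_Om R) le_rfl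
  refine h.clm_apply ?_
  have h2 : ContinuousOn (fun x : E3 => ‖x‖) (Om R) := by fun_prop
  refine ContinuousOn.smul (h2.inv₀ ?_) continuousOn_id
  intro x hx
  simp only [Om, Set.mem_ofPred_eq] at hx
  linarith

lemma sm_deriv {R : ℝ} (hR : 0 ≤ R) {f : E3 → F} (hf : ContDiffOn ℝ 1 f (Om R))
    {ρ : ℝ} (hρ : R < ρ) :
    HasDerivAt (sm f) (sm (fun x => fderiv ℝ f x (‖x‖⁻¹ • x)) ρ) ρ := by
  have hc := cont_radial hR hf
  obtain ⟨ε, hε, h1, C, hC⟩ := loc_bound hR hc hρ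
  have hb : ∀ t ∈ ball ρ ε, R < t := fun t ht => by
    rw [mem_ball, Real.dist_eq, abs_lt] at ht; linarith
  refine (hasDerivAt_integral_of_dominated_loc_of_deriv_le (μ := sig)
    (F := fun t (ω : S2) => f (t • (ω : E3))) (bound := fun _ => C)
    (F' := fun t (ω : S2) => fderiv ℝ f (t • (ω:E3)) (‖t • (ω : E3)‖⁻¹ • (t • (ω : E3))))
    (ball_mem_nhds ρ hε) ?_ (sm_int hR hf.continuousOn hρ) (sm_int hR hc hρ).1 ?_ (integrable_const _) ?_).2
  · filter_upwards [ball_mem_nhds ρ hε] with t ht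
    exact (sm_int hR hf.continuousOn (hb t ht)).1
  · exact Eventually.of_forall fun ω t ht => hC t ht ω
  · refine Eventually.of_forall fun ω t ht => ?_
    have ht0 := hb t ht
    simp only [radial_smul (hR.trans_lt ht0)]
    have hd : HasFDerivAt f (fderiv ℝ f (t • (ω:E3))) (t • (ω:E3)) :=
      ((hf.contDiffAt ((isOpen_Om R).mem_nhds (mem_Om hR ht0 ω))).differentiableAt (by norm_num)).hasFDerivAt
    have h2 : HasDerivAt (fun t : ℝ => t • (ω:E3)) ((1:ℝ) • (ω:E3)) t := (hasDerivAt_id t).smul_const _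
    rw [one_smul] at h2
    exact hd.comp_hasDerivAt t h2
end

end PartA3

section PartA4
open scoped ENNReal Topology Pointwise

noncomputable abbrev ee (i : Fin 3) : E3 := EuclideanSpace.single i 1

lemma inner_ee (x : E3) (i : Fin 3) : inner ℝ x (ee i) = x i := by
  simp [ee, EuclideanSpace.inner_single_right]

lemma norm_hasFDeriv {x : E3} (hx : x ≠ 0) :
    HasFDerivAt (fun x : E3 => ‖x‖) (‖x‖⁻¹ • innerSL ℝ x) x := by
  have h1 : HasFDerivAt (fun x : E3 => ‖x‖^2) (2 • innerSL ℝ x) x := (hasStrictFDerivAt_norm_sq x).hasFDerivAt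
  have hx' : ‖x‖ ≠ 0 := norm_ne_zero_iff.2 hx
  have h2 := h1.sqrt (by positivity)
  have h3 : (fun x : E3 => √(‖x‖^2)) = fun x => ‖x‖ := by ext y; simp
  rw [h3] at h2
  have h4 : (1 / (2 * √(‖x‖ ^ 2))) • (2:ℕ) • (innerSL ℝ) x = ‖x‖⁻¹ • innerSL ℝ x := by
    rw [Real.sqrt_sq (norm_nonneg x), ← Nat.cast_smul_eq_nsmul ℝ, smul_smul]
    congr 1
    push_cast
    field_simp
  rw [← h4]
  exact h2

section
variable {F : Type*} [NormedAddCommGroup F] [NormedSpace ℝ F]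

lemma cs_cont {X : Type*} [TopologicalSpace X] {s : X → ℝ} (hs : Continuous s) {U : Set X}
    (hU : IsOpen U) (hsub : tsupport s ⊆ U) {f : X → F} (hf : ContinuousOn f U) :
    Continuous (fun x => s x • f x) := by
  rw [continuous_iff_continuousAt]
  intro x
  by_cases hx : x ∈ tsupport s
  · exact hs.continuousAt.smul (hf.continuousAt (hU.mem_nhds (hsub hx)))
  · rw [notMem_tsupport_iff_eventuallyEq] at hx
    have : (fun x => s x • f x) =ᶠ[𝓝 x] fun _ => 0 := by
      filter_upwards [hx] with y hy
      simp [hy]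
    exact this.continuousAt

lemma cs_int {X : Type*} [TopologicalSpace X] [MeasurableSpace X] [OpensMeasurableSpace X]
    [T2Space X] {μ : Measure X} [IsFiniteMeasureOnCompacts μ]
    {s : X → ℝ} (hs : Continuous s) (hc : HasCompactSupport s) {U : Set X}
    (hU : IsOpen U) (hsub : tsupport s ⊆ U) {f : X → F} (hf : ContinuousOn f U) :
    Integrable (fun x => s x • f x) μ :=
  (cs_cont hs hU hsub hf).integrable_of_hasCompactSupport (hc.smul_right)

lemma contDiff_normx {R : ℝ} (hR : 0 ≤ R) (i : Fin 3) :
    ContDiffOn ℝ 1 (fun x : E3 => ‖x‖⁻¹ * x i) (Om R) := by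
  intro x hx
  have hx' : x ≠ 0 := by
    rintro rfl; simp [Om] at hx; linarith
  refine ContDiffAt.contDiffWithinAt ?_
  refine ContDiffAt.mul ((contDiffAt_norm ℝ hx').inv (by simpa using hx')) ?_
  fun_prop

/-- radial component of a vector field -/
noncomputable def rc (G : Fin 3 → E3 → F) (x : E3) : F := ∑ i, (‖x‖⁻¹ * x i) • G i x
noncomputable def dv (G : Fin 3 → E3 → F) (x : E3) : F := ∑ i, fderiv ℝ (G i) x (ee i)

lemma rc_contDiff {R : ℝ} (hR : 0 ≤ R) {G : Fin 3 → E3 → F} (hG : ∀ i, ContDiffOn ℝ 1 (G i) (Om R)) :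
    ContDiffOn ℝ 1 (rc G) (Om R) := by
  unfold rc
  exact ContDiffOn.sum fun i _ => (contDiff_normx hR i).smul (hG i)

lemma dv_cont {R : ℝ} {G : Fin 3 → E3 → F} (hG : ∀ i, ContDiffOn ℝ 1 (G i) (Om R)) :
    ContinuousOn (dv G) (Om R) := by
  unfold dv
  refine continuousOn_finsetSum _ fun i _ => ?_
  exact ((hG i).continuousOn_fderiv_of_isOpen (isOpen_Om R) le_rfl).clm_apply continuousOn_const

lemma weak_div {R : ℝ} (hR : 0 ≤ R) {G : Fin 3 → E3 → F} (hG : ∀ i, ContDiffOn ℝ 1 (G i) (Om R))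
    {ψ : ℝ → ℝ} (hψ : ContDiff ℝ ((⊤ : ℕ∞) : WithTop ℕ∞) ψ) (hc : HasCompactSupport ψ) (hs : tsupport ψ ⊆ Set.Ioi R) :
    ∫ ρ in Set.Ioi (0:ℝ), ρ^2 • (ψ ρ • sm (dv G) ρ) = - ∫ ρ in Set.Ioi (0:ℝ), ρ^2 • (deriv ψ ρ • sm (rc G) ρ) := by
  have hψ1 : Continuous (deriv ψ) := (hψ.continuous_deriv (by simp))
  have hts : ∀ f : ℝ → ℝ, tsupport f ⊆ Set.Ioi R → tsupport (fun x : E3 => f ‖x‖) ⊆ Om R := by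
    intro f hf x hx
    exact hf (tsupport_comp_subset_preimage f (f := fun x : E3 => ‖x‖) (by fun_prop) hx)
  have hcs : ∀ f : ℝ → ℝ, HasCompactSupport f → HasCompactSupport (fun x : E3 => f ‖x‖) := by
    intro f hf
    obtain ⟨B, hB⟩ := hf.isCompact.isBounded.exists_norm_le
    refine HasCompactSupport.of_support_subset_isCompact (isCompact_closedBall (0:E3) B) fun x hx => ?_
    have := hB ‖x‖ (subset_tsupport f hx)
    simpa using this
  have hs1 : tsupport (deriv ψ) ⊆ Set.Ioi R := (tsupport_deriv_subset).trans hs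
  have hc1 : HasCompactSupport (deriv ψ) := hc.deriv
  have hψd : ∀ x, HasDerivAt ψ (deriv ψ x) x := fun x =>
    (hψ.differentiable (by simp)).differentiableAt.hasDerivAt
  have hfd : ∀ x : E3, ∀ v, HasFDerivAt (fun x : E3 => ψ ‖x‖) (fderiv ℝ (fun x : E3 => ψ ‖x‖) x) x ∧
      fderiv ℝ (fun x : E3 => ψ ‖x‖) x v = deriv ψ ‖x‖ * (‖x‖⁻¹ * inner ℝ x v) := by
    intro x v
    by_cases hx : x = 0
    · have h0 : (0:ℝ) ∉ tsupport ψ := fun h => by have := hs h; simp at this; linarith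
      have h0' : ‖x‖ ∉ tsupport ψ := by simpa [hx] using h0
      have h1 : x ∉ tsupport (fun x : E3 => ψ ‖x‖) := fun h => by
        have := hts ψ hs h; simp [Om, hx] at this; linarith
      rw [notMem_tsupport_iff_eventuallyEq] at h1
      have h2 : HasFDerivAt (fun x : E3 => ψ ‖x‖) (0 : E3 →L[ℝ] ℝ) x :=
        (hasFDerivAt_const (0:ℝ) x).congr_of_eventuallyEq h1
      refine ⟨h2.differentiableAt.hasFDerivAt, ?_⟩
      rw [h2.fderiv]; simp [hx]
    · have h := (hψd ‖x‖).comp_hasFDerivAt x (norm_hasFDeriv hx)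
      refine ⟨h.differentiableAt.hasFDerivAt, ?_⟩
      have h2 := h.fderiv
      simp only [Function.comp_def] at h2
      rw [h2]; simp
  have hi1 : ∀ i, Integrable (fun x : E3 => ψ ‖x‖ • fderiv ℝ (G i) x (ee i)) := fun i =>
    cs_int (hψ.continuous.comp continuous_norm) (hcs _ hc) (isOpen_Om R) (hts _ hs)
      (((hG i).continuousOn_fderiv_of_isOpen (isOpen_Om R) le_rfl).clm_apply continuousOn_const)
  have hi2 : ∀ i, Integrable (fun x : E3 => deriv ψ ‖x‖ • ((‖x‖⁻¹ * x i) • G i x)) := fun i =>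
    cs_int (hψ1.comp continuous_norm) (hcs _ hc1) (isOpen_Om R) (hts _ hs1)
      ((contDiff_normx hR i).continuousOn.smul (hG i).continuousOn)
  have key : ∀ i, ∫ x : E3, ψ ‖x‖ • fderiv ℝ (G i) x (ee i)
      = - ∫ x : E3, deriv ψ ‖x‖ • ((‖x‖⁻¹ * x i) • G i x) := by
    intro i
    have he : ∀ x : E3, fderiv ℝ (fun x : E3 => ψ ‖x‖) x (ee i) • G i x
        = deriv ψ ‖x‖ • ((‖x‖⁻¹ * x i) • G i x) := fun x => by
      rw [(hfd x (ee i)).2, inner_ee, smul_smul]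
    have := integral_smul_fderiv_eq_neg_fderiv_smul_of_integrable (μ := (volume : Measure E3))
      (f := fun x : E3 => ψ ‖x‖) (g := G i) (v := ee i) (by simp only [he]; exact hi2 i) (hi1 i)
      (cs_int (hψ.continuous.comp continuous_norm) (hcs _ hc) (isOpen_Om R) (hts _ hs) (hG i).continuousOn)
      (fun x _ => (hfd x 0).1.differentiableAt)
      (fun x hx => ((hG i).contDiffAt ((isOpen_Om R).mem_nhds (hts _ hs hx))).differentiableAt (by norm_num))
    rw [this]; simp only [he]
  have e1 : ∫ x : E3, ψ ‖x‖ • dv G x = - ∫ x : E3, deriv ψ ‖x‖ • rc G x := by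
    simp only [dv, rc, Finset.smul_sum]
    rw [integral_finsetSum _ (fun i _ => hi1 i), integral_finsetSum _ (fun i _ => hi2 i),
      ← Finset.sum_neg_distrib]
    exact Finset.sum_congr rfl fun i _ => key i
  have i1 : Integrable (fun x : E3 => ψ ‖x‖ • dv G x) := by
    simp only [dv, Finset.smul_sum]; exact integrable_finsetSum _ fun i _ => hi1 i
  have i2 : Integrable (fun x : E3 => deriv ψ ‖x‖ • rc G x) := by
    simp only [rc, Finset.smul_sum]; exact integrable_finsetSum _ fun i _ => hi2 i
  rw [integral_polar _ i1, integral_polar _ i2] at e1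
  convert e1 using 1
  · refine setIntegral_congr_fun measurableSet_Ioi fun ρ hρ => ?_
    simp only [sm]
    congr 1
    rw [← integral_smul]
    refine integral_congr_ae (Eventually.of_forall fun ω => ?_)
    simp only [norm_smul_S2 (le_of_lt hρ)]
  · congr 1
    refine setIntegral_congr_fun measurableSet_Ioi fun ρ hρ => ?_
    simp only [sm]
    congr 1
    rw [← integral_smul]
    refine integral_congr_ae (Eventually.of_forall fun ω => ?_)
    simp only [norm_smul_S2 (le_of_lt hρ)]

lemma sm_div [CompleteSpace F] {R : ℝ} (hR : 0 ≤ R) {G : Fin 3 → E3 → F} (hG : ∀ i, ContDiffOn ℝ 1 (G i) (Om R))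
    {ρ : ℝ} (hρ : R < ρ) :
    HasDerivAt (sm (rc G)) (sm (dv G) ρ - (2/ρ) • sm (rc G) ρ) ρ := by
  have hrc := rc_contDiff hR hG
  have hP := fun t (ht : R < t) => sm_deriv hR hrc ht
  set P := sm (rc G) with hPdef
  set P' := sm (fun x => fderiv ℝ (rc G) x (‖x‖⁻¹ • x)) with hP'def
  have cP : ContinuousOn P (Set.Ioi R) := sm_cont hR hrc.continuousOn
  have cP' : ContinuousOn P' (Set.Ioi R) := sm_cont hR (cont_radial hR hrc)
  have cd : ContinuousOn (sm (dv G)) (Set.Ioi R) := sm_cont hR (dv_cont hG)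
  set W : ℝ → F := fun t => t^2 • sm (dv G) t - (t^2 • P' t + (2*t) • P t) with hW
  have cW : ContinuousOn W (Set.Ioi R) := by
    refine ContinuousOn.sub (ContinuousOn.smul (by fun_prop) cd)
      (ContinuousOn.add (ContinuousOn.smul (by fun_prop) cP') (ContinuousOn.smul (by fun_prop) cP))
  have hz : ∀ᵐ x ∂(volume : Measure ℝ), x ∈ Set.Ioi R → W x = 0 := by
    refine isOpen_Ioi.ae_eq_zero_of_integral_contDiff_smul_eq_zero
      (cW.locallyIntegrableOn measurableSet_Ioi) fun ψ hψ hc hs => ?_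
    have w := weak_div hR hG hψ hc hs
    have hψ1 : Continuous (deriv ψ) := (hψ.continuous_deriv (by simp))
    have hs1 : tsupport (deriv ψ) ⊆ Set.Ioi R := (tsupport_deriv_subset).trans hs
    have hc1 : HasCompactSupport (deriv ψ) := hc.deriv
    have hψd : ∀ x, HasDerivAt ψ (deriv ψ x) x := fun x =>
      (hψ.differentiable (by simp)).differentiableAt.hasDerivAt
    have hrest : ∀ (f : ℝ → ℝ) (g : ℝ → F), tsupport f ⊆ Set.Ioi R →
        ∫ t in Set.Ioi (0:ℝ), t^2 • (f t • g t) = ∫ t, f t • (t^2 • g t) := by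
      intro f g hf
      rw [setIntegral_eq_integral_of_forall_compl_eq_zero]
      · congr 1; ext t; rw [smul_comm]
      · intro t ht
        have : f t = 0 := by
          by_contra h
          have := hf (subset_tsupport f h)
          simp at this ht; linarith
        simp [this]
    rw [hrest ψ _ hs, hrest (deriv ψ) _ hs1] at w
    have c2 : ContinuousOn (fun t : ℝ => t^2 • P t) (Set.Ioi R) := ContinuousOn.smul (by fun_prop) cP
    have c2' : ContinuousOn (fun t : ℝ => t^2 • P' t + (2*t) • P t) (Set.Ioi R) :=
      ContinuousOn.add (ContinuousOn.smul (by fun_prop) cP') (ContinuousOn.smul (by fun_prop) cP)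
    have c3 : ContinuousOn (fun t : ℝ => t^2 • sm (dv G) t) (Set.Ioi R) := ContinuousOn.smul (by fun_prop) cd
    have ib := integral_bilinear_hasDerivAt_right_eq_neg_left_of_integrable
      (L := ContinuousLinearMap.lsmul ℝ ℝ (E := F)) (u := ψ) (u' := deriv ψ)
      (v := fun t => t^2 • P t) (v' := fun t => t^2 • P' t + (2*t) • P t)
      (fun x _ => hψd x) (fun x hx => by
        have h1 : HasDerivAt (fun t : ℝ => t^2) (2*x) x := by simpa using hasDerivAt_pow 2 x
        exact h1.smul (hP x (hs hx)))
      (cs_int hψ.continuous hc isOpen_Ioi hs c2') (cs_int hψ1 hc1 isOpen_Ioi hs1 c2)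
      (cs_int hψ.continuous hc isOpen_Ioi hs c2)
    simp only [ContinuousLinearMap.lsmul_apply] at ib
    simp only [hW, smul_sub]
    rw [integral_sub (cs_int hψ.continuous hc isOpen_Ioi hs c3) (cs_int hψ.continuous hc isOpen_Ioi hs c2'),
      w, ib, sub_self]
  have hz2 : Set.EqOn W (fun _ => 0) (Set.Ioi R) :=
    Measure.eqOn_open_of_ae_eq (μ := (volume : Measure ℝ)) ((ae_restrict_iff' measurableSet_Ioi).2 hz)
      isOpen_Ioi cW continuousOn_const
  have h0 := hz2 hρ
  have hρ0 : ρ ≠ 0 := by linarith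
  have : P' ρ = sm (dv G) ρ - (2/ρ) • P ρ := by
    simp only [hW] at h0
    have h1 : (ρ^2)⁻¹ • (ρ ^ 2 • sm (dv G) ρ - (ρ ^ 2 • P' ρ + (2 * ρ) • P ρ)) = 0 := by rw [h0, smul_zero]
    rw [smul_sub, smul_add, smul_smul, smul_smul, smul_smul, inv_mul_cancel₀ (by positivity), one_smul, one_smul] at h1
    have h2 : (ρ^2)⁻¹ * (2 * ρ) = 2 / ρ := by field_simp
    rw [h2, sub_eq_zero] at h1
    rw [h1]; abel
  rw [← this]
  exact hP ρ hρ
end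

end PartA4

section PartA5
open scoped ENNReal Topology Pointwise

noncomputable def rotL (t : ℝ) : (E3 × E3) →ₗ[ℝ] (E3 × E3) where
  toFun p := (Real.cos t • p.1 + Real.sin t • p.2, -Real.sin t • p.1 + Real.cos t • p.2)
  map_add' p q := by ext1 <;> simp <;> abel
  map_smul' c p := by
    ext1 <;> simp [smul_comm c]

lemma rot_det (t : ℝ) : |LinearMap.det (rotL t)| = 1 := by
  set J : (E3 × E3) →ₗ[ℝ] (E3 × E3) := LinearMap.prodMap LinearMap.id (-LinearMap.id) with hJ
  have h1 : J * J = 1 := by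
    ext1 <;> ext1 <;> simp [hJ]
  have h2 : J * rotL t * J * rotL t = 1 := by
    refine LinearMap.ext fun p => ?_
    have hcs : Real.cos t * Real.cos t + Real.sin t * Real.sin t = 1 := by
      have := Real.cos_sq_add_sin_sq t; nlinarith
    have e : ∀ x : E3, x = (Real.cos t * Real.cos t + Real.sin t * Real.sin t) • x := fun x => by rw [hcs, one_smul]
    ext1
    · simp only [hJ, Module.End.mul_apply, rotL, LinearMap.prodMap_apply, LinearMap.id_apply, LinearMap.neg_apply,
        LinearMap.coe_mk, AddHom.coe_mk, Module.End.one_apply]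
      conv_rhs => rw [e p.1]
      module
    · simp only [hJ, Module.End.mul_apply, rotL, LinearMap.prodMap_apply, LinearMap.id_apply, LinearMap.neg_apply,
        LinearMap.coe_mk, AddHom.coe_mk, Module.End.one_apply]
      conv_rhs => rw [e p.2]
      module
  have d1 : LinearMap.det J * LinearMap.det J = 1 := by rw [← map_mul, h1, map_one]
  have d2 : LinearMap.det J * LinearMap.det (rotL t) * LinearMap.det J * LinearMap.det (rotL t) = 1 := by
    rw [← map_mul, ← map_mul, ← map_mul, h2, map_one]
  have d3 : LinearMap.det (rotL t) ^ 2 = 1 := by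
    calc _ = (LinearMap.det J * LinearMap.det J) * LinearMap.det (rotL t) ^ 2 := by rw [d1, one_mul]
      _ = 1 := by rw [← d2]; ring
  exact (pow_eq_one_iff_of_nonneg (abs_nonneg _) two_ne_zero).1 (by rw [sq_abs, d3])

lemma rot_mp (t : ℝ) : MeasurePreserving (rotL t) (volume : Measure (E3 × E3)) volume := by
  refine ⟨(rotL t).continuous_of_finiteDimensional.measurable, ?_⟩
  have hd : LinearMap.det (rotL t) ≠ 0 := by
    intro h; have := rot_det t; rw [h] at this; simp at this
  have hv : (volume : Measure (E3 × E3)) = (volume : Measure E3).prod volume := rfl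
  have hh : (volume : Measure (E3 × E3)).IsAddHaarMeasure := by rw [hv]; infer_instance
  rw [Measure.map_linearMap_addHaar_eq_smul_addHaar _ hd, abs_inv, rot_det]
  simp

lemma ae_indep : ∀ᵐ p : E3 × E3, ‖p.1‖^2 * ‖p.2‖^2 ≠ (inner ℝ p.1 p.2)^2 := by
  have hm : MeasurableSet {p : E3 × E3 | ‖p.1‖^2 * ‖p.2‖^2 = (inner ℝ p.1 p.2)^2} :=
    (isClosed_eq (by fun_prop) (by fun_prop)).measurableSet
  rw [ae_iff]
  simp only [ne_eq, not_not]
  change (volume.prod volume) _ = 0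
  rw [Measure.measure_prod_null hm]
  have h0 : ∀ᵐ x : E3, x ≠ 0 := by
    rw [ae_iff]; simp
  filter_upwards [h0] with x hx
  have hsub : (Prod.mk x ⁻¹' {p : E3 × E3 | ‖p.1‖^2 * ‖p.2‖^2 = (inner ℝ p.1 p.2)^2})
      ⊆ (Submodule.span ℝ {x} : Set E3) := by
    intro y hy
    simp only [Set.mem_preimage, Set.mem_ofPred_eq] at hy
    have hx2 : ‖x‖^2 ≠ 0 := by simpa using hx
    have hz : ‖‖x‖^2 • y - inner ℝ x y • x‖^2 = 0 := by
      rw [@norm_sub_sq_real, norm_smul, norm_smul, inner_smul_left, inner_smul_right, real_inner_comm]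
      simp only [Real.norm_eq_abs, mul_pow, sq_abs, conj_trivial, real_inner_comm x y]
      linear_combination (‖x‖^2) * hy
    have hz' : ‖x‖^2 • y = inner ℝ x y • x := by
      rw [← sub_eq_zero, ← norm_eq_zero]; simpa using hz
    have : y = ((‖x‖^2)⁻¹ * inner ℝ x y) • x := by
      rw [← smul_smul, ← hz', smul_smul, inv_mul_cancel₀ hx2, one_smul]
    rw [this]
    exact Submodule.smul_mem _ _ (Submodule.mem_span_singleton_self x)
  refine measure_mono_null hsub (Measure.addHaar_submodule _ _ ?_)
  intro h
  have h1 := finrank_span_singleton (K := ℝ) hx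
  rw [h, finrank_top] at h1
  simp at h1

lemma cs_real {X : Type*} [MeasurableSpace X] {μ : Measure X} {f g : X → ℝ}
    (hf : Integrable (fun x => f x ^ 2) μ) (hfg : Integrable (fun x => f x * g x) μ)
    (hg : Integrable (fun x => g x ^ 2) μ) :
    (∫ x, f x * g x ∂μ)^2 ≤ (∫ x, f x ^ 2 ∂μ) * ∫ x, g x ^ 2 ∂μ := by
  have h : ∀ t : ℝ, 0 ≤ (∫ x, f x ^ 2 ∂μ) * (t * t) + (2 * ∫ x, f x * g x ∂μ) * t + ∫ x, g x ^ 2 ∂μ := by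
    intro t
    have : ∫ x, (t * f x + g x)^2 ∂μ
        = (∫ x, f x ^ 2 ∂μ) * (t * t) + (2 * ∫ x, f x * g x ∂μ) * t + ∫ x, g x ^ 2 ∂μ := by
      have e : ∀ x, (t * f x + g x)^2 = ((t*t) * f x ^2 + (2*t) * (f x * g x)) + g x ^ 2 := fun x => by ring
      simp only [e]
      have i1 : Integrable (fun x => (t*t) * f x ^2 + (2*t) * (f x * g x)) μ :=
        (hf.const_mul _).add (hfg.const_mul _)
      rw [integral_add i1 hg,
        integral_add (hf.const_mul _) (hfg.const_mul _), integral_const_mul, integral_const_mul]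
      ring
    rw [← this]
    exact integral_nonneg fun x => sq_nonneg _
  have := discrim_le_zero h
  unfold discrim at this
  nlinarith

end PartA5

section PartA6
open scoped ENNReal Topology Pointwise

lemma norm_dir_deriv {γ : ℝ → E3} {γ' : E3} {t : ℝ} (h : HasDerivAt γ γ' t) (h0 : γ t ≠ 0) :
    ∃ w : E3, HasDerivAt (fun s => ‖γ s‖⁻¹ • γ s) w t ∧ ‖w‖ ≤ 2 * ‖γ'‖ / ‖γ t‖ := by
  have hn : ‖γ t‖ ≠ 0 := norm_ne_zero_iff.2 h0
  have h1 : HasDerivAt (fun s => ‖γ s‖) ((‖γ t‖⁻¹ • innerSL ℝ (γ t)) γ') t :=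
    (norm_hasFDeriv h0).comp_hasDerivAt t h
  have h2 := (h1.inv hn).smul h
  refine ⟨_, h2, ?_⟩
  have e : |inner ℝ (γ t) γ'| ≤ ‖γ t‖ * ‖γ'‖ := abs_real_inner_le_norm _ _
  refine (norm_add_le _ _).trans ?_
  rw [norm_smul, norm_smul]
  simp only [ContinuousLinearMap.smul_apply, innerSL_apply_apply, smul_eq_mul, Pi.inv_apply, norm_inv, norm_norm,
    norm_div, norm_neg, norm_mul, norm_pow, Real.norm_eq_abs, abs_norm]
  have hp : 0 < ‖γ t‖ := norm_pos_iff.2 h0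
  have : ‖γ t‖⁻¹ * |inner ℝ (γ t) γ'| / ‖γ t‖^2 * ‖γ t‖ ≤ ‖γ'‖ / ‖γ t‖ := by
    calc _ ≤ ‖γ t‖⁻¹ * (‖γ t‖ * ‖γ'‖) / ‖γ t‖^2 * ‖γ t‖ := by gcongr
      _ = _ := by field_simp
  calc _ ≤ ‖γ t‖⁻¹ * ‖γ'‖ + ‖γ'‖ / ‖γ t‖ := by exact add_le_add le_rfl this
    _ = _ := by field_simp; ring

noncomputable def pG (u : E3 → ℂ) (ρ : ℝ) (z v : E3) : ℝ :=
  ρ * ‖fderiv ℝ u (ρ • ‖z‖⁻¹ • z)‖ * (2 * ‖v‖ / ‖z‖)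

lemma dir_mem {R ρ : ℝ} (hR : 0 ≤ R) (hρ : R < ρ) {z : E3} (hz : z ≠ 0) : ρ • ‖z‖⁻¹ • z ∈ Om R := by
  have hn : ‖z‖ ≠ 0 := norm_ne_zero_iff.2 hz
  simp only [Om, Set.mem_ofPred_eq, norm_smul, Real.norm_eq_abs, abs_inv, abs_norm, inv_mul_cancel₀ hn,
    abs_of_pos (hR.trans_lt hρ)]
  linarith

lemma path_est {R : ℝ} (hR : 0 ≤ R) {u : E3 → ℂ} (hu : ContDiffOn ℝ 1 u (Om R)) {ρ : ℝ} (hρ : R < ρ)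
    (x y : E3) (hxy : ‖x‖^2 * ‖y‖^2 ≠ (inner ℝ x y)^2) :
    ENNReal.ofReal (‖u (ρ • ‖y‖⁻¹ • y) - u (ρ • ‖x‖⁻¹ • x)‖^2) ≤
      ENNReal.ofReal (Real.pi/2) * ∫⁻ t in Set.Ioc 0 (Real.pi/2),
        ENNReal.ofReal (pG u ρ (rotL t (x, y)).1 (rotL t (x,y)).2 ^ 2) := by
  set γ : ℝ → E3 := fun t => Real.cos t • x + Real.sin t • y with hγ
  set γ' : ℝ → E3 := fun t => -Real.sin t • x + Real.cos t • y with hγ'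
  have hd : ∀ t, HasDerivAt γ (γ' t) t := fun t =>
    ((Real.hasDerivAt_cos t).smul_const x).add ((Real.hasDerivAt_sin t).smul_const y)
  have h0 : ∀ t, γ t ≠ 0 := by
    intro t ht
    apply hxy
    have e1 : Real.cos t • x = - (Real.sin t • y) := eq_neg_of_add_eq_zero_left ht
    have hcs := Real.cos_sq_add_sin_sq t
    have a1 : Real.cos t ^ 2 * ‖x‖^2 = Real.sin t^2 * ‖y‖^2 := by
      have := congrArg (fun z => ‖z‖^2) e1
      simpa [norm_smul, mul_pow] using this
    have a2 : Real.cos t * inner ℝ x y = - Real.sin t * ‖y‖^2 := by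
      have := congrArg (fun z => inner ℝ z y) e1
      simpa [inner_smul_left, inner_neg_left] using this
    have a3 : Real.cos t * ‖x‖^2 = - Real.sin t * inner ℝ x y := by
      have := congrArg (fun z => inner ℝ x z) e1
      simpa [inner_smul_right, inner_neg_right] using this
    have b1 : Real.cos t ^ 2 * (‖x‖^2 * ‖y‖^2 - (inner ℝ x y)^2) = 0 := by
      linear_combination ‖y‖^2 * a1 - (Real.cos t * inner ℝ x y - Real.sin t * ‖y‖^2) * a2
    have b2 : Real.sin t ^ 2 * (‖x‖^2 * ‖y‖^2 - (inner ℝ x y)^2) = 0 := by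
      linear_combination - ‖x‖^2 * a1 + (Real.cos t * ‖x‖^2 - Real.sin t * inner ℝ x y) * a3
    have : ‖x‖^2 * ‖y‖^2 - (inner ℝ x y)^2 = 0 := by
      calc _ = (Real.cos t^2 + Real.sin t^2) * (‖x‖^2 * ‖y‖^2 - (inner ℝ x y)^2) := by rw [hcs, one_mul]
        _ = 0 := by linear_combination b1 + b2
    linarith
  have hρ0 : 0 < ρ := hR.trans_lt hρ
  choose w hw hwn using fun t => norm_dir_deriv (hd t) (h0 t)
  have hF : ∀ t, HasDerivAt (fun s => u (ρ • ‖γ s‖⁻¹ • γ s)) (fderiv ℝ u (ρ • ‖γ t‖⁻¹ • γ t) (ρ • w t)) t := by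
    intro t
    have h1 : HasFDerivAt u (fderiv ℝ u (ρ • ‖γ t‖⁻¹ • γ t)) (ρ • ‖γ t‖⁻¹ • γ t) :=
      ((hu.contDiffAt ((isOpen_Om R).mem_nhds (dir_mem hR hρ (h0 t)))).differentiableAt (by norm_num)).hasFDerivAt
    exact h1.comp_hasDerivAt t ((hw t).const_smul ρ)
  have hcγ : Continuous γ := by fun_prop
  have hcγ' : Continuous γ' := by fun_prop
  have hg : Continuous (fun t => pG u ρ (γ t) (γ' t)) := by
    unfold pG
    have c1 : Continuous (fun t => fderiv ℝ u (ρ • ‖γ t‖⁻¹ • γ t)) :=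
      (hu.continuousOn_fderiv_of_isOpen (isOpen_Om R) le_rfl).comp_continuous
        (((hcγ.norm.inv₀ (fun t => norm_ne_zero_iff.2 (h0 t))).smul hcγ).const_smul ρ)
        (fun t => dir_mem hR hρ (h0 t))
    exact (c1.norm.const_mul ρ).mul ((hcγ'.norm.const_mul 2).div hcγ.norm (fun t => norm_ne_zero_iff.2 (h0 t)))
  have hbd : ∀ t, ‖fderiv ℝ u (ρ • ‖γ t‖⁻¹ • γ t) (ρ • w t)‖ ≤ pG u ρ (γ t) (γ' t) := by
    intro t
    refine (ContinuousLinearMap.le_opNorm _ _).trans ?_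
    rw [norm_smul, Real.norm_eq_abs, abs_of_pos hρ0]
    unfold pG
    calc _ ≤ ‖fderiv ℝ u (ρ • ‖γ t‖⁻¹ • γ t)‖ * (ρ * (2 * ‖γ' t‖ / ‖γ t‖)) := by gcongr; exact hwn t
      _ = _ := by ring
  have hpi : (0:ℝ) ≤ Real.pi / 2 := by positivity
  have h1 : ‖u (ρ • ‖γ (Real.pi/2)‖⁻¹ • γ (Real.pi/2)) - u (ρ • ‖γ 0‖⁻¹ • γ 0)‖
      ≤ ∫ t in (0)..(Real.pi/2), pG u ρ (γ t) (γ' t) := by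
    have hB : ∀ t, HasDerivAt (fun s => ∫ τ in (0:ℝ)..s, pG u ρ (γ τ) (γ' τ)) (pG u ρ (γ t) (γ' t)) t :=
      fun t => intervalIntegral.integral_hasDerivAt_right (hg.intervalIntegrable _ _)
        hg.stronglyMeasurable.stronglyMeasurableAtFilter hg.continuousAt
    have := image_norm_le_of_norm_deriv_right_le_deriv_boundary
      (f := fun s => u (ρ • ‖γ s‖⁻¹ • γ s) - u (ρ • ‖γ 0‖⁻¹ • γ 0))
      (f' := fun t => fderiv ℝ u (ρ • ‖γ t‖⁻¹ • γ t) (ρ • w t)) (a := 0) (b := Real.pi/2)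
      (B := fun s => ∫ τ in (0:ℝ)..s, pG u ρ (γ τ) (γ' τ)) (B' := fun t => pG u ρ (γ t) (γ' t))
      (fun t _ => ((hF t).sub_const _).continuousAt.continuousWithinAt)
      (fun t _ => ((hF t).sub_const _).hasDerivWithinAt) (by simp) hB (fun t _ => hbd t)
    exact this (Set.right_mem_Icc.2 hpi)
  have e0 : γ 0 = x := by simp [hγ]
  have e1 : γ (Real.pi/2) = y := by simp [hγ]
  rw [e0, e1] at h1
  have h2 : (∫ t in (0)..(Real.pi/2), pG u ρ (γ t) (γ' t))^2
      ≤ (Real.pi/2) * ∫ t in (0)..(Real.pi/2), pG u ρ (γ t) (γ' t) ^ 2 := by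
    rw [intervalIntegral.integral_of_le hpi, intervalIntegral.integral_of_le hpi]
    have hgi : ∀ f : ℝ → ℝ, Continuous f → Integrable f (volume.restrict (Set.Ioc 0 (Real.pi/2))) := fun f hf =>
      (hf.integrableOn_Icc).mono_set Set.Ioc_subset_Icc_self
    have := cs_real (μ := volume.restrict (Set.Ioc 0 (Real.pi/2))) (f := fun _ => (1:ℝ))
      (g := fun t => pG u ρ (γ t) (γ' t)) (hgi _ (by fun_prop)) (hgi _ (by fun_prop)) (hgi _ (by fun_prop))
    simp only [one_mul, one_pow, integral_const, smul_eq_mul, mul_one] at this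
    have hm : (volume.restrict (Set.Ioc 0 (Real.pi/2))).real Set.univ = Real.pi/2 := by
      simp [measureReal_def, hpi]
    rwa [hm] at this
  have h3 : ‖u (ρ • ‖y‖⁻¹ • y) - u (ρ • ‖x‖⁻¹ • x)‖^2
      ≤ (Real.pi/2) * ∫ t in (0)..(Real.pi/2), pG u ρ (γ t) (γ' t) ^ 2 :=
    (pow_le_pow_left₀ (norm_nonneg _) h1 2).trans h2
  refine (ENNReal.ofReal_le_ofReal h3).trans ?_
  rw [ENNReal.ofReal_mul hpi, intervalIntegral.integral_of_le hpi,
    ofReal_integral_eq_lintegral_ofReal]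
  · exact le_rfl
  · exact ((hg.pow 2).integrableOn_Icc).mono_set Set.Ioc_subset_Icc_self
  · exact Eventually.of_forall fun t => sq_nonneg _

end PartA6

section PartA7
open scoped ENNReal Topology Pointwise

lemma polar_ball (h : E3 → ℝ≥0∞) (hm : Measurable h) (a : ℝ) :
    ∫⁻ x in ball 0 a, h x = ∫⁻ r in Set.Ioo 0 a, ENNReal.ofReal (r^2) * ∫⁻ ω : S2, h (r • (ω : E3)) ∂sig := by
  rw [← lintegral_indicator measurableSet_ball, lintegral_polar' _ (hm.indicator measurableSet_ball)]
  rw [← Set.Ioi_inter_Iio, ← Measure.restrict_restrict measurableSet_Ioi, Measure.restrict_comm measurableSet_Ioi,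
    ← lintegral_indicator measurableSet_Iio]
  refine setLIntegral_congr_fun measurableSet_Ioi fun r hr => ?_
  have hr' : (0:ℝ) ≤ r := le_of_lt hr
  by_cases hra : r < a
  · rw [Set.indicator_of_mem (by exact hra)]
    congr 1
    refine lintegral_congr fun ω => ?_
    rw [Set.indicator_of_mem]
    rw [mem_ball_zero_iff, norm_smul_S2 hr']; exact hra
  · rw [Set.indicator_of_notMem (by exact hra)]
    have : ∀ ω : S2, (ball (0:E3) a).indicator h (r • (ω : E3)) = 0 := fun ω => by
      rw [Set.indicator_of_notMem]
      rw [mem_ball_zero_iff, norm_smul_S2 hr']; exact hra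
    simp [this]

lemma dir_S2 {r : ℝ} (hr : 0 < r) (ω : S2) : ‖r • (ω : E3)‖⁻¹ • (r • (ω : E3)) = (ω : E3) := radial_smul hr ω

lemma dir_meas : Measurable (fun z : E3 => ‖z‖⁻¹ • z) := by fun_prop

lemma polar_hom (h : E3 → ℝ≥0∞) (hm : Measurable h) :
    ∫⁻ x in ball 0 (1/2), h (‖x‖⁻¹ • x)
      = (∫⁻ r in Set.Ioo (0:ℝ) (1/2), ENNReal.ofReal (r^2)) * ∫⁻ ω : S2, h (ω : E3) ∂sig := by
  rw [polar_ball (fun x => h (‖x‖⁻¹ • x)) (hm.comp dir_meas), ← lintegral_mul_const _ (by fun_prop)]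
  refine setLIntegral_congr_fun measurableSet_Ioo fun r hr => ?_
  simp only [dir_S2 hr.1]

lemma polar_hom2 (h : E3 → ℝ≥0∞) (hm : Measurable h) :
    ∫⁻ x in ball 0 1, ENNReal.ofReal ((‖x‖^2)⁻¹) * h (‖x‖⁻¹ • x)
      = ∫⁻ ω : S2, h (ω : E3) ∂sig := by
  rw [polar_ball _ (by have := hm.comp dir_meas; fun_prop)]
  have : ∀ r ∈ Set.Ioo (0:ℝ) 1, ENNReal.ofReal (r^2) * ∫⁻ ω : S2, ENNReal.ofReal ((‖r • (ω:E3)‖^2)⁻¹) *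
      h (‖r • (ω:E3)‖⁻¹ • (r • (ω:E3))) ∂sig = ∫⁻ ω : S2, h (ω : E3) ∂sig := by
    intro r hr
    simp only [dir_S2 hr.1]
    simp only [norm_smul_S2 hr.1.le]
    rw [lintegral_const_mul _ (by fun_prop), ← mul_assoc, ← ENNReal.ofReal_mul (by positivity),
      mul_inv_cancel₀ (by have := hr.1; positivity)]
    simp
  rw [setLIntegral_congr_fun measurableSet_Ioo this]
  simp

def Wset : Set (E3 × E3) := {p | ‖p.1‖^2 + ‖p.2‖^2 < 1}

lemma W_meas : MeasurableSet Wset := (isOpen_lt (by fun_prop) (by fun_prop)).measurableSet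

lemma rot_W (t : ℝ) : rotL t ⁻¹' Wset = Wset := by
  ext p
  simp only [Wset, Set.mem_preimage, Set.mem_ofPred_eq, rotL, LinearMap.coe_mk, AddHom.coe_mk]
  have hcs := Real.cos_sq_add_sin_sq t
  rw [@norm_add_sq_real, @norm_add_sq_real]
  simp only [norm_smul, inner_smul_left, inner_smul_right, mul_pow, Real.norm_eq_abs, sq_abs, conj_trivial,
    norm_neg, neg_sq]
  have : Real.cos t ^ 2 * ‖p.1‖ ^ 2 + 2 * (Real.sin t * (Real.cos t * inner ℝ p.1 p.2)) + Real.sin t ^ 2 * ‖p.2‖ ^ 2 +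
    (Real.sin t ^ 2 * ‖p.1‖ ^ 2 + 2 * (Real.cos t * (-Real.sin t * inner ℝ p.1 p.2)) + Real.cos t ^ 2 * ‖p.2‖ ^ 2)
    = ‖p.1‖^2 + ‖p.2‖^2 := by linear_combination (‖p.1‖^2 + ‖p.2‖^2) * hcs
  constructor <;> intro h <;> linarith

lemma pG_meas (u : E3 → ℂ) (ρ : ℝ) : Measurable (fun p : E3 × E3 => pG u ρ p.1 p.2) := by
  unfold pG
  have h := measurable_fderiv ℝ u
  have h2 : Measurable (fun p : E3 × E3 => fderiv ℝ u (ρ • ‖p.1‖⁻¹ • p.1)) := h.comp (by fun_prop)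
  fun_prop

lemma rot_est {R : ℝ} (hR : 0 ≤ R) {u : E3 → ℂ} (hu : ContDiffOn ℝ 1 u (Om R)) {ρ : ℝ} (hρ : R < ρ) :
    ∫⁻ p in Wset, ENNReal.ofReal (‖u (ρ • ‖p.2‖⁻¹ • p.2) - u (ρ • ‖p.1‖⁻¹ • p.1)‖^2) ≤
      ENNReal.ofReal (Real.pi/2) * (ENNReal.ofReal (Real.pi/2) *
        ∫⁻ p in Wset, ENNReal.ofReal (pG u ρ p.1 p.2 ^ 2)) := by
  have hrm : Measurable (fun q : (E3 × E3) × ℝ => rotL q.2 q.1) := by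
    unfold rotL
    simp only [LinearMap.coe_mk, AddHom.coe_mk]
    fun_prop
  have hm := (pG_meas u ρ)
  have hm2 : Measurable (fun q : (E3 × E3) × ℝ => ENNReal.ofReal (pG u ρ (rotL q.2 q.1).1 (rotL q.2 q.1).2 ^ 2)) :=
    ((hm.comp hrm).pow_const 2).ennreal_ofReal
  calc _ ≤ ∫⁻ p in Wset, ENNReal.ofReal (Real.pi/2) * ∫⁻ t in Set.Ioc 0 (Real.pi/2),
        ENNReal.ofReal (pG u ρ (rotL t p).1 (rotL t p).2 ^ 2) := by
        refine lintegral_mono_ae (ae_restrict_of_ae ?_)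
        filter_upwards [ae_indep] with p hp
        exact path_est hR hu hρ p.1 p.2 hp
    _ = ENNReal.ofReal (Real.pi/2) * ∫⁻ t in Set.Ioc 0 (Real.pi/2), ∫⁻ p in Wset,
        ENNReal.ofReal (pG u ρ (rotL t p).1 (rotL t p).2 ^ 2) := by
        rw [lintegral_const_mul' _ _ ENNReal.ofReal_ne_top, lintegral_lintegral_swap]
        exact hm2.aemeasurable
    _ = ENNReal.ofReal (Real.pi/2) * ∫⁻ t in Set.Ioc 0 (Real.pi/2), ∫⁻ p in Wset,
        ENNReal.ofReal (pG u ρ p.1 p.2 ^ 2) := by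
        congr 1
        refine lintegral_congr fun t => ?_
        have := (rot_mp t).setLIntegral_comp_preimage W_meas
          (f := fun p => ENNReal.ofReal (pG u ρ p.1 p.2 ^ 2)) (hm.pow_const 2).ennreal_ofReal
        rw [rot_W] at this
        exact this
    _ = _ := by
        rw [lintegral_const, mul_comm (∫⁻ p in Wset, _)]
        simp

lemma rhs_est (u : E3 → ℂ) {ρ : ℝ} (hρ : 0 < ρ) :
    ∫⁻ p in Wset, ENNReal.ofReal (pG u ρ p.1 p.2 ^ 2) ≤
      volume (ball (0:E3) 1) * ∫⁻ ω : S2, ENNReal.ofReal (4 * ρ^2 * ‖fderiv ℝ u (ρ • (ω : E3))‖^2) ∂sig := by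
  have hm := (pG_meas u ρ)
  have hh : Measurable (fun z : E3 => ENNReal.ofReal (4 * ρ^2 * ‖fderiv ℝ u (ρ • z)‖^2)) := by
    have h2 : Measurable (fun z : E3 => fderiv ℝ u (ρ • z)) := (measurable_fderiv ℝ u).comp (by fun_prop)
    fun_prop
  have hsub : Wset ⊆ ball (0:E3) 1 ×ˢ ball (0:E3) 1 := by
    rintro p hp
    simp only [Wset, Set.mem_ofPred_eq] at hp
    constructor <;> rw [mem_ball_zero_iff] <;> nlinarith [norm_nonneg p.1, norm_nonneg p.2]
  refine (lintegral_mono_set hsub).trans ?_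
  change ∫⁻ p in _, _ ∂(volume.prod volume) ≤ _
  rw [← Measure.prod_restrict, lintegral_prod _ (hm.pow_const 2).ennreal_ofReal.aemeasurable,
    ← polar_hom2 _ hh, ← lintegral_const_mul _ (by
      have := hh.comp dir_meas; fun_prop)]
  refine lintegral_mono fun x => ?_
  calc _ ≤ ∫⁻ y in ball (0:E3) 1, ENNReal.ofReal ((‖x‖ ^ 2)⁻¹) * ENNReal.ofReal (4 * ρ^2 * ‖fderiv ℝ u (ρ • ‖x‖⁻¹ • x)‖^2) := by
        refine setLIntegral_mono (by fun_prop) fun y hy => ?_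
        rw [← ENNReal.ofReal_mul (by positivity)]
        refine ENNReal.ofReal_le_ofReal ?_
        unfold pG
        rw [mem_ball_zero_iff] at hy
        have : ‖y‖^2 ≤ 1 := by nlinarith [norm_nonneg y]
        calc _ = (‖x‖ ^ 2)⁻¹ * (4 * ρ^2 * ‖fderiv ℝ u (ρ • ‖x‖⁻¹ • x)‖^2) * ‖y‖^2 := by
              simp only [mul_pow, div_eq_mul_inv, inv_pow]; ring
          _ ≤ (‖x‖ ^ 2)⁻¹ * (4 * ρ^2 * ‖fderiv ℝ u (ρ • ‖x‖⁻¹ • x)‖^2) * 1 := by gcongr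
          _ = _ := mul_one _
    _ = _ := by rw [lintegral_const]; simp [mul_comm]

lemma lhs_est {R : ℝ} (hR : 0 ≤ R) {u : E3 → ℂ} (hu : ContinuousOn u (Om R)) {ρ : ℝ} (hρ : R < ρ) :
    (∫⁻ r in Set.Ioo (0:ℝ) (1/2), ENNReal.ofReal (r^2)) * ((∫⁻ r in Set.Ioo (0:ℝ) (1/2), ENNReal.ofReal (r^2)) *
      ∫⁻ ω : S2, ∫⁻ ω' : S2, ENNReal.ofReal (‖u (ρ • (ω' : E3)) - u (ρ • (ω : E3))‖^2) ∂sig ∂sig) ≤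
    ∫⁻ p in Wset, ENNReal.ofReal (‖u (ρ • ‖p.2‖⁻¹ • p.2) - u (ρ • ‖p.1‖⁻¹ • p.1)‖^2) := by
  -- replace u by a measurable version
  set v : E3 → ℂ := (Om R).indicator u with hv
  have hvm : Measurable v := by
    exact measurable_of_restrict_of_restrict_compl (isOpen_Om R).measurableSet
      (by
        have : (Om R).domRestrict v = (Om R).domRestrict u := by
          ext ⟨x, hx⟩; simp only [Set.domRestrict_apply, hv]; exact Set.indicator_of_mem hx _
        rw [this]; exact (continuousOn_iff_continuous_domRestrict.1 hu).measurable)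
      (by
        have : (Om R)ᶜ.domRestrict v = fun _ => 0 := by
          ext ⟨x, hx⟩; simp only [Set.domRestrict_apply, hv]; exact Set.indicator_of_notMem hx _
        rw [this]; exact measurable_const)
  have hvu : ∀ z : E3, z ∈ Om R → v z = u z := fun z hz => Set.indicator_of_mem hz _
  have hsub : ball (0:E3) (1/2) ×ˢ ball (0:E3) (1/2) ⊆ Wset := by
    rintro p ⟨h1, h2⟩
    rw [mem_ball_zero_iff] at h1 h2
    simp only [Wset, Set.mem_ofPred_eq]
    nlinarith [norm_nonneg p.1, norm_nonneg p.2]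
  have h0 : ∀ᵐ p : E3 × E3, p.1 ≠ 0 ∧ p.2 ≠ 0 := by
    filter_upwards [ae_indep] with p hp
    constructor <;> intro h <;> apply hp <;> simp [h]
  have e1 : ∫⁻ p in Wset, ENNReal.ofReal (‖u (ρ • ‖p.2‖⁻¹ • p.2) - u (ρ • ‖p.1‖⁻¹ • p.1)‖^2)
      = ∫⁻ p in Wset, ENNReal.ofReal (‖v (ρ • ‖p.2‖⁻¹ • p.2) - v (ρ • ‖p.1‖⁻¹ • p.1)‖^2) := by
    refine lintegral_congr_ae (ae_restrict_of_ae ?_)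
    filter_upwards [h0] with p hp
    rw [hvu _ (dir_mem hR hρ hp.1), hvu _ (dir_mem hR hρ hp.2)]
  rw [e1]
  refine le_trans ?_ (lintegral_mono_set hsub)
  change _ ≤ ∫⁻ p in _, _ ∂(volume.prod volume)
  have hm1 : Measurable (fun p : E3 × E3 => v (ρ • p.2) - v (ρ • p.1)) :=
    (hvm.comp (by fun_prop)).sub (hvm.comp (by fun_prop))
  have hm2 : Measurable (fun p : E3 × E3 => ENNReal.ofReal (‖v (ρ • p.2) - v (ρ • p.1)‖^2)) := by fun_prop
  have hm3 : Measurable (fun p : E3 × E3 => ENNReal.ofReal (‖v (ρ • ‖p.2‖⁻¹ • p.2) - v (ρ • ‖p.1‖⁻¹ • p.1)‖^2)) :=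
    hm2.comp (f := fun p : E3 × E3 => (‖p.1‖⁻¹ • p.1, ‖p.2‖⁻¹ • p.2)) (by fun_prop)
  rw [← Measure.prod_restrict, lintegral_prod _ hm3.aemeasurable]
  have e2 : ∀ x : E3, ∫⁻ y in ball (0:E3) (1/2), ENNReal.ofReal (‖v (ρ • ‖y‖⁻¹ • y) - v (ρ • ‖x‖⁻¹ • x)‖^2)
      = (∫⁻ r in Set.Ioo (0:ℝ) (1/2), ENNReal.ofReal (r^2)) *
        ∫⁻ ω' : S2, ENNReal.ofReal (‖v (ρ • (ω' : E3)) - v (ρ • ‖x‖⁻¹ • x)‖^2) ∂sig := by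
    intro x
    exact polar_hom (fun z => ENNReal.ofReal (‖v (ρ • z) - v (ρ • ‖x‖⁻¹ • x)‖^2))
      (hm2.comp (f := fun z => (‖x‖⁻¹ • x, z)) (by fun_prop))
  simp only [e2]
  have hm4 : Measurable (fun z : E3 => ∫⁻ ω' : S2, ENNReal.ofReal (‖v (ρ • (ω' : E3)) - v (ρ • z)‖^2) ∂sig) := by
    refine Measurable.lintegral_prod_right' (f := fun q : E3 × S2 => ENNReal.ofReal (‖v (ρ • (q.2 : E3)) - v (ρ • q.1)‖^2)) ?_
    exact hm2.comp (f := fun q : E3 × S2 => (q.1, (q.2 : E3))) (by fun_prop)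
  rw [lintegral_const_mul (f := fun x : E3 => ∫⁻ ω' : S2, ENNReal.ofReal (‖v (ρ • (ω' : E3)) - v (ρ • ‖x‖⁻¹ • x)‖^2) ∂sig)
    _ (hm4.comp dir_meas),
    polar_hom (fun z : E3 => ∫⁻ ω' : S2, ENNReal.ofReal (‖v (ρ • (ω' : E3)) - v (ρ • z)‖^2) ∂sig) hm4]
  refine le_of_eq ?_
  congr 2
  refine lintegral_congr fun ω => lintegral_congr fun ω' => ?_
  rw [hvu _ (mem_Om hR hρ _), hvu _ (mem_Om hR hρ _)]

end PartA7

section PartA8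
open scoped ENNReal Topology Pointwise

noncomputable def s0 : ℝ := sig.real Set.univ

instance : IsFiniteMeasure sig := by unfold sig; infer_instance

lemma s0_pos : 0 < s0 := by
  unfold s0 Measure.real
  refine ENNReal.toReal_pos ?_ (measure_ne_top _ _)
  intro h
  have h0 : (volume : Measure E3).toSphere = 0 := Measure.measure_univ_eq_zero.1 h
  rw [Measure.toSphere_eq_zero_iff] at h0
  exact not_subsingleton E3 h0

lemma c0_val : (∫⁻ r in Set.Ioo (0:ℝ) (1/2), ENNReal.ofReal (r^2)) = ENNReal.ofReal (1/24) := by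
  rw [← ofReal_integral_eq_lintegral_ofReal]
  · rw [← integral_Ioc_eq_integral_Ioo, ← intervalIntegral.integral_of_le (by norm_num), integral_pow]
    norm_num
  · exact ((continuous_pow 2).integrableOn_Icc (a := (0:ℝ)) (b := 1/2)).mono_set Set.Ioo_subset_Icc_self
  · exact ae_of_all _ fun x => by positivity

noncomputable def CP0 : ℝ := 24 * (24 * (Real.pi/2 * (Real.pi/2 * ((volume (ball (0:E3) 1)).toReal * 4))))

lemma CP0_pos : 0 < CP0 := by
  unfold CP0
  have : 0 < (volume (ball (0:E3) 1)).toReal :=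
    ENNReal.toReal_pos (measure_ball_pos _ _ one_pos).ne' measure_ball_lt_top.ne
  positivity

lemma fd_cont {R : ℝ} {u : E3 → ℂ} (hu : ContDiffOn ℝ 1 u (Om R)) : ContinuousOn (fun x => fderiv ℝ u x) (Om R) :=
  hu.continuousOn_fderiv_of_isOpen (isOpen_Om R) le_rfl

lemma double_est {R : ℝ} (hR : 0 ≤ R) {u : E3 → ℂ} (hu : ContDiffOn ℝ 1 u (Om R)) {ρ : ℝ} (hρ : R < ρ) :
    ∫ ω : S2, ∫ ω' : S2, ‖u (ρ • (ω' : E3)) - u (ρ • (ω : E3))‖^2 ∂sig ∂sig ≤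
      CP0 * (ρ^2 * sm (fun x => ‖fderiv ℝ u x‖^2) ρ) := by
  have h1 := lhs_est hR hu.continuousOn hρ
  have h2 := rot_est hR hu hρ
  have hρ0 : 0 < ρ := hR.trans_lt hρ
  have h3 := rhs_est u hρ0
  have hc := cont_slice hR hu.continuousOn hρ
  have hcc : Continuous (fun p : S2 × S2 => ‖u (ρ • (p.2 : E3)) - u (ρ • (p.1 : E3))‖^2) :=
    ((hc.comp continuous_snd).sub (hc.comp continuous_fst)).norm.pow 2
  have e1 : ∀ ω : S2, ∫⁻ ω' : S2, ENNReal.ofReal (‖u (ρ • (ω' : E3)) - u (ρ • (ω : E3))‖^2) ∂sig =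
      ENNReal.ofReal (∫ ω' : S2, ‖u (ρ • (ω' : E3)) - u (ρ • (ω : E3))‖^2 ∂sig) := by
    intro ω
    rw [ofReal_integral_eq_lintegral_ofReal]
    · exact int_of_cont (hcc.comp (Continuous.prodMk_right ω))
    · exact ae_of_all _ fun x => by positivity
  have e2 : ∫⁻ ω : S2, ENNReal.ofReal (∫ ω' : S2, ‖u (ρ • (ω' : E3)) - u (ρ • (ω : E3))‖^2 ∂sig) ∂sig =
      ENNReal.ofReal (∫ ω : S2, ∫ ω' : S2, ‖u (ρ • (ω' : E3)) - u (ρ • (ω : E3))‖^2 ∂sig ∂sig) := by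
    rw [ofReal_integral_eq_lintegral_ofReal]
    · have : Integrable (fun p : S2 × S2 => ‖u (ρ • (p.2 : E3)) - u (ρ • (p.1 : E3))‖^2) (sig.prod sig) := by
        have := hcc.continuousOn.integrableOn_compact (μ := sig.prod sig) isCompact_univ
        simpa using this
      exact this.integral_prod_left
    · exact ae_of_all _ fun x => by positivity
  have e3 : ∫⁻ ω : S2, ENNReal.ofReal (4 * ρ^2 * ‖fderiv ℝ u (ρ • (ω : E3))‖^2) ∂sig =
      ENNReal.ofReal (4 * ρ^2 * sm (fun x => ‖fderiv ℝ u x‖^2) ρ) := by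
    unfold sm
    rw [← integral_const_mul, ofReal_integral_eq_lintegral_ofReal]
    · exact (int_of_cont ((cont_slice hR (fd_cont hu) hρ).norm.pow 2)).const_mul _
    · exact ae_of_all _ fun x => by positivity
  simp only [e1] at h1
  rw [e2, c0_val] at h1
  rw [e3] at h3
  have hb : volume (ball (0:E3) 1) = ENNReal.ofReal (volume (ball (0:E3) 1)).toReal :=
    (ENNReal.ofReal_toReal measure_ball_lt_top.ne).symm
  rw [hb] at h3
  have hpi := Real.pi_pos
  have h4 := h1.trans (h2.trans (mul_le_mul_right (mul_le_mul_right h3 _) _))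
  have hs : 0 ≤ sm (fun x => ‖fderiv ℝ u x‖^2) ρ := integral_nonneg fun _ => by positivity
  rw [← ENNReal.ofReal_mul (by positivity), ← ENNReal.ofReal_mul (by positivity), ← ENNReal.ofReal_mul (by positivity),
    ← ENNReal.ofReal_mul (by positivity), ← ENNReal.ofReal_mul (by positivity),
    ENNReal.ofReal_le_ofReal_iff (by positivity)] at h4
  unfold CP0
  linarith

lemma poinc {R : ℝ} (hR : 0 ≤ R) {u : E3 → ℂ} (hu : ContDiffOn ℝ 1 u (Om R)) {ρ : ℝ} (hρ : R < ρ) :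
    ∫ ω : S2, ‖u (ρ • (ω : E3)) - s0⁻¹ • sm u ρ‖^2 ∂sig ≤
      (s0⁻¹ * CP0) * (ρ^2 * sm (fun x => ‖fderiv ℝ u x‖^2) ρ) := by
  have hc := cont_slice hR hu.continuousOn hρ
  have hs := s0_pos
  have hcc : Continuous (fun p : S2 × S2 => ‖u (ρ • (p.2 : E3)) - u (ρ • (p.1 : E3))‖^2) :=
    ((hc.comp continuous_snd).sub (hc.comp continuous_fst)).norm.pow 2
  have hin : Integrable (fun ω : S2 => ∫ ω' : S2, ‖u (ρ • (ω' : E3)) - u (ρ • (ω : E3))‖^2 ∂sig) sig := by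
    have : Integrable (fun p : S2 × S2 => ‖u (ρ • (p.2 : E3)) - u (ρ • (p.1 : E3))‖^2) (sig.prod sig) := by
      have := hcc.continuousOn.integrableOn_compact (μ := sig.prod sig) isCompact_univ
      simpa using this
    exact this.integral_prod_left
  calc _ ≤ ∫ ω : S2, s0⁻¹ * ∫ ω' : S2, ‖u (ρ • (ω' : E3)) - u (ρ • (ω : E3))‖^2 ∂sig ∂sig := by
        refine integral_mono (int_of_cont ((hc.sub continuous_const).norm.pow 2)) (hin.const_mul _) fun ω => ?_
        have hd : Continuous (fun ω' : S2 => u (ρ • (ω' : E3)) - u (ρ • (ω : E3))) := hc.sub continuous_const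
        have h1 : s0⁻¹ • sm u ρ - u (ρ • (ω : E3)) = s0⁻¹ • ∫ ω' : S2, (u (ρ • (ω' : E3)) - u (ρ • (ω : E3))) ∂sig := by
          rw [integral_sub (int_of_cont hc) (int_of_cont continuous_const), integral_const, smul_sub, smul_smul]
          change _ = _ - (s0⁻¹ * s0) • _
          rw [inv_mul_cancel₀ hs.ne', one_smul]; rfl
        have h2 : ‖∫ ω' : S2, (u (ρ • (ω' : E3)) - u (ρ • (ω : E3))) ∂sig‖ ≤ ∫ ω' : S2, ‖u (ρ • (ω' : E3)) - u (ρ • (ω : E3))‖ * 1 ∂sig := by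
          simpa using norm_integral_le_integral_norm (μ := sig) (fun ω' : S2 => u (ρ • (ω' : E3)) - u (ρ • (ω : E3)))
        have h3 := cs_real (μ := sig) (f := fun ω' : S2 => ‖u (ρ • (ω' : E3)) - u (ρ • (ω : E3))‖) (g := fun _ => 1)
          (int_of_cont (hd.norm.pow 2)) (int_of_cont (hd.norm.mul continuous_const)) (int_of_cont (by fun_prop))
        have h4 : ∫ _ω : S2, (1:ℝ)^2 ∂sig = s0 := by simp [s0]
        rw [h4] at h3
        have h5 := pow_le_pow_left₀ (norm_nonneg _) h2 2
        show ‖u (ρ • (ω : E3)) - s0⁻¹ • sm u ρ‖^2 ≤ _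
        rw [norm_sub_rev, h1, norm_smul, mul_pow, Real.norm_eq_abs, sq_abs]
        calc _ ≤ s0⁻¹^2 * ((∫ ω' : S2, ‖u (ρ • (ω' : E3)) - u (ρ • (ω : E3))‖^2 ∂sig) * s0) := by
              gcongr; exact h5.trans h3
          _ = _ := by field_simp
    _ = s0⁻¹ * ∫ ω : S2, ∫ ω' : S2, ‖u (ρ • (ω' : E3)) - u (ρ • (ω : E3))‖^2 ∂sig ∂sig := integral_const_mul _ _
    _ ≤ _ := by
        rw [mul_assoc]
        exact mul_le_mul_of_nonneg_left (double_est hR hu hρ) (by positivity)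

end PartA8

section PartB1
open scoped ENNReal Topology Pointwise

structure D1 (k : ℂ) (r q M A s CH m1 : ℝ) (c : ℂ) (m a e p v B g1 : ℝ → ℝ) (N n U uV D g2 : ℝ → ℂ) : Prop where
  hk : 0 < k.im
  hr : 0 < r
  hq : 0 ≤ q
  hM : 0 ≤ M
  hA : 0 ≤ A
  hs : 0 < s
  hCH : 0 < CH
  hm1 : 0 ≤ m1
  m_nn : ∀ x, r ≤ x → 0 ≤ m x
  a_nn : ∀ x, r ≤ x → 0 ≤ a x
  e_nn : ∀ x, r ≤ x → 0 ≤ e x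
  p_nn : ∀ x, r ≤ x → 0 ≤ p x
  ca : ContinuousOn a (Set.Ici r)
  ce : ContinuousOn e (Set.Ici r)
  cp : ContinuousOn p (Set.Ici r)
  cv : ContinuousOn v (Set.Ici r)
  cg1 : ContinuousOn g1 (Set.Ici r)
  cg2 : ContinuousOn g2 (Set.Ici r)
  dN : ∀ x, r ≤ x → HasDerivAt N ((a x : ℂ) + (v x : ℂ) - 2 * Complex.I * k * N x) x
  dn : ∀ x, r ≤ x → HasDerivAt n (uV x - 2 * Complex.I * k * n x) x
  dm : ∀ x, r ≤ x → HasDerivAt m (2 * (N x).re) x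
  dU : ∀ x, r ≤ x → HasDerivAt U (n x) x
  dB : ∀ x, r ≤ x → HasDerivAt B (v x + g1 x - 2 / x * B x) x
  dD : ∀ x, r ≤ x → HasDerivAt D (uV x + g2 x - ((2 / x : ℝ) : ℂ) * D x) x
  bN : ∀ x, r ≤ x → ‖N x‖ ^ 2 ≤ m x * a x
  bN1 : ‖N r‖ ^ 2 ≤ m r * m1
  bn : ∀ x, r ≤ x → ‖n x‖ ^ 2 ≤ s * a x
  bn1 : ‖n r‖ ^ 2 ≤ s * m1
  bU : ∀ x, r ≤ x → ‖U x‖ ^ 2 ≤ s * m x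
  bB : ∀ x, r ≤ x → B x ^ 2 ≤ e x * m x
  bD : ∀ x, r ≤ x → ‖D x‖ ^ 2 ≤ s * e x
  be : ∀ x, r ≤ x → e x ≤ q ^ 2 * m x
  bg1 : ∀ x, r ≤ x → g1 x ^ 2 ≤ 4 * (e x * a x)
  bg2 : ∀ x, r ≤ x → ‖g2 x‖ ^ 2 ≤ q ^ 2 * s * a x
  bc : ‖c‖ ^ 2 * s ≤ m r
  bG : ∀ x, r ≤ x → ∀ w, 0 ≤ w → w ≤ 1 → |B x - w * ((starRingEnd ℂ) c * D x).re| ≤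
    √(e x) * √(p x) + ‖c‖ * q * √s * √(p x) + (1 - w) * s * q * ‖c‖ ^ 2
  Ia : ∀ t, r ≤ t → ∫ x in r..t, a x ≤ A
  Ip : ∀ t, r ≤ t → ∫ x in r..t, p x / x ^ 2 ≤ CH * A
  Ie : ∀ t, r ≤ t → ∫ x in r..t, e x ≤ q ^ 2 * M
  Im : ∀ t, r ≤ t → ∫ x in t..(t+1), m x ≤ M
  lN : Tendsto N atTop (𝓝 0)
  lB : Tendsto B atTop (𝓝 0)
  supA : ∀ X, (∀ᶠ t in atTop, ∫ x in r..t, a x ≤ X) → A ≤ X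
  supM : ∀ X, (∀ t, r < t → ∫ x in t..(t+1), m x ≤ X) → M ≤ X

/-- interval Cauchy–Schwarz -/
lemma csI {x y f : ℝ → ℝ} {α β X Y : ℝ} (hab : α ≤ β) (hf : ContinuousOn f (Set.Icc α β))
    (hx : ContinuousOn x (Set.Icc α β)) (hy : ContinuousOn y (Set.Icc α β))
    (hx0 : ∀ t ∈ Set.Icc α β, 0 ≤ x t) (hy0 : ∀ t ∈ Set.Icc α β, 0 ≤ y t)
    (h : ∀ t ∈ Set.Icc α β, f t ^ 2 ≤ x t * y t)
    (hX : ∫ t in α..β, x t ≤ X) (hY : ∫ t in α..β, y t ≤ Y) :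
    ∫ t in α..β, f t ≤ √X * √Y := by
  have hx' := hx.sqrt
  have hy' := hy.sqrt
  have hX0 : 0 ≤ ∫ t in α..β, x t := intervalIntegral.integral_nonneg hab hx0
  have hY0 : 0 ≤ ∫ t in α..β, y t := intervalIntegral.integral_nonneg hab hy0
  have h1 : ∫ t in α..β, f t ≤ ∫ t in α..β, √(x t) * √(y t) := by
    refine intervalIntegral.integral_mono_on hab (hf.intervalIntegrable_of_Icc hab)
      ((hx'.mul hy').intervalIntegrable_of_Icc hab) fun t ht => ?_
    rw [← Real.sqrt_mul (hx0 t ht)]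
    exact Real.le_sqrt_of_sq_le (h t ht)
  have icc : ∀ {z : ℝ → ℝ}, ContinuousOn z (Set.Icc α β) → Integrable z (volume.restrict (Set.Ioc α β)) :=
    fun hz => (hz.integrableOn_Icc).mono_set Set.Ioc_subset_Icc_self
  have h2 := cs_real (μ := volume.restrict (Set.Ioc α β)) (f := fun t => √(x t)) (g := fun t => √(y t))
    (icc (hx'.pow 2)) (icc (hx'.mul hy')) (icc (hy'.pow 2))
  simp only [← intervalIntegral.integral_of_le hab] at h2
  have e1 : ∫ t in α..β, √(x t) ^ 2 = ∫ t in α..β, x t :=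
    intervalIntegral.integral_congr fun t ht => by
      rw [Set.uIcc_of_le hab] at ht; exact Real.sq_sqrt (hx0 t ht)
  have e2 : ∫ t in α..β, √(y t) ^ 2 = ∫ t in α..β, y t :=
    intervalIntegral.integral_congr fun t ht => by
      rw [Set.uIcc_of_le hab] at ht; exact Real.sq_sqrt (hy0 t ht)
  rw [e1, e2] at h2
  refine h1.trans ((Real.le_sqrt_of_sq_le h2).trans ?_)
  rw [Real.sqrt_mul hX0]
  gcongr

/-- fundamental theorem on an interval with continuous derivative -/
lemma ftcI {F : Type*} [NormedAddCommGroup F] [NormedSpace ℝ F] [CompleteSpace F] {f f' : ℝ → F} {α β : ℝ} (hab : α ≤ β)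
    (h : ∀ x, α ≤ x → HasDerivAt f (f' x) x) (hc : ContinuousOn f' (Set.Icc α β)) :
    ∫ x in α..β, f' x = f β - f α :=
  intervalIntegral.integral_eq_sub_of_hasDerivAt (fun x hx => h x (by rw [Set.uIcc_of_le hab] at hx; exact hx.1))
    (hc.intervalIntegrable_of_Icc hab)

lemma hardy {g g' : ℝ → ℂ} {r t : ℝ} (hr : 0 < r) (hrt : r ≤ t) (hg : ∀ x, r ≤ x → HasDerivAt g (g' x) x)
    (hc : ContinuousOn g' (Set.Ici r)) (h0 : g r = 0) :
    ∫ x in r..t, ‖g x‖ ^ 2 / x ^ 2 ≤ 4 * ∫ x in r..t, ‖g' x‖ ^ 2 := by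
  have cg : ContinuousOn g (Set.Ici r) := fun x hx => (hg x hx).continuousAt.continuousWithinAt
  have hx0 : ∀ x ∈ Set.Ici r, x ≠ 0 := fun x hx => (hr.trans_le hx).ne'
  have hsub : Set.Icc r t ⊆ Set.Ici r := Set.Icc_subset_Ici_self
  have c1 : ContinuousOn (fun x => ‖g x‖ ^ 2 / x ^ 2) (Set.Ici r) :=
    (cg.norm.pow 2).div (continuousOn_id.pow 2) fun x hx => pow_ne_zero 2 (hx0 x hx)
  have c2 : ContinuousOn (fun x => ‖g' x‖ ^ 2) (Set.Ici r) := hc.norm.pow 2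
  have c3 : ContinuousOn (fun x => 2 * inner ℝ (g x) (g' x)) (Set.Ici r) := (cg.inner hc).const_mul 2
  have hd : ∀ x, r ≤ x → HasDerivAt (fun y => ‖g y‖ ^ 2 / y) ((2 * inner ℝ (g x) (g' x) * x - ‖g x‖ ^ 2 * 1) / x ^ 2) x := by
    intro x hx
    exact ((hg x hx).norm_sq).div (hasDerivAt_id x) (hx0 x hx)
  have c4 : ContinuousOn (fun x => (2 * inner ℝ (g x) (g' x) * x - ‖g x‖ ^ 2 * 1) / x ^ 2) (Set.Ici r) :=
    ((c3.mul continuousOn_id).sub ((cg.norm.pow 2).mul continuousOn_const)).div (continuousOn_id.pow 2)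
      fun x hx => pow_ne_zero 2 (hx0 x hx)
  have h1 := ftcI hrt hd (c4.mono hsub)
  rw [h0, norm_zero] at h1
  have h2 : 0 ≤ ‖g t‖ ^ 2 / t := by have := hr.trans_le hrt; positivity
  have i1 := (c1.mono hsub).intervalIntegrable_of_Icc (μ := volume) hrt
  have i2 := (c2.mono hsub).intervalIntegrable_of_Icc (μ := volume) hrt
  have h3 : ∫ x in r..t, (2 * inner ℝ (g x) (g' x) * x - ‖g x‖ ^ 2 * 1) / x ^ 2 ≤
      ∫ x in r..t, ((-1/2) * (‖g x‖ ^ 2 / x ^ 2) + 2 * ‖g' x‖ ^ 2) := by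
    refine intervalIntegral.integral_mono_on hrt ((c4.mono hsub).intervalIntegrable_of_Icc hrt)
      ((i1.const_mul _).add (i2.const_mul _)) fun x hx => ?_
    have hxp : 0 < x := hr.trans_le hx.1
    have h4 : inner ℝ (g x) (g' x) ≤ ‖g x‖ * ‖g' x‖ := real_inner_le_norm _ _
    rw [div_le_iff₀ (by positivity)]
    have : ((-1/2) * (‖g x‖ ^ 2 / x ^ 2) + 2 * ‖g' x‖ ^ 2) * x ^ 2 = (-1/2) * ‖g x‖ ^ 2 + 2 * (‖g' x‖ * x) ^ 2 := by
      field_simp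
    rw [this]
    have : inner ℝ (g x) (g' x) * x ≤ ‖g x‖ * ‖g' x‖ * x := by gcongr
    nlinarith [sq_nonneg (‖g x‖ - 2 * (‖g' x‖ * x))]
  rw [intervalIntegral.integral_add (i1.const_mul _) (i2.const_mul _), intervalIntegral.integral_const_mul,
    intervalIntegral.integral_const_mul] at h3
  have h5 : (0:ℝ) ^ 2 / r = 0 := by simp
  linarith

lemma tail_int {m : ℝ → ℝ} {r M : ℝ} (hr : 0 < r) (hm : ContinuousOn m (Set.Ici r)) (hm0 : ∀ x, r ≤ x → 0 ≤ m x)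
    (hM : ∀ t, r ≤ t → ∫ x in t..(t+1), m x ≤ M) (hM0 : 0 ≤ M) {t : ℝ} (ht : r + 1 ≤ t) :
    ∫ x in (r+1)..t, m x / x ^ 2 ≤ 2 * M / (r + 1) := by
  have hx0 : ∀ x ∈ Set.Ici r, x ≠ 0 := fun x hx => (hr.trans_le hx).ne'
  have c1 : ContinuousOn (fun x => m x / x ^ 2) (Set.Ici r) :=
    hm.div (continuousOn_id.pow 2) fun x hx => pow_ne_zero 2 (hx0 x hx)
  have ii : ∀ {α β : ℝ}, r ≤ α → α ≤ β → IntervalIntegrable (fun x => m x / x ^ 2) volume α β := fun h1 h2 =>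
    (c1.mono (Set.Icc_subset_Ici_self.trans (Set.Ici_subset_Ici.2 h1))).intervalIntegrable_of_Icc h2
  have key : ∀ j : ℕ, ∫ x in (r+1)..(r+1+j), m x / x ^ 2 ≤ 2 * M * (1 / (r+1) - 1 / (r+1+j)) := by
    intro j
    induction j with
    | zero => simp
    | succ j ih =>
      have hj : (0:ℝ) ≤ j := Nat.cast_nonneg j
      have e1 := intervalIntegral.integral_add_adjacent_intervals
        (ii (α := r+1) (β := r+1+j) (by linarith) (by linarith)) (ii (α := r+1+j) (β := r+1+j+1) (by linarith) (by linarith))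
      push_cast
      rw [← add_assoc, ← e1]
      set y := r + 1 + (j:ℝ) with hy
      have hy1 : 1 ≤ y := by linarith
      have cm : IntervalIntegrable m volume y (y+1) :=
        (hm.mono (Set.Icc_subset_Ici_self.trans (Set.Ici_subset_Ici.2 (by linarith)))).intervalIntegrable_of_Icc (by linarith)
      have e2 : ∫ x in y..(y+1), m x / x ^ 2 ≤ ∫ x in y..(y+1), (1 / y^2) * m x := by
        refine intervalIntegral.integral_mono_on (by linarith) (ii (by linarith) (by linarith)) (cm.const_mul _) fun x hx => ?_
        have := hm0 x (by linarith [hx.1])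
        have hx1 := hx.1
        rw [div_eq_mul_one_div, mul_comm]
        gcongr
      rw [intervalIntegral.integral_const_mul] at e2
      have e3 : 1 / y^2 * ∫ x in y..(y+1), m x ≤ 1 / y^2 * M := by
        gcongr; exact hM y (by linarith)
      have e4 : 1 / y^2 * M ≤ 2 * M * (1 / y - 1 / (y + 1)) := by
        have : 1 / y - 1 / (y+1) = 1 / (y * (y+1)) := by field_simp; ring
        rw [this]
        have : 1 / y^2 ≤ 2 * (1 / (y * (y+1))) := by
          rw [← mul_div_assoc, div_le_div_iff₀ (by positivity) (by positivity)]; nlinarith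
        nlinarith
      linarith
  obtain ⟨j, hj⟩ := exists_nat_ge (t - (r+1))
  have e1 := intervalIntegral.integral_add_adjacent_intervals (ii (α := r+1) (β := t) (by linarith) (by linarith))
    (ii (α := t) (β := r+1+j) (by linarith) (by linarith))
  have e2 : 0 ≤ ∫ x in t..(r+1+j), m x / x ^ 2 := intervalIntegral.integral_nonneg (by linarith) fun x hx =>
    div_nonneg (hm0 x (by linarith [hx.1])) (sq_nonneg _)
  have e3 : 2 * M * (1 / (r+1) - 1 / (r+1+j)) ≤ 2 * M / (r + 1) := by
    have : 0 ≤ 2 * M * (1 / (r+1+j)) := by positivity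
    have e : 2 * M / (r+1) = 2 * M * (1 / (r+1)) := by ring
    rw [e]; linarith
  linarith [key j]

lemma win_int {m : ℝ → ℝ} {r M : ℝ} (hm : ContinuousOn m (Set.Ici r)) (hm0 : ∀ x, r ≤ x → 0 ≤ m x)
    (hM : ∀ t, r ≤ t → ∫ x in t..(t+1), m x ≤ M) (hM0 : 0 ≤ M) {t L : ℝ} (ht : r ≤ t) (hL : 0 ≤ L) :
    ∫ x in t..(t+L), m x ≤ (L + 1) * M := by
  have ii : ∀ {α β : ℝ}, r ≤ α → α ≤ β → IntervalIntegrable m volume α β := fun h1 h2 =>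
    (hm.mono (Set.Icc_subset_Ici_self.trans (Set.Ici_subset_Ici.2 h1))).intervalIntegrable_of_Icc h2
  have key : ∀ j : ℕ, ∫ x in t..(t+j), m x ≤ j * M := by
    intro j
    induction j with
    | zero => simp
    | succ j ih =>
      have hj : (0:ℝ) ≤ j := Nat.cast_nonneg j
      have e1 := intervalIntegral.integral_add_adjacent_intervals
        (ii (α := t) (β := t+j) (by linarith) (by linarith)) (ii (α := t+j) (β := t+j+1) (by linarith) (by linarith))
      push_cast
      rw [← add_assoc, ← e1]
      have := hM (t+j) (by linarith)
      linarith
  have h1 := Nat.le_ceil L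
  have h2 := Nat.ceil_lt_add_one hL
  have e1 := intervalIntegral.integral_add_adjacent_intervals (ii (α := t) (β := t+L) (by linarith) (by linarith))
    (ii (α := t+L) (β := t+⌈L⌉₊) (by linarith) (by linarith))
  have e2 : 0 ≤ ∫ x in (t+L)..(t+⌈L⌉₊), m x := intervalIntegral.integral_nonneg (by linarith) fun x hx =>
    hm0 x (by linarith [hx.1])
  have := key ⌈L⌉₊
  nlinarith

end PartB1

section PartB2
open scoped ENNReal Topology Pointwise

section
variable {k : ℂ} {r q M A s CH m1 : ℝ} {c : ℂ} {m a e p v B g1 : ℝ → ℝ} {N n U uV D g2 : ℝ → ℂ}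

lemma cont_of_deriv {F : Type*} [NormedAddCommGroup F] [NormedSpace ℝ F] {f f' : ℝ → F} {r : ℝ}
    (h : ∀ x, r ≤ x → HasDerivAt f (f' x) x) : ContinuousOn f (Set.Ici r) :=
  fun x hx => (h x hx).continuousAt.continuousWithinAt

lemma iiI {F : Type*} [NormedAddCommGroup F] {f : ℝ → F} {r : ℝ} (h : ContinuousOn f (Set.Ici r)) {α β : ℝ}
    (h1 : r ≤ α) (h2 : α ≤ β) : IntervalIntegrable f volume α β :=
  (h.mono (Set.Icc_subset_Ici_self.trans (Set.Ici_subset_Ici.2 h1))).intervalIntegrable_of_Icc h2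

lemma subIcc {r α β : ℝ} (h1 : r ≤ α) : Set.Icc α β ⊆ Set.Ici r :=
  Set.Icc_subset_Ici_self.trans (Set.Ici_subset_Ici.2 h1)

lemma cinv {r : ℝ} (hr : 0 < r) : ContinuousOn (fun x : ℝ => 2 / x) (Set.Ici r) :=
  continuousOn_const.div continuousOn_id fun x hx => (hr.trans_le hx).ne'

lemma re_deriv {f : ℝ → ℂ} {f' : ℂ} {x : ℝ} (c : ℂ) (h : HasDerivAt f f' x) :
    HasDerivAt (fun y => ((starRingEnd ℂ) c * f y).re) ((starRingEnd ℂ) c * f').re x :=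
  Complex.reCLM.hasFDerivAt.comp_hasDerivAt x (h.const_mul ((starRingEnd ℂ) c))

lemma re_cont {f : ℝ → ℂ} {S : Set ℝ} (c : ℂ) (h : ContinuousOn f S) :
    ContinuousOn (fun y => ((starRingEnd ℂ) c * f y).re) S :=
  Complex.continuous_re.comp_continuousOn (continuousOn_const.mul h)

lemma re_bd (c z : ℂ) : |((starRingEnd ℂ) c * z).re| ≤ ‖c‖ * ‖z‖ := by
  refine (Complex.abs_re_le_norm _).trans ?_
  rw [norm_mul, RCLike.norm_conj]

noncomputable def wf (r ℓ x : ℝ) : ℝ := max 0 (1 - (x - r) / ℓ)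

lemma wf_cont (r ℓ : ℝ) : Continuous (wf r ℓ) := by unfold wf; fun_prop

lemma wf_nn (r ℓ x : ℝ) : 0 ≤ wf r ℓ x := le_max_left _ _

lemma wf_le {r ℓ x : ℝ} (hl : 0 < ℓ) (hx : r ≤ x) : wf r ℓ x ≤ 1 := by
  unfold wf
  have : 0 ≤ (x - r) / ℓ := div_nonneg (by linarith) hl.le
  exact max_le (by norm_num) (by linarith)

lemma wf_lin {r ℓ x : ℝ} (hl : 0 < ℓ) (hx : x ≤ r + ℓ) : wf r ℓ x = 1 - (x - r) / ℓ := by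
  unfold wf
  refine max_eq_right ?_
  have : (x - r) / ℓ ≤ 1 := (div_le_one hl).2 (by linarith)
  linarith

lemma wf_zero {r ℓ x : ℝ} (hl : 0 < ℓ) (hx : r + ℓ ≤ x) : wf r ℓ x = 0 := by
  unfold wf
  refine max_eq_left ?_
  have : 1 ≤ (x - r) / ℓ := (one_le_div hl).2 (by linarith)
  linarith

lemma wf_low {r ℓ x : ℝ} (hl : 0 < ℓ) (hr : 0 < r) (hx : r ≤ x) : (1 - wf r ℓ x) * (2 / x) ≤ 2 / ℓ := by
  have h1 : 1 - (x - r) / ℓ ≤ wf r ℓ x := le_max_right _ _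
  have hx0 : 0 < x := hr.trans_le hx
  have h2 : 1 - wf r ℓ x ≤ x / ℓ := by
    have : (x - r) / ℓ ≤ x / ℓ := by gcongr; linarith
    linarith
  calc _ ≤ x / ℓ * (2 / x) := by gcongr
    _ = _ := by field_simp

lemma key_le (d : D1 k r q M A s CH m1 c m a e p v B g1 N n U uV D g2) {ℓ t : ℝ} (hl : 0 < ℓ) (ht : r ≤ t)
    (htl : t ≤ r + ℓ) :
    |(∫ x in r..t, v x) - (B t - B r)| ≤ wf r ℓ t * (‖c‖ * (‖D t‖ + ‖n t‖)) + ‖c‖ * (‖D r‖ + ‖n r‖) +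
      (∫ x in r..t, (2 / x) * |B x - wf r ℓ x * ((starRingEnd ℂ) c * D x).re|) +
      ((∫ x in r..t, |g1 x|) + ‖c‖ * (∫ x in r..t, ‖g2 x‖) +
      ℓ⁻¹ * (‖c‖ * ((∫ x in r..t, ‖D x‖) + ∫ x in r..t, ‖n x‖)) +
      2 * ‖k‖ * ‖c‖ * ‖∫ x in r..t, (wf r ℓ x : ℂ) * n x‖) := by
  have cB := cont_of_deriv d.dB
  have cD := cont_of_deriv d.dD
  have cn := cont_of_deriv d.dn
  have cg1 := d.cg1
  have cg2 := d.cg2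
  have cv := d.cv
  have c2 := cinv d.hr
  have cw : ContinuousOn (fun x : ℝ => 1 - (x - r) / ℓ) (Set.Ici r) := by fun_prop
  have cwc : ContinuousOn (fun x : ℝ => (((1 - (x - r) / ℓ : ℝ)) : ℂ)) (Set.Ici r) := by fun_prop
  have hsub := subIcc (r := r) (α := r) (β := t) le_rfl
  set cc := (starRingEnd ℂ) c with hcc
  set G : ℝ → ℝ := fun x => B x - (1 - (x - r) / ℓ) * (cc * D x).re with hG
  have cG : ContinuousOn G (Set.Ici r) := cB.sub (cw.mul (re_cont c cD))
  set R1 : ℝ → ℝ := fun x => g1 x - (2 / x) * G x - (1 - (x - r) / ℓ) * (cc * g2 x).re +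
    ℓ⁻¹ * ((cc * D x).re - (cc * n x).re) with hR1
  have cR1 : ContinuousOn R1 (Set.Ici r) :=
    ((cg1.sub (c2.mul cG)).sub (cw.mul (re_cont c cg2))).add (continuousOn_const.mul ((re_cont c cD).sub (re_cont c cn)))
  set R2 : ℝ → ℂ := fun x => ((1 - (x - r) / ℓ : ℝ) : ℂ) * n x with hR2
  have cR2 : ContinuousOn R2 (Set.Ici r) := cwc.mul cn
  set F : ℝ → ℝ := fun x => B x - (1 - (x - r) / ℓ) * ((cc * D x).re - (cc * n x).re) with hF
  have dF : ∀ x, r ≤ x → HasDerivAt F (v x + R1 x - (cc * (2 * Complex.I * k) * R2 x).re) x := by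
    intro x hx
    have hw : HasDerivAt (fun y : ℝ => 1 - (y - r) / ℓ) (-ℓ⁻¹) x := by
      have := (((hasDerivAt_id x).sub_const r).div_const ℓ).const_sub 1
      simpa [div_eq_mul_inv] using this
    have h := (d.dB x hx).sub (hw.mul ((re_deriv c (d.dD x hx)).sub (re_deriv c (d.dn x hx))))
    refine h.congr_deriv ?_
    have e1 : (cc * (uV x + g2 x - ((2 / x : ℝ) : ℂ) * D x)).re = (cc * uV x).re + (cc * g2 x).re - 2 / x * (cc * D x).re := by
      have : cc * (uV x + g2 x - ((2 / x : ℝ) : ℂ) * D x) = cc * uV x + cc * g2 x - ((2 / x : ℝ) : ℂ) * (cc * D x) := by ring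
      rw [this, Complex.sub_re, Complex.add_re, Complex.re_ofReal_mul]
    have e2 : (cc * (uV x - 2 * Complex.I * k * n x)).re = (cc * uV x).re - (cc * (2 * Complex.I * k) * n x).re := by
      rw [← Complex.sub_re]; ring_nf
    have e3 : (cc * (2 * Complex.I * k) * R2 x).re = (1 - (x - r) / ℓ) * (cc * (2 * Complex.I * k) * n x).re := by
      rw [← Complex.re_ofReal_mul]; simp only [hR2]; ring_nf
    rw [e3]
    simp only [← hcc, e1, e2, hR1, hG, Pi.sub_apply]
    ring
  have cP : ContinuousOn (fun x => (cc * (2 * Complex.I * k) * R2 x).re) (Set.Ici r) :=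
    Complex.continuous_re.comp_continuousOn (continuousOn_const.mul cR2)
  have hI := ftcI ht dF (((cv.add cR1).sub cP).mono hsub)
  have iR2 := iiI cR2 le_rfl ht
  rw [intervalIntegral.integral_sub ((iiI cv le_rfl ht).add (iiI cR1 le_rfl ht)) (iiI cP le_rfl ht),
    intervalIntegral.integral_add (iiI cv le_rfl ht) (iiI cR1 le_rfl ht)] at hI
  have hP : |∫ x in r..t, (cc * (2 * Complex.I * k) * R2 x).re| ≤ 2 * ‖k‖ * ‖c‖ * ‖∫ x in r..t, R2 x‖ := by
    have e : ∫ x in r..t, (cc * (2 * Complex.I * k) * R2 x).re = (cc * (2 * Complex.I * k) * ∫ x in r..t, R2 x).re := by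
      rw [← intervalIntegral.integral_const_mul]
      exact Complex.reCLM.intervalIntegral_comp_comm (iR2.const_mul _)
    rw [e]
    refine (Complex.abs_re_le_norm _).trans (le_of_eq ?_)
    simp only [norm_mul, hcc, RCLike.norm_conj, Complex.norm_I, Complex.norm_ofNat]; ring
  have eR2 : ∫ x in r..t, (wf r ℓ x : ℂ) * n x = ∫ x in r..t, R2 x :=
    intervalIntegral.integral_congr fun x hx => by
      rw [Set.uIcc_of_le ht] at hx
      simp only [hR2, wf_lin hl (hx.2.trans htl)]
  have eG : ∫ x in r..t, (2 / x) * |B x - wf r ℓ x * (cc * D x).re| = ∫ x in r..t, (2/x) * |G x| :=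
    intervalIntegral.integral_congr fun x hx => by
      rw [Set.uIcc_of_le ht] at hx
      simp only [hG, wf_lin hl (hx.2.trans htl)]
  have hR1b : |∫ x in r..t, R1 x| ≤ ∫ x in r..t, (|g1 x| + (2 / x) * |G x| + ‖c‖ * ‖g2 x‖ + ℓ⁻¹ * (‖c‖ * (‖D x‖ + ‖n x‖))) := by
    refine (intervalIntegral.abs_integral_le_integral_abs ht).trans ?_
    refine intervalIntegral.integral_mono_on ht (iiI cR1.abs le_rfl ht)
      (iiI (((cg1.abs.add (c2.mul cG.abs)).add (continuousOn_const.mul cg2.norm)).add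
        (continuousOn_const.mul (continuousOn_const.mul (cD.norm.add cn.norm)))) le_rfl ht) fun x hx => ?_
    have hx0 : 0 < x := d.hr.trans_le hx.1
    have hw1 : 0 ≤ 1 - (x - r) / ℓ := by rw [← wf_lin hl (hx.2.trans htl)]; exact wf_nn _ _ _
    have hw2 : 1 - (x - r) / ℓ ≤ 1 := by rw [← wf_lin hl (hx.2.trans htl)]; exact wf_le hl hx.1
    have b1 : |(1 - (x - r) / ℓ) * (cc * g2 x).re| ≤ ‖c‖ * ‖g2 x‖ := by
      rw [abs_mul, abs_of_nonneg hw1]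
      calc _ ≤ 1 * (‖c‖ * ‖g2 x‖) := mul_le_mul hw2 (re_bd _ _) (abs_nonneg _) zero_le_one
        _ = _ := one_mul _
    have b2 : |ℓ⁻¹ * ((cc * D x).re - (cc * n x).re)| ≤ ℓ⁻¹ * (‖c‖ * (‖D x‖ + ‖n x‖)) := by
      rw [abs_mul, abs_of_pos (inv_pos.2 hl)]
      gcongr
      refine (abs_sub _ _).trans ?_
      rw [mul_add]
      exact add_le_add (re_bd _ _) (re_bd _ _)
    have b3 : |2 / x * G x| = 2 / x * |G x| := by rw [abs_mul, abs_of_pos (by positivity)]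
    calc |R1 x| ≤ |g1 x| + |2 / x * G x| + |(1 - (x - r) / ℓ) * (cc * g2 x).re| + |ℓ⁻¹ * ((cc * D x).re - (cc * n x).re)| := by
          refine (abs_add_le _ _).trans ?_
          gcongr
          refine (abs_sub _ _).trans ?_
          gcongr
          exact abs_sub _ _
      _ ≤ _ := by rw [b3]; gcongr
  have esum : ∫ x in r..t, (|g1 x| + (2 / x) * |G x| + ‖c‖ * ‖g2 x‖ + ℓ⁻¹ * (‖c‖ * (‖D x‖ + ‖n x‖))) =
      (∫ x in r..t, |g1 x|) + (∫ x in r..t, (2 / x) * |G x|) + ‖c‖ * (∫ x in r..t, ‖g2 x‖) +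
        ℓ⁻¹ * (‖c‖ * ((∫ x in r..t, ‖D x‖) + ∫ x in r..t, ‖n x‖)) := by
    have j1 := iiI cg1.abs le_rfl ht
    have j2 : IntervalIntegrable (fun x => 2 / x * |G x|) volume r t := iiI (c2.mul cG.abs) le_rfl ht
    have j3 := (iiI cg2.norm le_rfl ht).const_mul ‖c‖
    have j4 := iiI cD.norm le_rfl ht
    have j5 := iiI cn.norm le_rfl ht
    rw [intervalIntegral.integral_add ((j1.add j2).add j3) (((j4.add j5).const_mul _).const_mul _),
      intervalIntegral.integral_add (j1.add j2) j3, intervalIntegral.integral_add j1 j2,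
      intervalIntegral.integral_const_mul, intervalIntegral.integral_const_mul, intervalIntegral.integral_const_mul,
      intervalIntegral.integral_add j4 j5]
  have hFt : |F t - B t| ≤ wf r ℓ t * (‖c‖ * (‖D t‖ + ‖n t‖)) := by
    have : F t - B t = - (wf r ℓ t * ((cc * D t).re - (cc * n t).re)) := by
      simp only [hF, wf_lin hl htl]; ring
    rw [this, abs_neg, abs_mul, abs_of_nonneg (wf_nn _ _ _)]
    refine mul_le_mul_of_nonneg_left ((abs_sub _ _).trans ?_) (wf_nn _ _ _)
    rw [mul_add]
    exact add_le_add (re_bd _ _) (re_bd _ _)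
  have hFr : |F r - B r| ≤ ‖c‖ * (‖D r‖ + ‖n r‖) := by
    have : F r - B r = - (((cc * D r).re - (cc * n r).re)) := by
      simp only [hF]; simp
    rw [this, abs_neg]
    refine ((abs_sub _ _).trans ?_)
    rw [mul_add]
    exact add_le_add (re_bd _ _) (re_bd _ _)
  rw [eR2, eG]
  rw [esum] at hR1b
  have e : (∫ x in r..t, v x) - (B t - B r) = (F t - B t) - (F r - B r) - (∫ x in r..t, R1 x) +
      ∫ x in r..t, (cc * (2 * Complex.I * k) * R2 x).re := by linarith
  rw [e]
  have t1 := abs_add_le ((F t - B t) - (F r - B r) - (∫ x in r..t, R1 x)) (∫ x in r..t, (cc * (2 * Complex.I * k) * R2 x).re)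
  have t2 := abs_sub ((F t - B t) - (F r - B r)) (∫ x in r..t, R1 x)
  have t3 := abs_sub (F t - B t) (F r - B r)
  linarith

lemma key_gt (d : D1 k r q M A s CH m1 c m a e p v B g1 N n U uV D g2) {α t : ℝ} (hα : r ≤ α) (ht : α ≤ t) :
    |(∫ x in α..t, v x) - (B t - B α)| ≤ (∫ x in α..t, (2 / x) * |B x|) + ∫ x in α..t, |g1 x| := by
  have cB := cont_of_deriv d.dB
  have cg1 := d.cg1
  have cv := d.cv
  have c2 := cinv d.hr
  have hI := ftcI ht (fun x hx => d.dB x (hα.trans hx)) (((cv.add cg1).sub (c2.mul cB)).mono (subIcc hα))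
  have i1 := iiI cg1 hα ht
  have i2 : IntervalIntegrable (fun x => 2 / x * B x) volume α t := iiI (c2.mul cB) hα ht
  rw [intervalIntegral.integral_sub ((iiI cv hα ht).add i1) i2,
    intervalIntegral.integral_add (iiI cv hα ht) i1] at hI
  have h1 := intervalIntegral.abs_integral_le_integral_abs (μ := volume) (f := g1) ht
  have h2 := intervalIntegral.abs_integral_le_integral_abs (μ := volume) (f := fun x => 2 / x * B x) ht
  have h3 : ∫ x in α..t, |2 / x * B x| = ∫ x in α..t, (2 / x) * |B x| :=
    intervalIntegral.integral_congr fun x hx => by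
      rw [Set.uIcc_of_le ht] at hx
      have hx0 : 0 < x := d.hr.trans_le (hα.trans hx.1)
      simp only [abs_mul]; rw [abs_of_pos (by positivity : 0 < 2 / x)]
  rw [h3] at h2
  have e : (∫ x in α..t, v x) - (B t - B α) = (∫ x in α..t, 2 / x * B x) - ∫ x in α..t, g1 x := by linarith
  rw [e]
  have := abs_sub (∫ x in α..t, 2 / x * B x) (∫ x in α..t, g1 x)
  linarith

lemma key_bound (d : D1 k r q M A s CH m1 c m a e p v B g1 N n U uV D g2) {ℓ t : ℝ} (hl : 0 < ℓ) (ht : r ≤ t) :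
    |∫ x in r..t, v x| ≤ |B t| + |B r| + wf r ℓ t * (‖c‖ * (‖D t‖ + ‖n t‖)) + ‖c‖ * (‖D r‖ + ‖n r‖) +
      (∫ x in r..t, (2 / x) * |B x - wf r ℓ x * ((starRingEnd ℂ) c * D x).re|) +
      ((∫ x in r..t, |g1 x|) + ‖c‖ * (∫ x in r..(min t (r+ℓ)), ‖g2 x‖) +
      ℓ⁻¹ * (‖c‖ * ((∫ x in r..(min t (r+ℓ)), ‖D x‖) + ∫ x in r..(min t (r+ℓ)), ‖n x‖)) +
      2 * ‖k‖ * ‖c‖ * ‖∫ x in r..(min t (r+ℓ)), (wf r ℓ x : ℂ) * n x‖) := by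
  rcases le_total t (r + ℓ) with h | h
  · rw [min_eq_left h]
    have h1 := key_le d hl ht h
    have t1 := abs_add_le ((∫ x in r..t, v x) - (B t - B r)) (B t - B r)
    have t2 := abs_sub (B t) (B r)
    rw [sub_add_cancel] at t1
    linarith
  · rw [min_eq_right h]
    have hrl : r ≤ r + ℓ := by linarith
    have h1 := key_le d hl hrl le_rfl
    have h2 := key_gt d hrl h
    have cB := cont_of_deriv d.dB
    have cD := cont_of_deriv d.dD
    have cG : ContinuousOn (fun x => (2 / x) * |B x - wf r ℓ x * ((starRingEnd ℂ) c * D x).re|) (Set.Ici r) :=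
      (cinv d.hr).mul (cB.sub ((wf_cont r ℓ).continuousOn.mul (re_cont c cD))).abs
    have e1 := intervalIntegral.integral_add_adjacent_intervals (iiI d.cv le_rfl hrl) (iiI d.cv hrl h)
    have e2 := intervalIntegral.integral_add_adjacent_intervals (iiI d.cg1.abs le_rfl hrl) (iiI d.cg1.abs hrl h)
    have e3 := intervalIntegral.integral_add_adjacent_intervals (iiI cG le_rfl hrl) (iiI cG hrl h)
    have e4 : ∫ x in (r+ℓ)..t, (2 / x) * |B x - wf r ℓ x * ((starRingEnd ℂ) c * D x).re| =
        ∫ x in (r+ℓ)..t, (2 / x) * |B x| :=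
      intervalIntegral.integral_congr fun x hx => by
        rw [Set.uIcc_of_le h] at hx
        simp only [wf_zero hl hx.1]; simp
    rw [← e1, ← e2, ← e3, e4, wf_zero hl h, zero_mul]
    rw [wf_zero hl le_rfl, zero_mul] at h1
    set I1 := ∫ x in r..(r+ℓ), v x
    set I2 := ∫ x in (r+ℓ)..t, v x
    have t0 : I1 + I2 = (I1 - (B (r+ℓ) - B r)) + (I2 - (B t - B (r+ℓ))) + (B t - B r) := by ring
    have t1 := abs_add_le ((I1 - (B (r+ℓ) - B r)) + (I2 - (B t - B (r+ℓ)))) (B t - B r)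
    have t3 := abs_add_le (I1 - (B (r+ℓ) - B r)) (I2 - (B t - B (r+ℓ)))
    have t2 := abs_sub (B t) (B r)
    rw [t0]
    linarith
end

end PartB2

section PartB3
open scoped ENNReal Topology Pointwise

section
variable {k : ℂ} {r q M A s CH m1 : ℝ} {c : ℂ} {m a e p v B g1 : ℝ → ℝ} {N n U uV D g2 : ℝ → ℂ}

lemma D1.cS (d : D1 k r q M A s CH m1 c m a e p v B g1 N n U uV D g2) : ‖c‖ * √s ≤ √(m r) := by
  refine Real.le_sqrt_of_sq_le ?_
  rw [mul_pow, Real.sq_sqrt d.hs.le]; exact d.bc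

lemma D1.Nr (d : D1 k r q M A s CH m1 c m a e p v B g1 N n U uV D g2) : ‖N r‖ ≤ √(m r) * √m1 := by
  rw [← Real.sqrt_mul (d.m_nn r le_rfl)]; exact Real.le_sqrt_of_sq_le d.bN1

lemma D1.nr (d : D1 k r q M A s CH m1 c m a e p v B g1 N n U uV D g2) : ‖c‖ * ‖n r‖ ≤ √(m r) * √m1 := by
  have h : ‖n r‖ ≤ √s * √m1 := by
    rw [← Real.sqrt_mul d.hs.le]; exact Real.le_sqrt_of_sq_le d.bn1
  calc _ ≤ ‖c‖ * (√s * √m1) := by gcongr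
    _ = (‖c‖ * √s) * √m1 := by ring
    _ ≤ _ := by gcongr; exact d.cS

lemma D1.Dx (d : D1 k r q M A s CH m1 c m a e p v B g1 N n U uV D g2) {x : ℝ} (hx : r ≤ x) :
    ‖c‖ * ‖D x‖ ≤ √(m r) * (q * √(m x)) := by
  have h : ‖D x‖ ≤ √s * (q * √(m x)) := by
    refine abs_le_of_sq_le_sq' ?_ (by have := d.hq; positivity) |>.2
    rw [mul_pow, mul_pow, Real.sq_sqrt d.hs.le, Real.sq_sqrt (d.m_nn x hx)]
    exact (d.bD x hx).trans (mul_le_mul_of_nonneg_left (d.be x hx) d.hs.le)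
  have := d.hq
  calc _ ≤ ‖c‖ * (√s * (q * √(m x))) := by gcongr
    _ = (‖c‖ * √s) * (q * √(m x)) := by ring
    _ ≤ _ := by gcongr; exact d.cS

lemma D1.Br (d : D1 k r q M A s CH m1 c m a e p v B g1 N n U uV D g2) : |B r| ≤ q * √(m r) ^ 2 := by
  have hm := d.m_nn r le_rfl
  rw [Real.sq_sqrt hm]
  refine abs_le_of_sq_le_sq ?_ (mul_nonneg d.hq hm)
  refine (d.bB r le_rfl).trans ?_
  have := mul_le_mul_of_nonneg_right (d.be r le_rfl) hm
  nlinarith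

lemma D1.In (d : D1 k r q M A s CH m1 c m a e p v B g1 N n U uV D g2) {t b : ℝ} (ht : r ≤ t) (hb : t ≤ r + b) :
    ‖c‖ * (∫ x in r..t, ‖n x‖) ≤ √(m r) * (√b * √A) := by
  have h := csI (f := fun x => ‖n x‖) (x := fun _ => s) (y := a) (X := s * b) ht ((cont_of_deriv d.dn).norm.mono (subIcc le_rfl))
    continuousOn_const (d.ca.mono (subIcc le_rfl)) (fun _ _ => d.hs.le) (fun x hx => d.a_nn x hx.1) (fun x hx => d.bn x hx.1)
    (by rw [intervalIntegral.integral_const, smul_eq_mul, mul_comm]; have := d.hs; gcongr; linarith) (d.Ia t ht)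
  rw [Real.sqrt_mul d.hs.le] at h
  calc _ ≤ ‖c‖ * (√s * √b * √A) := by gcongr
    _ = (‖c‖ * √s) * (√b * √A) := by ring
    _ ≤ _ := by gcongr; exact d.cS

lemma D1.Ig2 (d : D1 k r q M A s CH m1 c m a e p v B g1 N n U uV D g2) {t b : ℝ} (ht : r ≤ t) (hb : t ≤ r + b) :
    ‖c‖ * (∫ x in r..t, ‖g2 x‖) ≤ √(m r) * (q * (√b * √A)) := by
  have h := csI (f := fun x => ‖g2 x‖) (x := fun _ => q ^ 2 * s) (y := a) (X := q ^ 2 * s * b) ht (d.cg2.norm.mono (subIcc le_rfl))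
    continuousOn_const (d.ca.mono (subIcc le_rfl)) (fun _ _ => mul_nonneg (sq_nonneg _) d.hs.le) (fun x hx => d.a_nn x hx.1) (fun x hx => d.bg2 x hx.1)
    (by rw [intervalIntegral.integral_const, smul_eq_mul, mul_comm]; have := d.hs; gcongr; linarith) (d.Ia t ht)
  rw [Real.sqrt_mul (mul_nonneg (sq_nonneg _) d.hs.le), Real.sqrt_mul (sq_nonneg _), Real.sqrt_sq d.hq] at h
  have := d.hq
  calc _ ≤ ‖c‖ * (q * √s * √b * √A) := by gcongr
    _ = (‖c‖ * √s) * (q * (√b * √A)) := by ring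
    _ ≤ _ := by gcongr; exact d.cS

lemma D1.Ig1 (d : D1 k r q M A s CH m1 c m a e p v B g1 N n U uV D g2) {t : ℝ} (ht : r ≤ t) :
    (∫ x in r..t, |g1 x|) ≤ 2 * (q * (√M * √A)) := by
  have h := csI (f := fun x => |g1 x|) (x := fun x => 4 * e x) (y := a) (X := 4 * (q ^ 2 * M)) ht (d.cg1.abs.mono (subIcc le_rfl))
    ((continuousOn_const.mul d.ce).mono (subIcc le_rfl)) (d.ca.mono (subIcc le_rfl)) (fun x hx => by have := d.e_nn x hx.1; positivity) (fun x hx => d.a_nn x hx.1) (fun x hx => by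
      rw [sq_abs, mul_assoc]; exact d.bg1 x hx.1)
    (by rw [intervalIntegral.integral_const_mul]; gcongr; exact d.Ie t ht) (d.Ia t ht)
  rw [Real.sqrt_mul (by norm_num), Real.sqrt_mul (sq_nonneg _), Real.sqrt_sq d.hq,
    show (4:ℝ) = 2 ^ 2 by norm_num, Real.sqrt_sq (by norm_num)] at h
  linarith

/-- pointwise growth of `m` -/
lemma D1.mgrow (d : D1 k r q M A s CH m1 c m a e p v B g1 N n U uV D g2) {t b : ℝ} (ht : r ≤ t) (hb : t ≤ r + b) :
    √(m t) ≤ √(m r) + 2 * (√b * √A) := by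
  have hb0 : 0 ≤ b := by linarith
  have cm := cont_of_deriv d.dm
  have cN := cont_of_deriv d.dN
  obtain ⟨y, hy, hmax⟩ := (isCompact_Icc (a := r) (b := t)).exists_isMaxOn (Set.nonempty_Icc.2 ht) (cm.mono (subIcc le_rfl))
  have hyr : r ≤ y := hy.1
  have h1 := ftcI hyr d.dm ((continuousOn_const.mul (Complex.continuous_re.comp_continuousOn cN)).mono (subIcc le_rfl))
  have h2 : ∫ x in r..y, 2 * (N x).re ≤ √(4 * m y * b) * √A := by
    refine csI (f := fun x => 2 * (N x).re) (x := fun _ => 4 * m y) (y := a) hyr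
      ((continuousOn_const.mul (Complex.continuous_re.comp_continuousOn cN)).mono (subIcc le_rfl))
      continuousOn_const (d.ca.mono (subIcc le_rfl)) (fun _ _ => by have := d.m_nn y hyr; positivity)
      (fun x hx => d.a_nn x hx.1) (fun x hx => ?_) ?_ (d.Ia y hyr)
    · have e1 := d.bN x hx.1
      have e2 : m x ≤ m y := hmax ⟨hx.1, hx.2.trans hy.2⟩
      have e3 := Complex.abs_re_le_norm (N x)
      have e4 : (N x).re ^ 2 ≤ ‖N x‖ ^ 2 := by rw [← sq_abs]; gcongr
      have e5 := mul_le_mul_of_nonneg_right e2 (d.a_nn x hx.1)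
      nlinarith
    · rw [intervalIntegral.integral_const, smul_eq_mul, mul_comm]
      have := d.m_nn y hyr
      gcongr; linarith [hy.2]
  have hmy := d.m_nn y hyr
  have hmr := d.m_nn r le_rfl
  rw [Real.sqrt_mul (by positivity), Real.sqrt_mul (by norm_num), show (4:ℝ) = 2 ^ 2 by norm_num, Real.sqrt_sq (by norm_num)] at h2
  have h3 : √(m t) ≤ √(m y) := Real.sqrt_le_sqrt (hmax ⟨ht, le_rfl⟩)
  have e1 := Real.sq_sqrt hmy
  have e2 := Real.sq_sqrt hmr
  set f := √(m y)
  set g := √(m r)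
  have hf : 0 ≤ f := Real.sqrt_nonneg _
  have hg : 0 ≤ g := Real.sqrt_nonneg _
  set X := √b * √A with hX
  have hX0 : 0 ≤ X := by positivity
  have h4 : f ^ 2 ≤ g ^ 2 + 2 * f * X := by
    rw [e1, e2]; linarith
  refine h3.trans ?_
  nlinarith

lemma D1.ID (d : D1 k r q M A s CH m1 c m a e p v B g1 N n U uV D g2) {t b : ℝ} (ht : r ≤ t) (hb : t ≤ r + b) :
    ‖c‖ * (∫ x in r..t, ‖D x‖) ≤ b * (√(m r) * (q * (√(m r) + 2 * (√b * √A)))) := by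
  rw [← intervalIntegral.integral_const_mul]
  have hq := d.hq
  calc _ ≤ ∫ _x in r..t, (√(m r) * (q * (√(m r) + 2 * (√b * √A)))) := by
        refine intervalIntegral.integral_mono_on ht ((iiI (cont_of_deriv d.dD).norm le_rfl ht).const_mul _)
          intervalIntegrable_const fun x hx => ?_
        refine (d.Dx hx.1).trans ?_
        gcongr
        exact d.mgrow hx.1 (hx.2.trans hb)
    _ ≤ _ := by
        rw [intervalIntegral.integral_const, smul_eq_mul]
        gcongr
        linarith

lemma D1.cG (d : D1 k r q M A s CH m1 c m a e p v B g1 N n U uV D g2) (ℓ : ℝ) :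
    ContinuousOn (fun x => (2 / x) * |B x - wf r ℓ x * ((starRingEnd ℂ) c * D x).re|) (Set.Ici r) :=
  (cinv d.hr).mul ((cont_of_deriv d.dB).sub ((wf_cont r ℓ).continuousOn.mul (re_cont c (cont_of_deriv d.dD)))).abs

lemma D1.G1 (d : D1 k r q M A s CH m1 c m a e p v B g1 N n U uV D g2) {t b ℓ : ℝ} (hl : 0 < ℓ) (ht : r ≤ t) (hb : t ≤ r + b) :
    (∫ x in r..t, (2 / x) * |B x - wf r ℓ x * ((starRingEnd ℂ) c * D x).re|) ≤
      2 * (q * √M * (√CH * √A)) + 2 * (√(m r) * q * √b * (√CH * √A)) + 2 / ℓ * b * (q * √(m r) ^ 2) := by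
  have hq := d.hq
  have hs := d.hs
  have hb0 : 0 ≤ b := by linarith
  have hx0 : ∀ x ∈ Set.Ici r, x ≠ 0 := fun x hx => (d.hr.trans_le hx).ne'
  have cpx : ContinuousOn (fun x => p x / x ^ 2) (Set.Ici r) :=
    d.cp.div (continuousOn_id.pow 2) fun x hx => pow_ne_zero 2 (hx0 x hx)
  have c1 : ContinuousOn (fun x => √(e x) * √(p x / x ^ 2)) (Set.Ici r) := d.ce.sqrt.mul cpx.sqrt
  have c2 : ContinuousOn (fun x => √(p x / x ^ 2)) (Set.Ici r) := cpx.sqrt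
  have pnn : ∀ x, r ≤ x → 0 ≤ p x / x ^ 2 := fun x hx => div_nonneg (d.p_nn x hx) (sq_nonneg _)
  have h1 : ∫ x in r..t, √(e x) * √(p x / x ^ 2) ≤ √(q ^ 2 * M) * √(CH * A) :=
    csI ht (c1.mono (subIcc le_rfl)) (d.ce.mono (subIcc le_rfl)) (cpx.mono (subIcc le_rfl)) (fun x hx => d.e_nn x hx.1)
      (fun x hx => pnn x hx.1) (fun x hx => by
        rw [mul_pow, Real.sq_sqrt (d.e_nn x hx.1), Real.sq_sqrt (pnn x hx.1)]) (d.Ie t ht) (d.Ip t ht)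
  have h2 : ∫ x in r..t, √(p x / x ^ 2) ≤ √b * √(CH * A) :=
    csI (x := fun _ => 1) ht (c2.mono (subIcc le_rfl)) continuousOn_const (cpx.mono (subIcc le_rfl)) (fun x hx => zero_le_one)
      (fun x hx => pnn x hx.1) (fun x hx => by
        rw [Real.sq_sqrt (pnn x hx.1), one_mul]) (by rw [intervalIntegral.integral_const, smul_eq_mul]; linarith) (d.Ip t ht)
  rw [Real.sqrt_mul (sq_nonneg _), Real.sqrt_sq hq] at h1
  rw [Real.sqrt_mul d.hCH.le] at h1 h2
  have i1 := iiI c1 le_rfl ht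
  have i2 := iiI c2 le_rfl ht
  have h3 : (∫ x in r..t, (2 / x) * |B x - wf r ℓ x * ((starRingEnd ℂ) c * D x).re|) ≤
      ∫ x in r..t, (2 * (√(e x) * √(p x / x ^ 2)) + 2 * (√(m r) * q) * √(p x / x ^ 2) + 2 / ℓ * (q * √(m r) ^ 2)) := by
    refine intervalIntegral.integral_mono_on ht (iiI (d.cG ℓ) le_rfl ht)
      (((i1.const_mul _).add (i2.const_mul _)).add intervalIntegrable_const) fun x hx => ?_
    have hx0 : 0 < x := d.hr.trans_le hx.1
    have hG := d.bG x hx.1 (wf r ℓ x) (wf_nn _ _ _) (wf_le hl hx.1)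
    have hw := wf_low hl d.hr hx.1
    have ep : √(p x / x ^ 2) = √(p x) / x := by
      rw [Real.sqrt_div (d.p_nn x hx.1), Real.sqrt_sq hx0.le]
    have hc1 := d.cS
    have hc2 := d.bc
    rw [ep, Real.sq_sqrt (d.m_nn r le_rfl)]
    calc _ ≤ (2 / x) * (√(e x) * √(p x) + ‖c‖ * q * √s * √(p x) + (1 - wf r ℓ x) * s * q * ‖c‖ ^ 2) := by gcongr
      _ = 2 * (√(e x) * (√(p x) / x)) + 2 * ((‖c‖ * √s) * q) * (√(p x) / x) + ((1 - wf r ℓ x) * (2 / x)) * (q * (‖c‖ ^ 2 * s)) := by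
          field_simp
      _ ≤ _ := by gcongr
  refine h3.trans ?_
  rw [intervalIntegral.integral_add ((i1.const_mul _).add (i2.const_mul _)) intervalIntegrable_const,
    intervalIntegral.integral_add (i1.const_mul _) (i2.const_mul _), intervalIntegral.integral_const_mul,
    intervalIntegral.integral_const_mul, intervalIntegral.integral_const, smul_eq_mul]
  have f2 : 2 * (√(m r) * q) * (∫ x in r..t, √(p x / x ^ 2)) ≤ 2 * (√(m r) * q) * (√b * (√CH * √A)) := by gcongr
  have f3 : (t - r) * (2 / ℓ * (q * √(m r) ^ 2)) ≤ b * (2 / ℓ * (q * √(m r) ^ 2)) := by gcongr; linarith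
  linarith

lemma D1.Bx (d : D1 k r q M A s CH m1 c m a e p v B g1 N n U uV D g2) {α t X Y : ℝ} (hα : r ≤ α) (ht : α ≤ t)
    (hX : ∫ x in α..t, e x ≤ X) (hY : ∫ x in α..t, m x ≤ Y) : (∫ x in α..t, |B x|) ≤ √X * √Y :=
  csI ht ((cont_of_deriv d.dB).abs.mono (subIcc hα)) (d.ce.mono (subIcc hα)) ((cont_of_deriv d.dm).mono (subIcc hα))
    (fun x hx => d.e_nn x (hα.trans hx.1)) (fun x hx => d.m_nn x (hα.trans hx.1))
    (fun x hx => by rw [sq_abs]; exact d.bB x (hα.trans hx.1)) hX hY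

lemma D1.Ie' (d : D1 k r q M A s CH m1 c m a e p v B g1 N n U uV D g2) {α t : ℝ} (hα : r ≤ α) (ht : α ≤ t) :
    ∫ x in α..t, e x ≤ q ^ 2 * M := by
  have e1 := intervalIntegral.integral_add_adjacent_intervals (iiI d.ce le_rfl hα) (iiI d.ce hα ht)
  have e2 : 0 ≤ ∫ x in r..α, e x := intervalIntegral.integral_nonneg hα fun x hx => d.e_nn x hx.1
  linarith [d.Ie t (hα.trans ht)]

lemma D1.Ia' (d : D1 k r q M A s CH m1 c m a e p v B g1 N n U uV D g2) {α t : ℝ} (hα : r ≤ α) (ht : α ≤ t) :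
    ∫ x in α..t, a x ≤ A := by
  have e1 := intervalIntegral.integral_add_adjacent_intervals (iiI d.ca le_rfl hα) (iiI d.ca hα ht)
  have e2 : 0 ≤ ∫ x in r..α, a x := intervalIntegral.integral_nonneg hα fun x hx => d.a_nn x hx.1
  linarith [d.Ia t (hα.trans ht)]

lemma D1.Im' (d : D1 k r q M A s CH m1 c m a e p v B g1 N n U uV D g2) {α t : ℝ} (hα : r ≤ α) (ht : α ≤ t) (h1 : t ≤ α + 1) :
    ∫ x in α..t, m x ≤ M := by
  have cm := cont_of_deriv d.dm
  have e1 := intervalIntegral.integral_add_adjacent_intervals (iiI cm hα ht) (iiI cm (hα.trans ht) h1)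
  have e2 : 0 ≤ ∫ x in t..(α+1), m x := intervalIntegral.integral_nonneg h1 fun x hx => d.m_nn x (hα.trans (ht.trans hx.1))
  linarith [d.Im α hα]

lemma D1.G2 (d : D1 k r q M A s CH m1 c m a e p v B g1 N n U uV D g2) {b ℓ : ℝ} (hl : 0 < ℓ) (hlb : ℓ ≤ b) (hb1 : b ≤ 1) :
    (∫ x in (r+b)..(r+1), (2 / x) * |B x - wf r ℓ x * ((starRingEnd ℂ) c * D x).re|) ≤ 2 / b * (q * √M ^ 2) := by
  have hb : 0 < b := hl.trans_le hlb
  have hα : r ≤ r + b := by linarith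
  have ht : r + b ≤ r + 1 := by linarith
  have cB := cont_of_deriv d.dB
  have h0 := d.Bx hα ht (d.Ie' hα ht) (d.Im' hα ht (by linarith))
  rw [Real.sqrt_mul (sq_nonneg _), Real.sqrt_sq d.hq] at h0
  calc _ ≤ ∫ x in (r+b)..(r+1), (2 / b) * |B x| := by
        refine intervalIntegral.integral_mono_on ht (iiI (d.cG ℓ) hα ht) ((iiI cB.abs hα ht).const_mul _) fun x hx => ?_
        rw [wf_zero hl (by linarith [hx.1]), zero_mul, sub_zero]
        have : b ≤ x := by linarith [hx.1, d.hr]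
        gcongr
    _ ≤ _ := by
        rw [intervalIntegral.integral_const_mul]
        gcongr
        linarith

lemma D1.G3 (d : D1 k r q M A s CH m1 c m a e p v B g1 N n U uV D g2) {t ℓ : ℝ} (hl : 0 < ℓ) (ht : r + 1 ≤ t) :
    (∫ x in (r+1)..t, (2 / x) * |B x - wf r ℓ x * ((starRingEnd ℂ) c * D x).re|) ≤
      4 * (q * √M ^ 2 * (√(r+1))⁻¹) + 2 * (√(m r) * (q * √M * (√(r+1))⁻¹)) := by
  have hα : r ≤ r + 1 := by linarith
  have hr := d.hr
  have hq := d.hq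
  have cB := cont_of_deriv d.dB
  have cD := cont_of_deriv d.dD
  have cm := cont_of_deriv d.dm
  have hx0 : ∀ x ∈ Set.Ici r, x ≠ 0 := fun x hx => (d.hr.trans_le hx).ne'
  have cmx : ContinuousOn (fun x => m x / x ^ 2) (Set.Ici r) :=
    cm.div (continuousOn_id.pow 2) fun x hx => pow_ne_zero 2 (hx0 x hx)
  have c1x : ContinuousOn (fun x => 1 / x ^ 2) (Set.Ici r) :=
    continuousOn_const.div (continuousOn_id.pow 2) fun x hx => pow_ne_zero 2 (hx0 x hx)
  have cBx : ContinuousOn (fun x => |B x| / x) (Set.Ici r) := cB.abs.div continuousOn_id hx0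
  have cDx : ContinuousOn (fun x => ‖D x‖ / x) (Set.Ici r) := cD.norm.div continuousOn_id hx0
  have h1 : ∫ x in (r+1)..t, |B x| / x ≤ √(q ^ 2 * M) * √(2 * M / (r+1)) := by
    refine csI ht (cBx.mono (subIcc hα)) (d.ce.mono (subIcc hα)) (cmx.mono (subIcc hα)) (fun x hx => d.e_nn x (hα.trans hx.1))
      (fun x hx => div_nonneg (d.m_nn x (hα.trans hx.1)) (sq_nonneg _)) (fun x hx => ?_) (d.Ie' hα ht)
      (tail_int hr cm d.m_nn d.Im d.hM ht)
    rw [div_pow, sq_abs, ← mul_div_assoc]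
    gcongr
    exact d.bB x (hα.trans hx.1)
  have hinv : ∫ x in (r+1)..t, 1 / x ^ 2 ≤ 1 / (r+1) := by
    have hd : ∀ x, r + 1 ≤ x → HasDerivAt (fun y : ℝ => - y⁻¹) (1 / x ^ 2) x := fun x hx => by
      have := (hasDerivAt_inv (show x ≠ 0 by linarith)).neg
      refine this.congr_deriv ?_
      rw [one_div, neg_neg]
    rw [ftcI ht hd (c1x.mono (subIcc hα))]
    have : 0 ≤ t⁻¹ := inv_nonneg.2 (by linarith)
    rw [one_div]; linarith
  have h2 : ∫ x in (r+1)..t, ‖D x‖ / x ≤ √(s * (q ^ 2 * M)) * √(1 / (r+1)) := by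
    refine csI (x := fun x => s * e x) ht (cDx.mono (subIcc hα)) ((continuousOn_const.mul d.ce).mono (subIcc hα)) (c1x.mono (subIcc hα))
      (fun x hx => mul_nonneg d.hs.le (d.e_nn x (hα.trans hx.1)))
      (fun x hx => by positivity) (fun x hx => ?_) ?_ hinv
    · rw [div_pow, mul_one_div]
      gcongr
      exact d.bD x (hα.trans hx.1)
    · rw [intervalIntegral.integral_const_mul]
      exact mul_le_mul_of_nonneg_left (d.Ie' hα ht) d.hs.le
  rw [Real.sqrt_mul (sq_nonneg _), Real.sqrt_sq hq, mul_div_assoc, Real.sqrt_mul (by norm_num),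
    Real.sqrt_div d.hM] at h1
  rw [Real.sqrt_mul d.hs.le, Real.sqrt_mul (sq_nonneg _), Real.sqrt_sq hq, Real.sqrt_div (by norm_num), Real.sqrt_one] at h2
  have i1 := iiI cBx hα ht
  have i2 := iiI cDx hα ht
  have h3 : (∫ x in (r+1)..t, (2 / x) * |B x - wf r ℓ x * ((starRingEnd ℂ) c * D x).re|) ≤
      ∫ x in (r+1)..t, (2 * (|B x| / x) + 2 * ‖c‖ * (‖D x‖ / x)) := by
    refine intervalIntegral.integral_mono_on ht (iiI (d.cG ℓ) hα ht)
      ((i1.const_mul _).add (i2.const_mul _)) fun x hx => ?_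
    have hx0 : 0 < x := d.hr.trans_le (hα.trans hx.1)
    have : |B x - wf r ℓ x * ((starRingEnd ℂ) c * D x).re| ≤ |B x| + ‖c‖ * ‖D x‖ := by
      refine (abs_sub _ _).trans ?_
      gcongr
      rw [abs_mul, abs_of_nonneg (wf_nn _ _ _)]
      calc _ ≤ 1 * (‖c‖ * ‖D x‖) := mul_le_mul (wf_le hl (hα.trans hx.1)) (re_bd _ _) (abs_nonneg _) zero_le_one
        _ = _ := one_mul _
    calc _ ≤ (2 / x) * (|B x| + ‖c‖ * ‖D x‖) := by gcongr
      _ = _ := by field_simp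
  refine h3.trans ?_
  rw [intervalIntegral.integral_add (i1.const_mul _) (i2.const_mul _), intervalIntegral.integral_const_mul,
    intervalIntegral.integral_const_mul]
  have h22 : √(2:ℝ) ≤ 2 := by rw [Real.sqrt_le_left (by norm_num)]; norm_num
  have f1 : q * √M * (√2 * (√M / √(r+1))) ≤ q * √M * (2 * (√M / √(r+1))) := by gcongr
  have f2 : 2 * ‖c‖ * (∫ x in (r+1)..t, ‖D x‖ / x) ≤ 2 * (√(m r) * (q * √M * (√(r+1))⁻¹)) := by
    calc _ ≤ 2 * ‖c‖ * (√s * (q * √M) * (1 / √(r+1))) := by gcongr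
      _ = 2 * ((‖c‖ * √s) * (q * √M * (√(r+1))⁻¹)) := by rw [one_div]; ring
      _ ≤ _ := by gcongr; exact d.cS
  have f3 : q * √M * (2 * (√M / √(r+1))) = 2 * (q * √M ^ 2 * (√(r+1))⁻¹) := by rw [div_eq_mul_inv]; ring
  linarith
end

end PartB3

section PartB4
open scoped ENNReal Topology Pointwise

section
variable {k : ℂ} {r q M A s CH m1 : ℝ} {c : ℂ} {m a e p v B g1 : ℝ → ℝ} {N n U uV D g2 : ℝ → ℂ}

lemma D1.phi (d : D1 k r q M A s CH m1 c m a e p v B g1 N n U uV D g2) {t : ℝ} (ht : r ≤ t) :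
    (∫ x in r..t, a x) + ‖k‖ ^ 2 / k.im * m t ≤ ‖k‖ / k.im * (‖N t‖ + ‖N r‖) + ‖k‖ ^ 2 / k.im * m r + |∫ x in r..t, v x| := by
  have hk := d.hk
  have hk2 : ‖k‖ ^ 2 = k.re ^ 2 + k.im ^ 2 := by rw [← Complex.normSq_eq_norm_sq, Complex.normSq_apply]; ring
  set Φ : ℝ → ℝ := fun x => (N x).re - k.re / k.im * (N x).im - ‖k‖ ^ 2 / k.im * m x with hΦ
  have hd : ∀ x, r ≤ x → HasDerivAt Φ (a x + v x) x := by
    intro x hx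
    have h1 : HasDerivAt (fun y => (N y).re) _ x := Complex.reCLM.hasFDerivAt.comp_hasDerivAt x (d.dN x hx)
    have h2 : HasDerivAt (fun y => (N y).im) _ x := Complex.imCLM.hasFDerivAt.comp_hasDerivAt x (d.dN x hx)
    have h := (h1.sub (h2.const_mul (k.re / k.im))).sub ((d.dm x hx).const_mul (‖k‖ ^ 2 / k.im))
    refine h.congr_deriv ?_
    simp only [Complex.reCLM_apply, Complex.imCLM_apply, Complex.sub_re, Complex.add_re, Complex.sub_im, Complex.add_im,
      Complex.ofReal_re, Complex.ofReal_im, Complex.mul_re, Complex.mul_im, Complex.I_re, Complex.I_im, Complex.re_ofNat,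
      Complex.im_ofNat]
    rw [hk2]
    field_simp
    ring
  have hI := ftcI ht hd ((d.ca.add d.cv).mono (subIcc le_rfl))
  rw [intervalIntegral.integral_add (iiI d.ca le_rfl ht) (iiI d.cv le_rfl ht)] at hI
  have hb : ∀ z : ℂ, |z.re - k.re / k.im * z.im| ≤ ‖k‖ / k.im * ‖z‖ := by
    intro z
    refine abs_le_of_sq_le_sq ?_ (by positivity)
    have hz2 : ‖z‖ ^ 2 = z.re ^ 2 + z.im ^ 2 := by rw [← Complex.normSq_eq_norm_sq, Complex.normSq_apply]; ring
    have this : z.re - k.re / k.im * z.im = (z.re * k.im - k.re * z.im) / k.im := by field_simp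
    have h2 : (‖k‖ / k.im * ‖z‖) ^ 2 = ((k.re ^ 2 + k.im ^ 2) * (z.re ^ 2 + z.im ^ 2)) / k.im ^ 2 := by
      rw [← hk2, ← hz2]; ring
    rw [this, h2, div_pow]
    refine div_le_div_of_nonneg_right ?_ (by positivity)
    nlinarith [sq_nonneg (z.re * k.re + k.im * z.im)]
  have b1 := (abs_le.1 (hb (N t))).2
  have b2 := (abs_le.1 (hb (N r))).1
  have b3 := neg_abs_le (∫ x in r..t, v x)
  simp only [hΦ] at hI
  rw [mul_add]
  linarith

lemma D1.Gall (d : D1 k r q M A s CH m1 c m a e p v B g1 N n U uV D g2) {K ℓ T : ℝ} (hK : 0 < K) (hl : ℓ = (q + K)⁻¹)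
    (hT : r + 1 ≤ T) :
    (∫ x in r..T, (2 / x) * |B x - wf r ℓ x * ((starRingEnd ℂ) c * D x).re|) ≤
      2 * (q * √M * (√CH * √A)) + 2 * (√(m r) * √q * (√CH * √A)) + 2 * (q + K) * √(m r) ^ 2 + 2 * q ^ 2 * √M ^ 2 +
      (4 * (q * √M ^ 2 * (√(r+1))⁻¹) + 2 * (√(m r) * (q * √M * (√(r+1))⁻¹))) := by
  have hq := d.hq
  have hqK : 0 < q + K := by linarith
  have hl0 : 0 < ℓ := by rw [hl]; positivity
  have h3 := d.G3 hl0 hT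
  have hr1 : r ≤ r + 1 := by linarith
  have e1 := intervalIntegral.integral_add_adjacent_intervals (iiI (d.cG ℓ) le_rfl hr1) (iiI (d.cG ℓ) hr1 hT)
  have hli : 2 / ℓ = 2 * (q + K) := by rw [hl, div_inv_eq_mul]
  have hqs := Real.sq_sqrt hq
  have hμ : 0 ≤ √(m r) := Real.sqrt_nonneg _
  suffices h : (∫ x in r..(r+1), (2 / x) * |B x - wf r ℓ x * ((starRingEnd ℂ) c * D x).re|) ≤
      2 * (q * √M * (√CH * √A)) + 2 * (√(m r) * √q * (√CH * √A)) + 2 * (q + K) * √(m r) ^ 2 + 2 * q ^ 2 * √M ^ 2 by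
    linarith
  rcases le_total q 1 with h1 | h1
  · have h2 := d.G1 (b := 1) hl0 hr1 le_rfl
    rw [hli, Real.sqrt_one] at h2
    have f1 : q ≤ √q := by
      refine Real.le_sqrt_of_sq_le ?_; nlinarith
    have f2 : 2 * (√(m r) * q * 1 * (√CH * √A)) ≤ 2 * (√(m r) * √q * (√CH * √A)) := by rw [mul_one]; gcongr
    have f3 : 2 * (q + K) * 1 * (q * √(m r) ^ 2) ≤ 2 * (q + K) * 1 * (1 * √(m r) ^ 2) := by gcongr
    have f4 : 0 ≤ 2 * q ^ 2 * √M ^ 2 := by positivity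
    linarith
  · have hq0 : 0 < q := by linarith
    have hb1 : q⁻¹ ≤ 1 := inv_le_one_of_one_le₀ h1
    have hb0 : 0 < q⁻¹ := inv_pos.2 hq0
    have hlb : ℓ ≤ q⁻¹ := by rw [hl]; gcongr; linarith
    have h2 := d.G1 (b := q⁻¹) (t := r + q⁻¹) hl0 (by linarith) le_rfl
    have h4 := d.G2 hl0 hlb hb1
    have e2 := intervalIntegral.integral_add_adjacent_intervals (iiI (d.cG ℓ) le_rfl (show r ≤ r + q⁻¹ by linarith))
      (iiI (d.cG ℓ) (show r ≤ r + q⁻¹ by linarith) (show r + q⁻¹ ≤ r + 1 by linarith))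
    rw [hli] at h2
    have f1 : q * √q⁻¹ = √q := by
      rw [Real.sqrt_inv]
      have : 0 < √q := Real.sqrt_pos.2 hq0
      field_simp; linarith
    have f2 : 2 * (√(m r) * q * √q⁻¹ * (√CH * √A)) = 2 * (√(m r) * √q * (√CH * √A)) := by
      rw [mul_assoc (√(m r)), f1]
    have f3 : 2 * (q + K) * q⁻¹ * (q * √(m r) ^ 2) = 2 * (q + K) * √(m r) ^ 2 := by field_simp
    have f4 : 2 / q⁻¹ * (q * √M ^ 2) = 2 * q ^ 2 * √M ^ 2 := by field_simp
    linarith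

lemma norm_wn_le (d : D1 k r q M A s CH m1 c m a e p v B g1 N n U uV D g2) {ℓ t : ℝ} (hl : 0 < ℓ) (ht : r ≤ t) :
    ‖∫ x in r..t, (wf r ℓ x : ℂ) * n x‖ ≤ ∫ x in r..t, ‖n x‖ := by
  have cn := cont_of_deriv d.dn
  refine (intervalIntegral.norm_integral_le_integral_norm ht).trans ?_
  refine intervalIntegral.integral_mono_on ht (iiI (((Complex.continuous_ofReal.comp (wf_cont r ℓ)).continuousOn.mul cn).norm) le_rfl ht)
    (iiI cn.norm le_rfl ht) fun x hx => ?_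
  rw [norm_mul, Complex.norm_real, Real.norm_eq_abs, abs_of_nonneg (wf_nn _ _ _)]
  exact mul_le_of_le_one_left (norm_nonneg _) (wf_le hl hx.1)

noncomputable def X1 (K κ q M g μ ν : ℝ) : ℝ := M * q ^ 2 + M * q * g + μ ^ 2 * q + K ^ 2 / κ * (μ ^ 2 + μ * ν / K)

lemma alg1 {q K h μ Y Z g P1 P2 w A L NB : ℝ} (hq : 0 ≤ q) (hh0 : 0 ≤ h) (hμ0 : 0 ≤ μ) (hY0 : 0 ≤ Y) (hZ0 : 0 ≤ Z) (hg0 : 0 ≤ g)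
    (hP1 : 0 ≤ P1) (hP2 : 0 ≤ P2) (T8 : K * μ ^ 2 ≤ P2) (hw2 : w ^ 2 = q + K) (hAZ : A = Z ^ 2)
    (hL : L ≤ NB + 2 * P1 + P2 + 6 * (q * μ ^ 2) + 2 * (K * μ ^ 2) + 2 * (q ^ 2 * Y ^ 2) + 5 * (q * (Y ^ 2 * g))
      + (2 * h + 2) * (q * (Y * Z)) + (2 * h + 6) * (μ * (w * Z))) :
    L ≤ NB + A / 2 + ((2 * h + 2) ^ 2 + (2 * h + 6) ^ 2 + 17) * (Y ^ 2 * q ^ 2 + Y ^ 2 * q * g + μ ^ 2 * q + (P2 + P1)) := by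
  have T11 : (2 * h + 2) * (q * (Y * Z)) ≤ Z ^ 2 / 4 + (2 * h + 2) ^ 2 * (q ^ 2 * Y ^ 2) := by
    nlinarith [sq_nonneg (Z / 2 - (2 * h + 2) * (q * Y))]
  have T12 : (2 * h + 6) * (μ * (w * Z)) ≤ Z ^ 2 / 4 + (2 * h + 6) ^ 2 * (q * μ ^ 2 + K * μ ^ 2) := by
    have : q * μ ^ 2 + K * μ ^ 2 = w ^ 2 * μ ^ 2 := by rw [hw2]; ring
    rw [this]
    nlinarith [sq_nonneg (Z / 2 - (2 * h + 6) * (w * μ))]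
  have ha1 : 0 ≤ q ^ 2 * Y ^ 2 := by positivity
  have ha2 : 0 ≤ q * (Y ^ 2 * g) := by positivity
  have ha3 : 0 ≤ q * μ ^ 2 := by positivity
  have eX : Y ^ 2 * q ^ 2 + Y ^ 2 * q * g + μ ^ 2 * q + (P2 + P1) = q ^ 2 * Y ^ 2 + q * (Y ^ 2 * g) + q * μ ^ 2 + (P2 + P1) := by ring
  rw [eX, hAZ]
  have e1 := mul_nonneg (sq_nonneg (2 * h + 2)) (show 0 ≤ q * (Y ^ 2 * g) + q * μ ^ 2 + (P2 + P1) by linarith)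
  have e2 := mul_nonneg (sq_nonneg (2 * h + 6)) (show 0 ≤ q ^ 2 * Y ^ 2 + q * (Y ^ 2 * g) + (P2 - K * μ ^ 2) + P1 by linarith)
  linarith

set_option maxHeartbeats 1600000 in
lemma D1.part1_T (d : D1 k r q M A s CH m1 c m a e p v B g1 N n U uV D g2) {T : ℝ} (hT : r + 1 ≤ T)
    (hT2 : r + (q + ‖k‖)⁻¹ ≤ T) :
    (∫ x in r..T, a x) ≤ (‖k‖ / k.im * ‖N T‖ + |B T|) + A / 2 +
      ((2 * √CH + 2) ^ 2 + (2 * √CH + 6) ^ 2 + 17) * X1 ‖k‖ k.im q M (√(r+1))⁻¹ √(m r) √m1 := by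
  have hq := d.hq
  have hk := d.hk
  have hκK : k.im ≤ ‖k‖ := (le_abs_self _).trans (Complex.abs_im_le_norm k)
  have hK : 0 < ‖k‖ := hk.trans_le hκK
  set K := ‖k‖ with hKdef
  set κ := k.im with hκdef
  have hqK : 0 < q + K := by linarith
  set ℓ := (q + K)⁻¹ with hl
  have hl0 : 0 < ℓ := by positivity
  have hrT : r ≤ T := by linarith
  have hphi := d.phi hrT
  have hkey := key_bound d hl0 hrT
  rw [min_eq_right hT2, wf_zero hl0 hT2, zero_mul] at hkey
  have hrl : r ≤ r + ℓ := by linarith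
  have hG := d.Gall hK hl hT
  have h1 := d.Nr
  have h2 := d.nr
  have h3 := d.Dx le_rfl
  have h4 := d.Br
  have h5 := d.In (b := ℓ) hrl le_rfl
  have h6 := d.Ig2 (b := ℓ) hrl le_rfl
  have h7 := d.Ig1 hrT
  have h8 := d.ID (b := ℓ) hrl le_rfl
  have h9 := mul_le_mul_of_nonneg_left (norm_wn_le d hl0 hrl) (norm_nonneg c)
  have hmT := d.m_nn T hrT
  have hmr := Real.sq_sqrt (d.m_nn r le_rfl)
  have hMs := Real.sq_sqrt d.hM
  have hAs := Real.sq_sqrt d.hA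
  have hf0 : 0 < √ℓ := Real.sqrt_pos.2 hl0
  have hw0 : 0 < √(q + K) := Real.sqrt_pos.2 hqK
  have hw2 := Real.sq_sqrt hqK.le
  have hfw : √ℓ = (√(q+K))⁻¹ := by rw [hl, Real.sqrt_inv]
  have hg0 : 0 ≤ (√(r+1))⁻¹ := by positivity
  have hg1 : (√(r+1))⁻¹ ≤ 1 := inv_le_one_of_one_le₀ (by rw [Real.one_le_sqrt]; linarith [d.hr])
  have hsq : √q ≤ √(q+K) := Real.sqrt_le_sqrt (by linarith)
  have hh0 := Real.sqrt_nonneg CH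
  have hν0 := Real.sqrt_nonneg m1
  have hμ0 := Real.sqrt_nonneg (m r)
  have hY0 := Real.sqrt_nonneg M
  have hZ0 := Real.sqrt_nonneg A
  rw [← hmr] at hphi
  have hil : ℓ⁻¹ = √(q+K) ^ 2 := by rw [hl, inv_inv, hw2]
  rw [hil, mul_add] at hkey
  unfold X1
  rw [← hMs]
  set w := √(q+K)
  set f := √ℓ
  set μ := √(m r)
  set ν := √m1
  set Y := √M
  set Z := √A
  set h := √CH
  set g := (√(r+1))⁻¹
  have hfw1 : f * w = 1 := by rw [hfw]; field_simp
  have hl2 : ℓ = f ^ 2 := (Real.sq_sqrt hl0.le).symm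
  have hqf : q * f ≤ w := by
    calc q * f ≤ w ^ 2 * f := by gcongr; rw [hw2]; linarith
      _ = w * (f * w) := by ring
      _ = w := by rw [hfw1, mul_one]
  have hKf : K * f ≤ w := by
    calc K * f ≤ w ^ 2 * f := by gcongr; rw [hw2]; linarith
      _ = w * (f * w) := by ring
      _ = w := by rw [hfw1, mul_one]
  -- individual terms
  have T1 : w ^ 2 * (‖c‖ * (∫ x in r..(r+ℓ), ‖D x‖) + ‖c‖ * ∫ x in r..(r+ℓ), ‖n x‖) ≤
      q * μ ^ 2 + 2 * (μ * (w * Z)) + μ * (w * Z) := by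
    calc _ ≤ w ^ 2 * (ℓ * (μ * (q * (μ + 2 * (f * Z)))) + μ * (f * Z)) := by gcongr
      _ = (f * w) ^ 2 * (q * μ ^ 2) + 2 * (f * w) ^ 2 * (μ * ((q * f) * Z)) + (f * w) * (μ * (w * Z)) := by rw [hl2]; ring
      _ = q * μ ^ 2 + 2 * (μ * ((q * f) * Z)) + μ * (w * Z) := by rw [hfw1]; ring
      _ ≤ _ := by gcongr
  have T2 : μ * (q * (f * Z)) ≤ μ * (w * Z) := by rw [← mul_assoc q]; gcongr
  have T3 : 2 * K * ‖c‖ * ‖∫ x in r..(r+ℓ), (wf r ℓ x : ℂ) * n x‖ ≤ 2 * (μ * (w * Z)) := by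
    calc _ = 2 * (K * (‖c‖ * ‖∫ x in r..(r+ℓ), (wf r ℓ x : ℂ) * n x‖)) := by ring
      _ ≤ 2 * (K * (μ * (f * Z))) := mul_le_mul_of_nonneg_left (mul_le_mul_of_nonneg_left (h9.trans h5) hK.le) (by norm_num)
      _ = 2 * (μ * ((K * f) * Z)) := by ring
      _ ≤ _ := by gcongr
  have T4 : 2 * (μ * √q * (h * Z)) ≤ 2 * h * (μ * (w * Z)) := by
    calc _ = 2 * h * (μ * (√q * Z)) := by ring
      _ ≤ _ := by gcongr
  have T5 : 2 * (μ * (q * Y * g)) ≤ q * μ ^ 2 + q * (Y ^ 2 * g) := by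
    have : 2 * (μ * (q * Y * g)) ≤ q * μ ^ 2 + q * (Y * g) ^ 2 := by nlinarith [mul_nonneg hq (sq_nonneg (μ - Y * g))]
    have h2 : q * (Y * g) ^ 2 ≤ q * (Y ^ 2 * g) := by
      have : (Y * g) ^ 2 ≤ Y ^ 2 * g := by
        have hgg : g ^ 2 ≤ g := by rw [sq]; exact mul_le_of_le_one_left hg0 hg1
        rw [mul_pow]; exact mul_le_mul_of_nonneg_left hgg (sq_nonneg _)
      exact mul_le_mul_of_nonneg_left this hq
    linarith
  have T6 : K / κ * (‖N T‖ + ‖N r‖) ≤ K / κ * ‖N T‖ + K / κ * (μ * ν) := by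
    rw [mul_add]; gcongr
  have hKκ : 1 ≤ K / κ := (one_le_div hk).2 hκK
  have T7 : μ * ν ≤ K / κ * (μ * ν) := le_mul_of_one_le_left (by positivity) hKκ
  have T8 : K * μ ^ 2 ≤ K ^ 2 / κ * μ ^ 2 := by
    have : K ≤ K ^ 2 / κ := by
      rw [le_div_iff₀ hk]; nlinarith
    gcongr
  have T9 : K ^ 2 / κ * (μ ^ 2 + μ * ν / K) = K ^ 2 / κ * μ ^ 2 + K / κ * (μ * ν) := by field_simp
  have T10 : 0 ≤ K ^ 2 / κ * m T := by positivity
  rw [T9]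
  rw [mul_add ‖c‖] at hkey
  have e3 : μ * (q * μ) = q * μ ^ 2 := by ring
  rw [e3] at h3
  refine alg1 hq hh0 hμ0 hY0 hZ0 hg0 (by positivity) (by positivity) T8 hw2 hAs.symm ?_
  clear_value w f μ ν Y Z h g
  linarith

lemma D1.part1 (d : D1 k r q M A s CH m1 c m a e p v B g1 N n U uV D g2) :
    A ≤ 2 * ((2 * √CH + 2) ^ 2 + (2 * √CH + 6) ^ 2 + 17) * X1 ‖k‖ k.im q M (√(r+1))⁻¹ √(m r) √m1 := by
  suffices h : A ≤ A / 2 + ((2 * √CH + 2) ^ 2 + (2 * √CH + 6) ^ 2 + 17) * X1 ‖k‖ k.im q M (√(r+1))⁻¹ √(m r) √m1 by linarith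
  refine le_of_forall_pos_le_add fun ε hε => d.supA _ ?_
  have h0 : Tendsto (fun T => ‖k‖ / k.im * ‖N T‖ + |B T|) atTop (𝓝 (‖k‖ / k.im * ‖(0:ℂ)‖ + |(0:ℝ)|)) :=
    (d.lN.norm.const_mul _).add d.lB.abs
  simp only [norm_zero, mul_zero, abs_zero, add_zero] at h0
  filter_upwards [h0.eventually_lt_const hε, eventually_ge_atTop (r+1), eventually_ge_atTop (r + (q + ‖k‖)⁻¹)] with T h1 h2 h3
  have := d.part1_T h2 h3
  linarith
end

end PartB4

section PartB5
open scoped ENNReal Topology Pointwise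

section
variable {k : ℂ} {r q M A s CH m1 : ℝ} {c : ℂ} {m a e p v B g1 : ℝ → ℝ} {N n U uV D g2 : ℝ → ℂ}

lemma D1.cU (d : D1 k r q M A s CH m1 c m a e p v B g1 N n U uV D g2) {x : ℝ} (hx : r ≤ x) :
    ‖c‖ * ‖U x‖ ≤ √(m r) * √(m x) := by
  have h : ‖U x‖ ≤ √s * √(m x) := by
    rw [← Real.sqrt_mul d.hs.le]; exact Real.le_sqrt_of_sq_le (d.bU x hx)
  calc _ ≤ ‖c‖ * (√s * √(m x)) := by gcongr
    _ = (‖c‖ * √s) * √(m x) := by ring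
    _ ≤ _ := by gcongr; exact d.cS

lemma D1.IU (d : D1 k r q M A s CH m1 c m a e p v B g1 N n U uV D g2) {t : ℝ} (ht : r ≤ t) (h1 : t ≤ r + 1) :
    ‖c‖ * (∫ x in r..t, ‖U x‖) ≤ √(m r) * √M := by
  have cU := cont_of_deriv d.dU
  have h := csI (f := fun x => ‖U x‖) (x := fun _ => s) (y := m) (X := s * 1) ht (cU.norm.mono (subIcc le_rfl))
    continuousOn_const ((cont_of_deriv d.dm).mono (subIcc le_rfl)) (fun _ _ => d.hs.le) (fun x hx => d.m_nn x hx.1) (fun x hx => d.bU x hx.1)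
    (by rw [intervalIntegral.integral_const, smul_eq_mul, mul_comm]; have := d.hs; gcongr; linarith) (d.Im' le_rfl ht h1)
  rw [mul_one] at h
  calc _ ≤ ‖c‖ * (√s * √M) := by gcongr
    _ = (‖c‖ * √s) * √M := by ring
    _ ≤ _ := by gcongr; exact d.cS

lemma D1.wn0 (d : D1 k r q M A s CH m1 c m a e p v B g1 N n U uV D g2) {t : ℝ} (ht : r ≤ t) (h1 : t ≤ r + 1) :
    ‖∫ x in r..t, (wf r 1 x : ℂ) * n x‖ ≤ wf r 1 t * ‖U t‖ + ‖U r‖ + ∫ x in r..t, ‖U x‖ := by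
  have cU := cont_of_deriv d.dU
  have cn := cont_of_deriv d.dn
  have hd : ∀ x, r ≤ x → HasDerivAt (fun x => ((1 - (x - r) : ℝ) : ℂ) * U x) (-U x + ((1 - (x - r) : ℝ) : ℂ) * n x) x := by
    intro x hx
    have h1 : HasDerivAt (fun x : ℝ => (1 - (x - r) : ℝ)) (-1) x := by
      simpa using ((hasDerivAt_id x).sub_const r).const_sub 1
    refine (h1.ofReal_comp.mul (d.dU x hx)).congr_deriv ?_
    push_cast; ring
  have cw : ContinuousOn (fun x : ℝ => ((1 - (x - r) : ℝ) : ℂ)) (Set.Ici r) := by fun_prop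
  have hI := ftcI ht hd ((cU.neg.add (cw.mul cn)).mono (subIcc le_rfl))
  have i1 : IntervalIntegrable (fun x => -U x) volume r t := iiI cU.neg le_rfl ht
  have i2 : IntervalIntegrable (fun x => ((1 - (x - r) : ℝ) : ℂ) * n x) volume r t := iiI (cw.mul cn) le_rfl ht
  rw [intervalIntegral.integral_add i1 i2, intervalIntegral.integral_neg] at hI
  have e1 : ∫ x in r..t, (wf r 1 x : ℂ) * n x = ∫ x in r..t, ((1 - (x - r) : ℝ) : ℂ) * n x := by
    refine intervalIntegral.integral_congr fun x hx => ?_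
    rw [Set.uIcc_of_le ht] at hx
    rw [wf_lin one_pos (hx.2.trans h1), div_one]
  rw [e1, wf_lin one_pos h1, div_one]
  have e2 : ∫ x in r..t, ((1 - (x - r) : ℝ) : ℂ) * n x = ((1 - (t - r) : ℝ) : ℂ) * U t - U r + ∫ x in r..t, U x := by
    rw [sub_self, sub_zero, Complex.ofReal_one, one_mul] at hI
    linear_combination hI
  rw [e2]
  refine (norm_add_le _ _).trans (add_le_add ((norm_sub_le _ _).trans ?_) (intervalIntegral.norm_integral_le_integral_norm ht))
  rw [norm_mul, Complex.norm_real, Real.norm_eq_abs, abs_of_nonneg (by linarith)]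

lemma D1.wn (d : D1 k r q M A s CH m1 c m a e p v B g1 N n U uV D g2) {t : ℝ} (ht : r ≤ t) :
    ‖c‖ * ‖∫ x in r..(min t (r+1)), (wf r 1 x : ℂ) * n x‖ ≤ √(m r) * √(m t) + √(m r) ^ 2 + √(m r) * √M := by
  have hr1 : r ≤ min t (r+1) := le_min ht (by linarith)
  have h := mul_le_mul_of_nonneg_left (d.wn0 hr1 (min_le_right _ _)) (norm_nonneg c)
  have h2 := d.IU hr1 (min_le_right _ _)
  have h3 := d.cU le_rfl
  have h4 : ‖c‖ * (wf r 1 (min t (r+1)) * ‖U (min t (r+1))‖) ≤ √(m r) * √(m t) := by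
    rcases le_total t (r+1) with h5 | h5
    · rw [min_eq_left h5]
      refine le_trans ?_ (d.cU ht)
      gcongr
      exact mul_le_of_le_one_left (norm_nonneg _) (wf_le one_pos ht)
    · rw [min_eq_right h5, wf_zero one_pos le_rfl]
      simp only [zero_mul, mul_zero]; positivity
  rw [sq]
  linarith

/-- the right-hand side of part (ii) in one-dimensional form -/
noncomputable def X2 (K κ q g μ ν Y Z : ℝ) : ℝ :=
  κ / K ^ 2 * (Z * Y * q + μ ^ 2 * q + Y ^ 2 * q * g) + μ ^ 2 + μ * ν / K + Y * Z / K

lemma D1.Gone (d : D1 k r q M A s CH m1 c m a e p v B g1 N n U uV D g2) {t : ℝ} (ht : r ≤ t) :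
    (∫ x in r..t, (2 / x) * |B x - wf r 1 x * ((starRingEnd ℂ) c * D x).re|) ≤
      2 * (q * √M * (√CH * √A)) + 2 * (√(m r) * q * (√CH * √A)) + 2 * (q * √(m r) ^ 2) +
      (4 * (q * √M ^ 2 * (√(r+1))⁻¹) + 2 * (√(m r) * (q * √M * (√(r+1))⁻¹))) := by
  have hq := d.hq
  have hr1 : r ≤ r + 1 := by linarith
  rcases le_total t (r+1) with h5 | h5
  · have h2 := d.G1 (b := 1) one_pos ht h5
    rw [Real.sqrt_one, mul_one, div_one, mul_one] at h2
    have : 0 ≤ 4 * (q * √M ^ 2 * (√(r+1))⁻¹) + 2 * (√(m r) * (q * √M * (√(r+1))⁻¹)) := by positivity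
    linarith
  · have h2 := d.G1 (b := 1) one_pos hr1 le_rfl
    rw [Real.sqrt_one, mul_one, div_one, mul_one] at h2
    have h3 := d.G3 one_pos h5
    have e1 := intervalIntegral.integral_add_adjacent_intervals (iiI (d.cG 1) le_rfl hr1) (iiI (d.cG 1) hr1 h5)
    linarith

lemma alg2 {K κ J q h μ ν Y Z g mt Nt Nr Bt nt Iv Q1 W S : ℝ} (hK : 0 < K) (hJ : J = κ / K ^ 2) (hκ : 0 < κ) (hκK : κ ≤ K)
    (hq : 0 ≤ q) (hh0 : 0 ≤ h) (hμ0 : 0 ≤ μ) (hν0 : 0 ≤ ν) (hμY : μ ≤ Y) (hZ0 : 0 ≤ Z) (hg0 : 0 ≤ g) (hW0 : 0 ≤ W) (hS : S ^ 2 = mt)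
    (hphi : K ^ 2 / κ * mt ≤ K / κ * (Nt + Nr) + K ^ 2 / κ * μ ^ 2 + Iv)
    (hNr : Nr ≤ μ * ν) (hIv : Iv ≤ Bt + nt + Q1 + 2 * K * W)
    (hQ : Q1 ≤ 6 * (q * μ ^ 2) + (4 * h + 7) * (q * (Y * Z)) + 6 * (q * (Y ^ 2 * g)) + μ * ν + μ * Z)
    (hW : W ≤ μ * S + μ ^ 2 + μ * Y) :
    mt ≤ 2 * (Nt / K + J * Bt + J * nt) + 2 * (4 * h + 21) * X2 K κ q g μ ν Y Z + Y ^ 2 / 8 := by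
  have hJ0 : 0 < J := by rw [hJ]; positivity
  have hJK : J * K ≤ 1 := by
    rw [hJ, show κ / K ^ 2 * K = κ / K by field_simp]; exact (div_le_one hK).2 hκK
  have hY0 : 0 ≤ Y := hμ0.trans hμY
  have h1 := mul_le_mul_of_nonneg_left hphi hJ0.le
  have e1 : J * (K ^ 2 / κ * mt) = mt := by rw [hJ]; field_simp
  have e2 : J * (K / κ * (Nt + Nr) + K ^ 2 / κ * μ ^ 2 + Iv) = Nt / K + Nr / K + μ ^ 2 + J * Iv := by rw [hJ]; field_simp
  rw [e1, e2] at h1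
  have h2 := mul_le_mul_of_nonneg_left hIv hJ0.le
  have h3 := mul_le_mul_of_nonneg_left hQ hJ0.le
  have h4 : J * (2 * K * W) ≤ 2 * (μ * S + μ ^ 2 + μ * Y) := by
    calc J * (2 * K * W) = (J * K) * (2 * W) := by ring
      _ ≤ 1 * (2 * W) := by gcongr
      _ ≤ _ := by linarith
  have h5 : Nr / K ≤ μ * ν / K := by gcongr
  have hJ1 : J ≤ 1 / K := by rw [le_div_iff₀ hK]; exact hJK
  have h6 : J * (μ * ν) ≤ μ * ν / K := by
    calc J * (μ * ν) ≤ 1 / K * (μ * ν) := by gcongr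
      _ = _ := by ring
  have h7 : J * (μ * Z) ≤ Y * Z / K := by
    calc J * (μ * Z) ≤ 1 / K * (Y * Z) := by gcongr
      _ = _ := by ring
  have h8 : 2 * (μ * S) ≤ mt / 2 + 2 * μ ^ 2 := by nlinarith [sq_nonneg (S - 2 * μ)]
  have h9 : 2 * (μ * Y) ≤ Y ^ 2 / 16 + 16 * μ ^ 2 := by nlinarith [sq_nonneg (Y - 16 * μ)]
  unfold X2
  rw [← hJ]
  set a1 := J * (q * μ ^ 2) with ha1
  set a2 := J * (q * (Y * Z)) with ha2
  set a3 := J * (q * (Y ^ 2 * g)) with ha3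
  have p1 : 0 ≤ a1 := by positivity
  have p2 : 0 ≤ a2 := by positivity
  have p3 : 0 ≤ a3 := by positivity
  have p4 : 0 ≤ μ * ν / K := by positivity
  have p5 : 0 ≤ Y * Z / K := by positivity
  have p6 : 0 ≤ μ ^ 2 := by positivity
  have eX : J * (Z * Y * q + μ ^ 2 * q + Y ^ 2 * q * g) = a2 + a1 + a3 := by simp only [ha1, ha2, ha3]; ring
  rw [eX]
  have e3 : J * (6 * (q * μ ^ 2) + (4 * h + 7) * (q * (Y * Z)) + 6 * (q * (Y ^ 2 * g)) + μ * ν + μ * Z) =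
    6 * a1 + (4 * h + 7) * a2 + 6 * a3 + J * (μ * ν) + J * (μ * Z) := by simp only [ha1, ha2, ha3]; ring
  rw [e3] at h3
  have e4 : J * (Bt + nt + Q1 + 2 * K * W) = J * Bt + J * nt + J * Q1 + J * (2 * K * W) := by ring
  rw [e4] at h2
  have f1 := mul_nonneg hh0 (show 0 ≤ a1 + a3 + μ ^ 2 + μ * ν / K + Y * Z / K by linarith)
  clear_value a1 a2 a3
  linarith

set_option maxHeartbeats 1600000 in
lemma D1.mpt (d : D1 k r q M A s CH m1 c m a e p v B g1 N n U uV D g2) (hμY : √(m r) ≤ √M) {t : ℝ} (ht : r ≤ t) :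
    m t ≤ 2 * (‖N t‖ / ‖k‖ + k.im / ‖k‖ ^ 2 * |B t| + k.im / ‖k‖ ^ 2 * (‖c‖ * ‖n t‖)) +
      2 * (4 * √CH + 21) * X2 ‖k‖ k.im q (√(r+1))⁻¹ √(m r) √m1 √M √A + √M ^ 2 / 8 := by
  have hq := d.hq
  have hk := d.hk
  have hκK : k.im ≤ ‖k‖ := (le_abs_self _).trans (Complex.abs_im_le_norm k)
  have hK : 0 < ‖k‖ := hk.trans_le hκK
  have hphi := d.phi ht
  have hkey := key_bound d one_pos ht
  have hr1 : r ≤ min t (r+1) := le_min ht (by linarith)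
  have hG := d.Gone ht
  have h1 := d.Nr
  have h2 := d.nr
  have h3 := d.Dx le_rfl
  have h4 := d.Br
  have h5 := d.In (b := 1) hr1 (min_le_right _ _)
  have h6 := d.Ig2 (b := 1) hr1 (min_le_right _ _)
  have h7 := d.Ig1 ht
  have h8 := d.ID (b := 1) hr1 (min_le_right _ _)
  have hw := d.wn ht
  have hmr := Real.sq_sqrt (d.m_nn r le_rfl)
  have hg0 : 0 ≤ (√(r+1))⁻¹ := by positivity
  have ha0 : 0 ≤ ∫ x in r..t, a x := intervalIntegral.integral_nonneg ht fun x hx => d.a_nn x hx.1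
  have hDt : wf r 1 t * (‖c‖ * ‖D t‖) ≤ √(m r) * (q * (√(m r) + 2 * √A)) := by
    rcases le_total t (r+1) with h9 | h9
    · have := d.mgrow (b := 1) ht h9
      rw [Real.sqrt_one, one_mul] at this
      refine (mul_le_of_le_one_left (by positivity) (wf_le one_pos ht)).trans ((d.Dx ht).trans ?_)
      gcongr
    · rw [wf_zero one_pos h9, zero_mul]; positivity
  have hnt : wf r 1 t * (‖c‖ * ‖n t‖) ≤ ‖c‖ * ‖n t‖ := mul_le_of_le_one_left (by positivity) (wf_le one_pos ht)
  rw [Real.sqrt_one, one_mul] at h5 h6 h8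
  rw [one_mul] at h8
  rw [inv_one, one_mul] at hkey
  rw [← hmr] at hphi
  have hh0 := Real.sqrt_nonneg CH
  have hμ0 := Real.sqrt_nonneg (m r)
  have hZ0 := Real.sqrt_nonneg A
  have hY0 := Real.sqrt_nonneg M
  have hqZ : √(m r) * (q * √A) ≤ q * (√M * √A) := by
    calc √(m r) * (q * √A) ≤ √M * (q * √A) := by gcongr
      _ = _ := by ring
  have hhqZ : √CH * (√(m r) * (q * √A)) ≤ √CH * (q * (√M * √A)) := by gcongr
  have hqY : √(m r) * (q * √M * (√(r+1))⁻¹) ≤ q * (√M ^ 2 * (√(r+1))⁻¹) := by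
    calc √(m r) * (q * √M * (√(r+1))⁻¹) ≤ √M * (q * √M * (√(r+1))⁻¹) := by gcongr
      _ = _ := by ring
  refine alg2 (Nr := ‖N r‖) (Iv := |∫ x in r..t, v x|)
    (Q1 := |B r| + wf r 1 t * (‖c‖ * ‖D t‖) + (‖c‖ * ‖D r‖ + ‖c‖ * ‖n r‖) +
      (∫ x in r..t, (2 / x) * |B x - wf r 1 x * ((starRingEnd ℂ) c * D x).re|) +
      ((∫ x in r..t, |g1 x|) + ‖c‖ * (∫ x in r..(min t (r+1)), ‖g2 x‖) +
      (‖c‖ * (∫ x in r..(min t (r+1)), ‖D x‖) + ‖c‖ * ∫ x in r..(min t (r+1)), ‖n x‖)))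
    (W := ‖c‖ * ‖∫ x in r..(min t (r+1)), (wf r 1 x : ℂ) * n x‖) hK rfl hk hκK hq hh0 hμ0 (Real.sqrt_nonneg m1) hμY hZ0 hg0 (by positivity)
    (Real.sq_sqrt (d.m_nn t ht)) ?_ h1 ?_ ?_ hw
  · linarith
  · linarith
  · linarith


lemma D1.osc (d : D1 k r q M A s CH m1 c m a e p v B g1 N n U uV D g2) {α β x y : ℝ} (hα : r ≤ α) (hx : x ∈ Set.Icc α β)
    (hy : y ∈ Set.Icc α β) : m x ≤ m y + 2 * ∫ z in α..β, ‖N z‖ := by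
  have cN := cont_of_deriv d.dN
  have cR : ContinuousOn (fun x => 2 * (N x).re) (Set.Ici r) := continuousOn_const.mul (Complex.continuous_re.comp_continuousOn cN)
  have key : ∀ x y, x ∈ Set.Icc α β → y ∈ Set.Icc α β → x ≤ y → |m y - m x| ≤ 2 * ∫ z in α..β, ‖N z‖ := by
    intro x y hx hy hxy
    have hrx := hα.trans hx.1
    rw [← ftcI hxy (fun z hz => d.dm z (hrx.trans hz)) (cR.mono (subIcc hrx)), ← Real.norm_eq_abs]
    refine (intervalIntegral.norm_integral_le_integral_norm hxy).trans ?_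
    have h1 : ∫ z in x..y, ‖2 * (N z).re‖ ≤ ∫ z in x..y, 2 * ‖N z‖ := by
      refine intervalIntegral.integral_mono_on hxy (iiI cR.norm hrx hxy) ((iiI cN.norm hrx hxy).const_mul 2) fun z hz => ?_
      rw [norm_mul, Real.norm_eq_abs, Real.norm_eq_abs, abs_of_pos (by norm_num : (0:ℝ) < 2)]
      gcongr
      exact Complex.abs_re_le_norm _
    rw [intervalIntegral.integral_const_mul] at h1
    refine h1.trans ?_
    gcongr 2 * ?_
    refine intervalIntegral.integral_mono_interval hx.1 hxy hy.2 (Eventually.of_forall fun z => norm_nonneg _) (iiI cN.norm hα (hx.1.trans hx.2))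
  rcases le_total x y with h | h
  · have := (abs_le.1 (key x y hx hy h)).1
    linarith
  · have := (abs_le.1 (key y x hy hx h)).2
    linarith

lemma D1.WN (d : D1 k r q M A s CH m1 c m a e p v B g1 N n U uV D g2) {ρ l : ℝ} (hρ : r ≤ ρ) (hl : 1 ≤ l) :
    ∫ x in ρ..(ρ + l ^ 2), ‖N x‖ ≤ 3 / 2 * l * (√M * √A) := by
  have hm := win_int (cont_of_deriv d.dm) d.m_nn d.Im d.hM hρ (sq_nonneg l)
  have hle : ρ ≤ ρ + l ^ 2 := by linarith [sq_nonneg l]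
  have h := csI (f := fun x => ‖N x‖) (x := m) (y := a) hle ((cont_of_deriv d.dN).norm.mono (subIcc hρ)) ((cont_of_deriv d.dm).mono (subIcc hρ))
    (d.ca.mono (subIcc hρ)) (fun x hx => d.m_nn x (hρ.trans hx.1)) (fun x hx => d.a_nn x (hρ.trans hx.1))
    (fun x hx => d.bN x (hρ.trans hx.1)) hm (d.Ia' hρ hle)
  rw [Real.sqrt_mul (by positivity)] at h
  have h2 : √(l ^ 2 + 1) ≤ 3 / 2 * l := by
    refine Real.sqrt_le_iff.2 ⟨by linarith, by nlinarith⟩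
  calc _ ≤ _ := h
    _ ≤ 3 / 2 * l * √M * √A := by gcongr
    _ = _ := by ring

lemma D1.WB (d : D1 k r q M A s CH m1 c m a e p v B g1 N n U uV D g2) {ρ l : ℝ} (hρ : r ≤ ρ) (hl : 1 ≤ l) :
    ∫ x in ρ..(ρ + l ^ 2), |B x| ≤ 3 / 2 * l * (q * √M ^ 2) := by
  have hm := win_int (cont_of_deriv d.dm) d.m_nn d.Im d.hM hρ (sq_nonneg l)
  have hle : ρ ≤ ρ + l ^ 2 := by linarith [sq_nonneg l]
  have h := d.Bx hρ hle (d.Ie' hρ hle) hm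
  rw [Real.sqrt_mul (sq_nonneg q), Real.sqrt_mul (by positivity : 0 ≤ l ^ 2 + 1), Real.sqrt_sq d.hq] at h
  have h2 : √(l ^ 2 + 1) ≤ 3 / 2 * l := by
    refine Real.sqrt_le_iff.2 ⟨by linarith, by nlinarith⟩
  have hq := d.hq
  calc _ ≤ _ := h
    _ ≤ q * √M * (3 / 2 * l * √M) := by gcongr
    _ = _ := by ring

lemma D1.Wn (d : D1 k r q M A s CH m1 c m a e p v B g1 N n U uV D g2) {ρ l : ℝ} (hρ : r ≤ ρ) (hl : 1 ≤ l) :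
    ‖c‖ * (∫ x in ρ..(ρ + l ^ 2), ‖n x‖) ≤ l * (√(m r) * √A) := by
  have hle : ρ ≤ ρ + l ^ 2 := by linarith [sq_nonneg l]
  have h := csI (f := fun x => ‖n x‖) (x := fun _ => s) (y := a) (X := s * l ^ 2) hle ((cont_of_deriv d.dn).norm.mono (subIcc hρ))
    continuousOn_const (d.ca.mono (subIcc hρ)) (fun _ _ => d.hs.le) (fun x hx => d.a_nn x (hρ.trans hx.1)) (fun x hx => d.bn x (hρ.trans hx.1))
    (by rw [intervalIntegral.integral_const, smul_eq_mul, mul_comm]; have := d.hs; gcongr; linarith) (d.Ia' hρ hle)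
  rw [Real.sqrt_mul d.hs.le, Real.sqrt_sq (by linarith)] at h
  calc _ ≤ ‖c‖ * (√s * l * √A) := by gcongr
    _ = l * ((‖c‖ * √s) * √A) := by ring
    _ ≤ _ := by gcongr; exact d.cS

lemma alg3 {K κ q g μ ν Y Z l IN IB In C1 : ℝ} (hK : 0 < K) (hκ : 0 < κ) (hκK : κ ≤ K)
    (hq : 0 ≤ q) (hμ0 : 0 ≤ μ) (hν0 : 0 ≤ ν) (hμY : μ ≤ Y) (hZ0 : 0 ≤ Z) (hg0 : 0 ≤ g) (hl : 1 ≤ l)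
    (hl2 : 12 * (κ / K ^ 2 * q) ≤ l) (hN : IN ≤ 3 / 2 * l * (Y * Z)) (hB : IB ≤ 3 / 2 * l * (q * Y ^ 2)) (hn : In ≤ l * (μ * Z)) :
    2 * (IN / K + κ / K ^ 2 * IB + κ / K ^ 2 * In) + l ^ 2 * (C1 * X2 K κ q g μ ν Y Z + Y ^ 2 / 8) ≤
      l ^ 2 * ((5 + C1) * X2 K κ q g μ ν Y Z + 3 / 8 * Y ^ 2) := by
  have hY0 : 0 ≤ Y := hμ0.trans hμY
  have hJ0 : 0 < κ / K ^ 2 := by positivity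
  have hJ1 : κ / K ^ 2 ≤ 1 / K := by
    rw [div_le_div_iff₀ (by positivity) hK]; nlinarith
  have hX : Y * Z / K ≤ X2 K κ q g μ ν Y Z := by
    unfold X2
    have : 0 ≤ κ / K ^ 2 * (Z * Y * q + μ ^ 2 * q + Y ^ 2 * q * g) := by positivity
    have : 0 ≤ μ * ν / K := by positivity
    nlinarith
  set J := κ / K ^ 2
  have h1 : IN / K ≤ 3 / 2 * l * (Y * Z / K) := by
    rw [div_le_iff₀ hK]
    calc _ ≤ _ := hN
      _ = _ := by field_simp
  have h2 : J * IB ≤ l ^ 2 * Y ^ 2 / 8 := by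
    calc J * IB ≤ J * (3 / 2 * l * (q * Y ^ 2)) := by gcongr
      _ = (12 * (J * q)) * (l * Y ^ 2 / 8) := by ring
      _ ≤ l * (l * Y ^ 2 / 8) := by gcongr
      _ = _ := by ring
  have h3 : J * In ≤ l * (Y * Z / K) := by
    calc J * In ≤ J * (l * (μ * Z)) := by gcongr
      _ ≤ 1 / K * (l * (Y * Z)) := by gcongr
      _ = _ := by ring
  have p5 : 0 ≤ Y * Z / K := by positivity
  have h4 : l * (Y * Z / K) ≤ l ^ 2 * (Y * Z / K) := by gcongr; nlinarith
  have h5 : l ^ 2 * (Y * Z / K) ≤ l ^ 2 * X2 K κ q g μ ν Y Z := by gcongr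
  clear_value J
  generalize X2 K κ q g μ ν Y Z = X at *
  linarith

lemma D1.avg (d : D1 k r q M A s CH m1 c m a e p v B g1 N n U uV D g2) (hμY : √(m r) ≤ √M) {ρ l : ℝ} (hρ : r ≤ ρ) (hl : 1 ≤ l)
    (hl2 : 12 * (k.im / ‖k‖ ^ 2 * q) ≤ l) :
    ∫ x in ρ..(ρ + l ^ 2), m x ≤ l ^ 2 * ((5 + 2 * (4 * √CH + 21)) * X2 ‖k‖ k.im q (√(r+1))⁻¹ √(m r) √m1 √M √A + 3 / 8 * √M ^ 2) := by
  have hκK : k.im ≤ ‖k‖ := (le_abs_self _).trans (Complex.abs_im_le_norm k)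
  have hK : 0 < ‖k‖ := d.hk.trans_le hκK
  have hle : ρ ≤ ρ + l ^ 2 := by linarith [sq_nonneg l]
  have iN := iiI (cont_of_deriv d.dN).norm hρ hle
  have iB := iiI (cont_of_deriv d.dB).abs hρ hle
  have iin := iiI (cont_of_deriv d.dn).norm hρ hle
  refine le_trans ?_ (alg3 hK d.hk hκK d.hq (Real.sqrt_nonneg _) (Real.sqrt_nonneg m1) hμY (Real.sqrt_nonneg A)
    (show 0 ≤ (√(r+1))⁻¹ by positivity) hl hl2 (d.WN hρ hl) (d.WB hρ hl) (d.Wn hρ hl))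
  have h := intervalIntegral.integral_mono_on hle (iiI (cont_of_deriv d.dm) hρ hle)
    ((((((iN.div_const ‖k‖).add (iB.const_mul (k.im / ‖k‖ ^ 2))).add ((iin.const_mul ‖c‖).const_mul (k.im / ‖k‖ ^ 2))).const_mul 2).add
      (intervalIntegrable_const (c := 2 * (4 * √CH + 21) * X2 ‖k‖ k.im q (√(r+1))⁻¹ √(m r) √m1 √M √A))).add
      (intervalIntegrable_const (c := √M ^ 2 / 8))) fun x hx => d.mpt hμY (hρ.trans hx.1)
  refine h.trans (le_of_eq ?_)
  rw [intervalIntegral.integral_add ((((((iN.div_const ‖k‖).add (iB.const_mul (k.im / ‖k‖ ^ 2))).add ((iin.const_mul ‖c‖).const_mul (k.im / ‖k‖ ^ 2))).const_mul 2).add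
      (intervalIntegrable_const))) intervalIntegrable_const,
    intervalIntegral.integral_add (((((iN.div_const ‖k‖).add (iB.const_mul (k.im / ‖k‖ ^ 2))).add ((iin.const_mul ‖c‖).const_mul (k.im / ‖k‖ ^ 2))).const_mul 2)) intervalIntegrable_const,
    intervalIntegral.integral_const_mul,
    intervalIntegral.integral_add (((iN.div_const ‖k‖).add (iB.const_mul (k.im / ‖k‖ ^ 2)))) ((iin.const_mul ‖c‖).const_mul (k.im / ‖k‖ ^ 2)),
    intervalIntegral.integral_add (iN.div_const ‖k‖) (iB.const_mul (k.im / ‖k‖ ^ 2)),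
    intervalIntegral.integral_div, intervalIntegral.integral_const_mul, intervalIntegral.integral_const_mul, intervalIntegral.integral_const_mul,
    intervalIntegral.integral_const, intervalIntegral.integral_const]
  simp only [smul_eq_mul]
  ring

lemma D1.part2 (d : D1 k r q M A s CH m1 c m a e p v B g1 N n U uV D g2) :
    M ≤ (16 * √CH + 168) * X2 ‖k‖ k.im q (√(r+1))⁻¹ √(m r) √m1 √M √A := by
  have hq := d.hq
  have hk := d.hk
  have hκK : k.im ≤ ‖k‖ := (le_abs_self _).trans (Complex.abs_im_le_norm k)
  have hK : 0 < ‖k‖ := d.hk.trans_le hκK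
  have hh0 := Real.sqrt_nonneg CH
  have hM2 := Real.sq_sqrt d.hM
  have hg0 : 0 ≤ (√(r+1))⁻¹ := by positivity
  have p1 : 0 ≤ k.im / ‖k‖ ^ 2 * (√A * √M * q) := by positivity
  have p2 : 0 ≤ k.im / ‖k‖ ^ 2 * (√(m r) ^ 2 * q + √M ^ 2 * q * (√(r+1))⁻¹) := by positivity
  have p3 : 0 ≤ √(m r) * √m1 / ‖k‖ := by positivity
  have p4 : 0 ≤ √M * √A / ‖k‖ := by positivity
  have p5 : 0 ≤ √(m r) ^ 2 := by positivity
  have hXe : X2 ‖k‖ k.im q (√(r+1))⁻¹ √(m r) √m1 √M √A = k.im / ‖k‖ ^ 2 * (√A * √M * q) +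
    k.im / ‖k‖ ^ 2 * (√(m r) ^ 2 * q + √M ^ 2 * q * (√(r+1))⁻¹) + √(m r) ^ 2 + √(m r) * √m1 / ‖k‖ + √M * √A / ‖k‖ := by
    unfold X2; ring
  set X := X2 ‖k‖ k.im q (√(r+1))⁻¹ √(m r) √m1 √M √A with hX
  have hX0 : 0 ≤ X := by linarith
  have hhX : 0 ≤ √CH * X := by positivity
  rcases le_total √M √(m r) with hμ | hμ
  · have : √M ^ 2 ≤ √(m r) ^ 2 := by gcongr
    linarith
  suffices h : M ≤ (41 + 2 * (4 * √CH + 21)) * X + 3 / 8 * M by linarith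
  refine d.supM _ fun ρ hρ => ?_
  have hρ := hρ.le
  rcases le_total (12 * (k.im / ‖k‖ ^ 2 * q)) 1 with h1 | h1
  · have h2 := d.avg hμ hρ le_rfl h1
    rw [one_pow, one_mul, hM2, ← hX] at h2
    linarith
  · set l := 12 * (k.im / ‖k‖ ^ 2 * q) with hl
    have h2 := d.avg hμ hρ h1 le_rfl
    rw [hM2, ← hX] at h2
    have hl2 : 1 ≤ l ^ 2 := by nlinarith
    have cm := cont_of_deriv d.dm
    obtain ⟨y, hy, hmin⟩ := (isCompact_Icc (a := ρ) (b := ρ + l ^ 2)).exists_isMinOn (Set.nonempty_Icc.2 (by linarith)) (cm.mono (subIcc hρ))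
    have h3 : l ^ 2 * m y ≤ ∫ x in ρ..(ρ + l ^ 2), m x := by
      calc l ^ 2 * m y = ∫ _x in ρ..(ρ + l ^ 2), m y := by rw [intervalIntegral.integral_const, smul_eq_mul]; ring
        _ ≤ _ := intervalIntegral.integral_mono_on (by linarith) intervalIntegrable_const (iiI cm hρ (by linarith)) fun x hx => hmin hx
    have h4 : m y ≤ (5 + 2 * (4 * √CH + 21)) * X + 3 / 8 * M := by
      refine le_of_mul_le_mul_left (h3.trans h2) (by linarith)
    have hN := d.WN hρ h1
    have h5 : ∀ x ∈ Set.Icc ρ (ρ+1), m x ≤ (5 + 2 * (4 * √CH + 21)) * X + 3 / 8 * M + 3 * l * (√M * √A) := by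
      intro x hx
      have := d.osc hρ (x := x) (y := y) (β := ρ + l ^ 2) ⟨hx.1, by linarith [hx.2]⟩ hy
      linarith
    have h6 : 3 * l * (√M * √A) ≤ 36 * X := by
      have : 3 * l * (√M * √A) = 36 * (k.im / ‖k‖ ^ 2 * (√A * √M * q)) := by rw [hl]; ring
      linarith
    calc ∫ x in ρ..(ρ+1), m x ≤ ∫ _x in ρ..(ρ+1), ((5 + 2 * (4 * √CH + 21)) * X + 3 / 8 * M + 3 * l * (√M * √A)) :=
          intervalIntegral.integral_mono_on (by linarith) (iiI cm hρ (by linarith)) intervalIntegrable_const h5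
      _ = (5 + 2 * (4 * √CH + 21)) * X + 3 / 8 * M + 3 * l * (√M * √A) := by
          rw [intervalIntegral.integral_const, smul_eq_mul]; ring
      _ ≤ _ := by linarith

end

end PartB5

section PartB6
open scoped ENNReal Topology Pointwise

lemma sm_cs {F : Type*} [NormedAddCommGroup F] [NormedSpace ℝ F] {R ρ : ℝ} (hR : 0 ≤ R) (hρ : R < ρ) {f : E3 → F} {g h : E3 → ℝ}
    (cf : ContinuousOn f (Om R)) (cg : ContinuousOn g (Om R)) (ch : ContinuousOn h (Om R))
    (hg : ∀ x ∈ Om R, 0 ≤ g x) (hh : ∀ x ∈ Om R, 0 ≤ h x)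
    (hf : ∀ x, ‖x‖ = ρ → ‖f x‖ ^ 2 ≤ g x * h x) : ‖sm f ρ‖ ^ 2 ≤ sm g ρ * sm h ρ := by
  have h1 : ‖sm f ρ‖ ≤ ∫ ω : S2, √(g (ρ • (ω : E3))) * √(h (ρ • (ω : E3))) ∂sig := by
    refine (norm_integral_le_integral_norm _).trans ?_
    refine integral_mono (sm_int hR cf hρ).norm (sm_int hR (cg.sqrt.mul ch.sqrt) hρ) fun ω => ?_
    have hm := mem_Om hR hρ ω
    simp only
    rw [← Real.sqrt_mul (hg _ hm)]
    exact Real.le_sqrt_of_sq_le (hf _ (norm_smul_S2 (hR.trans hρ.le) ω))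
  have h2 := cs_real (μ := sig) (f := fun ω : S2 => √(g (ρ • (ω : E3)))) (g := fun ω : S2 => √(h (ρ • (ω : E3))))
    (sm_int hR (cg.sqrt.pow 2) hρ) (sm_int hR (cg.sqrt.mul ch.sqrt) hρ) (sm_int hR (ch.sqrt.pow 2) hρ)
  have e1 : ∫ ω : S2, √(g (ρ • (ω : E3))) ^ 2 ∂sig = sm g ρ :=
    integral_congr_ae (Eventually.of_forall fun ω => Real.sq_sqrt (hg _ (mem_Om hR hρ ω)))
  have e2 : ∫ ω : S2, √(h (ρ • (ω : E3))) ^ 2 ∂sig = sm h ρ :=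
    integral_congr_ae (Eventually.of_forall fun ω => Real.sq_sqrt (hh _ (mem_Om hR hρ ω)))
  rw [e1, e2] at h2
  refine le_trans ?_ h2
  gcongr

lemma sm_const (ρ b : ℝ) : sm (fun _ => b) ρ = s0 * b := by
  simp [sm, s0]

lemma sm_mono {R ρ : ℝ} (hR : 0 ≤ R) (hρ : R < ρ) {g h : E3 → ℝ}
    (cg : ContinuousOn g (Om R)) (ch : ContinuousOn h (Om R)) (hgh : ∀ x, ‖x‖ = ρ → g x ≤ h x) : sm g ρ ≤ sm h ρ :=
  integral_mono (sm_int hR cg hρ) (sm_int hR ch hρ) fun ω => hgh _ (norm_smul_S2 (hR.trans hρ.le) ω)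

lemma sm_congr {F : Type*} [NormedAddCommGroup F] [NormedSpace ℝ F] {ρ : ℝ} (hρ : 0 ≤ ρ) {g h : E3 → F}
    (hgh : ∀ x, ‖x‖ = ρ → g x = h x) : sm g ρ = sm h ρ :=
  integral_congr_ae (Eventually.of_forall fun ω => hgh _ (norm_smul_S2 hρ ω))

lemma sm_add {F : Type*} [NormedAddCommGroup F] [NormedSpace ℝ F] {R ρ : ℝ} (hR : 0 ≤ R) (hρ : R < ρ) {g h : E3 → F}
    (cg : ContinuousOn g (Om R)) (ch : ContinuousOn h (Om R)) : sm (fun x => g x + h x) ρ = sm g ρ + sm h ρ :=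
  integral_add (sm_int hR cg hρ) (sm_int hR ch hρ)

lemma sm_sub {F : Type*} [NormedAddCommGroup F] [NormedSpace ℝ F] {R ρ : ℝ} (hR : 0 ≤ R) (hρ : R < ρ) {g h : E3 → F}
    (cg : ContinuousOn g (Om R)) (ch : ContinuousOn h (Om R)) : sm (fun x => g x - h x) ρ = sm g ρ - sm h ρ :=
  integral_sub (sm_int hR cg hρ) (sm_int hR ch hρ)

lemma sm_mulc (b : ℂ) (g : E3 → ℂ) (ρ : ℝ) : sm (fun x => b * g x) ρ = b * sm g ρ := integral_const_mul _ _

lemma sm_mulr (b : ℝ) (g : E3 → ℝ) (ρ : ℝ) : sm (fun x => b * g x) ρ = b * sm g ρ := integral_const_mul _ _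

lemma sm_ofReal (g : E3 → ℝ) (ρ : ℝ) : sm (fun x => (g x : ℂ)) ρ = ((sm g ρ : ℝ) : ℂ) := integral_ofReal

lemma sm_re {R ρ : ℝ} (hR : 0 ≤ R) (hρ : R < ρ) {g : E3 → ℂ} (cg : ContinuousOn g (Om R)) : sm (fun x => (g x).re) ρ = (sm g ρ).re :=
  Complex.reCLM.integral_comp_comm (sm_int hR cg hρ)

noncomputable def dd (u : E3 → ℂ) (i : Fin 3) (x : E3) : ℂ := fderiv ℝ u x (ee i)
noncomputable def hs (u : E3 → ℂ) (x : E3) : ℝ := ∑ i, ‖dd u i x‖ ^ 2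

lemma fd_sum (u : E3 → ℂ) (x h : E3) : fderiv ℝ u x h = ∑ i, (h i) • dd u i x := by
  have : h = ∑ i, (h i) • ee i := by
    ext j
    fin_cases j <;> simp [Fin.sum_univ_three]
  conv_lhs => rw [this]
  rw [map_sum]
  simp only [map_smul, dd]

lemma rad_eq (u : E3 → ℂ) : rad u = rc (dd u) := by
  funext x
  rw [rad, fd_sum, rc]
  simp

lemma hs_nn (u : E3 → ℂ) (x : E3) : 0 ≤ hs u x := Finset.sum_nonneg fun _ _ => by positivity

lemma lin_le (u : E3 → ℂ) (x h : E3) : ‖∑ i, (h i) • dd u i x‖ ^ 2 ≤ ‖h‖ ^ 2 * hs u x := by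
  have h1 : ‖∑ i, (h i) • dd u i x‖ ≤ ∑ i, |h i| * ‖dd u i x‖ := by
    refine (norm_sum_le _ _).trans (Finset.sum_le_sum fun i _ => ?_)
    rw [norm_smul, Real.norm_eq_abs]
  have h2 := Finset.sum_mul_sq_le_sq_mul_sq Finset.univ (fun i => |h i|) (fun i => ‖dd u i x‖)
  have h3 : ‖h‖ ^ 2 = ∑ i, |h i| ^ 2 := by
    rw [EuclideanSpace.norm_sq_eq]; simp
  rw [h3, hs]
  refine le_trans ?_ h2
  gcongr

lemma op_le_hs (u : E3 → ℂ) (x : E3) : ‖fderiv ℝ u x‖ ^ 2 ≤ hs u x := by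
  have : ‖fderiv ℝ u x‖ ≤ √(hs u x) := by
    refine ContinuousLinearMap.opNorm_le_bound _ (Real.sqrt_nonneg _) fun h => ?_
    refine abs_le_of_sq_le_sq' ?_ (by positivity) |>.2
    rw [fd_sum, mul_pow, Real.sq_sqrt (hs_nn u x), mul_comm]
    exact lin_le u x h
  calc _ ≤ √(hs u x) ^ 2 := by gcongr
    _ = _ := Real.sq_sqrt (hs_nn u x)

lemma dd_le (u : E3 → ℂ) (i : Fin 3) (x : E3) : ‖dd u i x‖ ≤ ‖fderiv ℝ u x‖ := by
  have := (fderiv ℝ u x).le_opNorm (ee i)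
  simpa [ee, dd] using this

lemma hs_le_op (u : E3 → ℂ) (x : E3) : hs u x ≤ 3 * ‖fderiv ℝ u x‖ ^ 2 := by
  unfold hs
  calc _ ≤ ∑ _i : Fin 3, ‖fderiv ℝ u x‖ ^ 2 := Finset.sum_le_sum fun i _ => by gcongr; exact dd_le u i x
    _ = _ := by simp

section
variable {R : ℝ} {u : E3 → ℂ}

lemma dd_cd (hu : ContDiffOn ℝ 2 u (Om R)) (i : Fin 3) : ContDiffOn ℝ 1 (dd u i) (Om R) := by
  have h := hu.fderiv_of_isOpen (isOpen_Om R) (m := 1) (by norm_num)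
  exact h.clm_apply contDiffOn_const

lemma hs_cont (hu : ContDiffOn ℝ 2 u (Om R)) : ContinuousOn (hs u) (Om R) := by
  unfold hs
  exact continuousOn_finsetSum _ fun i _ => ((dd_cd hu i).continuousOn.norm.pow 2)

lemma diffAt {F : Type*} [NormedAddCommGroup F] [NormedSpace ℝ F] {f : E3 → F} (hf : ContDiffOn ℝ 1 f (Om R)) {x : E3} (hx : x ∈ Om R) :
    DifferentiableAt ℝ f x := (hf.contDiffAt ((isOpen_Om R).mem_nhds hx)).differentiableAt (by norm_num)

lemma conj_fd {f : E3 → ℂ} {f' : E3 →L[ℝ] ℂ} {x : E3} (h : HasFDerivAt f f' x) :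
    HasFDerivAt (fun y => (starRingEnd ℂ) (f y)) ((Complex.conjCLE : ℂ →L[ℝ] ℂ).comp f') x :=
  (Complex.conjCLE : ℂ →L[ℝ] ℂ).hasFDerivAt.comp x h

lemma conj_cd {f : E3 → ℂ} (hf : ContDiffOn ℝ 1 f (Om R)) : ContDiffOn ℝ 1 (fun y => (starRingEnd ℂ) (f y)) (Om R) :=
  (Complex.conjCLE : ℂ →L[ℝ] ℂ).contDiff.comp_contDiffOn hf

lemma normsq_fd {f : E3 → ℂ} {f' : E3 →L[ℝ] ℂ} {x : E3} (h : HasFDerivAt f f' x) (v : E3) :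
    fderiv ℝ (fun y => ‖f y‖ ^ 2) x v = 2 * ((starRingEnd ℂ) (f x) * f' v).re := by
  have := h.norm_sq.fderiv
  rw [this]
  simp [Complex.inner]
  ring

/-- the vector fields fed to the divergence theorem -/
noncomputable def GN (u : E3 → ℂ) (i : Fin 3) (x : E3) : ℂ := (starRingEnd ℂ) (u x) * dd u i x
noncomputable def GB (Q : E3 → E3) (u : E3 → ℂ) (i : Fin 3) (x : E3) : ℝ := Q x i * ‖u x‖ ^ 2
noncomputable def GD (Q : E3 → E3) (u : E3 → ℂ) (i : Fin 3) (x : E3) : ℂ := (Q x i) • u x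
noncomputable def fg1 (Q : E3 → E3) (u : E3 → ℂ) (x : E3) : ℝ := 2 * ((starRingEnd ℂ) (u x) * ∑ i, (Q x i) • dd u i x).re
noncomputable def fg2 (Q : E3 → E3) (u : E3 → ℂ) (x : E3) : ℂ := ∑ i, (Q x i) • dd u i x

lemma GN_cd (hu : ContDiffOn ℝ 2 u (Om R)) (i : Fin 3) : ContDiffOn ℝ 1 (GN u i) (Om R) :=
  (conj_cd (hu.of_le (by norm_num))).mul (dd_cd hu i)

lemma Q_cd {Q : E3 → E3} (hQ : ContDiff ℝ 1 Q) (i : Fin 3) : ContDiff ℝ 1 (fun x => Q x i) :=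
  (EuclideanSpace.proj i : E3 →L[ℝ] ℝ).contDiff.comp hQ

lemma GB_cd {Q : E3 → E3} (hQ : ContDiff ℝ 1 Q) (hu : ContDiffOn ℝ 1 u (Om R)) (i : Fin 3) : ContDiffOn ℝ 1 (GB Q u i) (Om R) :=
  (Q_cd hQ i).contDiffOn.mul (hu.norm_sq ℝ)

lemma GD_cd {Q : E3 → E3} (hQ : ContDiff ℝ 1 Q) (hu : ContDiffOn ℝ 1 u (Om R)) (i : Fin 3) : ContDiffOn ℝ 1 (GD Q u i) (Om R) :=
  (Q_cd hQ i).contDiffOn.smul hu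

lemma dv_dd (x : E3) : dv (dd u) x = lap u x := rfl

lemma dv_GN (hu : ContDiffOn ℝ 2 u (Om R)) {x : E3} (hx : x ∈ Om R) :
    dv (GN u) x = (hs u x : ℂ) + (starRingEnd ℂ) (u x) * lap u x := by
  have hu1 : ContDiffOn ℝ 1 u (Om R) := hu.of_le (by norm_num)
  rw [← dv_dd]
  unfold dv hs
  push_cast
  rw [Finset.mul_sum, ← Finset.sum_add_distrib]
  refine Finset.sum_congr rfl fun i _ => ?_
  have h1 := conj_fd (diffAt hu1 hx).hasFDerivAt
  have h2 := (diffAt (dd_cd hu i) hx).hasFDerivAt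
  have h3 : HasFDerivAt (GN u i) _ x := h1.mul h2
  rw [h3.fderiv]
  simp only [ContinuousLinearMap.add_apply, ContinuousLinearMap.smul_apply, ContinuousLinearMap.comp_apply, smul_eq_mul]
  have : (Complex.conjCLE : ℂ →L[ℝ] ℂ) ((fderiv ℝ u x) (ee i)) = (starRingEnd ℂ) (dd u i x) := rfl
  rw [this, Complex.mul_conj, Complex.normSq_eq_norm_sq]
  push_cast
  ring

lemma dv_GB {Q : E3 → E3} (hQ : ContDiff ℝ 1 Q) (hu : ContDiffOn ℝ 1 u (Om R)) {x : E3} (hx : x ∈ Om R) :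
    dv (GB Q u) x = rdiv Q x * ‖u x‖ ^ 2 + fg1 Q u x := by
  unfold dv rdiv fg1
  rw [Finset.mul_sum, Complex.re_sum, Finset.mul_sum, Finset.sum_mul, ← Finset.sum_add_distrib]
  refine Finset.sum_congr rfl fun i _ => ?_
  have h1 := ((Q_cd hQ i).differentiable (by norm_num) x).hasFDerivAt
  have h2 := (diffAt (hu.norm_sq ℝ) hx).hasFDerivAt
  have h3 : HasFDerivAt (GB Q u i) _ x := h1.mul h2
  rw [h3.fderiv]
  simp only [ContinuousLinearMap.add_apply, ContinuousLinearMap.smul_apply, smul_eq_mul]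
  rw [normsq_fd (diffAt hu hx).hasFDerivAt, mul_smul_comm, Complex.smul_re]
  simp only [dd, smul_eq_mul]
  ring

lemma dv_GD {Q : E3 → E3} (hQ : ContDiff ℝ 1 Q) (hu : ContDiffOn ℝ 1 u (Om R)) {x : E3} (hx : x ∈ Om R) :
    dv (GD Q u) x = (rdiv Q x : ℂ) * u x + fg2 Q u x := by
  unfold dv rdiv fg2
  push_cast
  rw [Finset.sum_mul, ← Finset.sum_add_distrib]
  refine Finset.sum_congr rfl fun i _ => ?_
  have h1 := ((Q_cd hQ i).differentiable (by norm_num) x).hasFDerivAt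
  have h2 := (diffAt hu hx).hasFDerivAt
  have h3 : HasFDerivAt (GD Q u i) _ x := h1.smul h2
  rw [h3.fderiv]
  simp [dd]
  ring

end

end PartB6

section PartB7
open scoped ENNReal Topology Pointwise

section
variable {R : ℝ} {u : E3 → ℂ} {Q : E3 → E3} {k : ℂ}

lemma rc_mul (g : E3 → ℂ) (G : Fin 3 → E3 → ℂ) (x : E3) : rc (fun i x => g x * G i x) x = g x * rc G x := by
  unfold rc
  rw [Finset.mul_sum]
  refine Finset.sum_congr rfl fun i _ => ?_
  rw [mul_smul_comm]

lemma rc_GN (x : E3) : rc (GN u) x = (starRingEnd ℂ) (u x) * rad u x := by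
  rw [rad_eq]; exact rc_mul _ _ x

/-- radial component of the field -/
noncomputable def qr (Q : E3 → E3) (x : E3) : ℝ := ∑ i, (‖x‖⁻¹ * x i) * Q x i

lemma rc_GB (x : E3) : rc (GB Q u) x = qr Q x * ‖u x‖ ^ 2 := by
  unfold rc qr GB
  rw [Finset.sum_mul]
  refine Finset.sum_congr rfl fun i _ => ?_
  rw [smul_eq_mul]; ring

lemma rc_GD (x : E3) : rc (GD Q u) x = (qr Q x : ℂ) * u x := by
  unfold rc qr GD
  push_cast
  rw [Finset.sum_mul]
  refine Finset.sum_congr rfl fun i _ => ?_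
  rw [Complex.real_smul, Complex.real_smul]; push_cast; ring

lemma nrm_unit (x : E3) : ‖‖x‖⁻¹ • x‖ ≤ 1 := by
  rw [norm_smul, norm_inv, norm_norm]; exact inv_mul_le_one

lemma qr_le (x : E3) : |qr Q x| ≤ ‖Q x‖ := by
  have : qr Q x = inner ℝ (Q x) (‖x‖⁻¹ • x) := by
    simp [qr, PiLp.inner_apply]
  rw [this]
  refine (abs_real_inner_le_norm _ _).trans ?_
  exact mul_le_of_le_one_right (norm_nonneg _) (nrm_unit x)

lemma rad_le (x : E3) : ‖rad u x‖ ≤ ‖fderiv ℝ u x‖ := by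
  refine ((fderiv ℝ u x).le_opNorm _).trans ?_
  exact mul_le_of_le_one_right (norm_nonneg _) (nrm_unit x)

lemma rad_sq (x : E3) : ‖rad u x‖ ^ 2 ≤ hs u x := by
  refine le_trans ?_ (op_le_hs u x)
  gcongr; exact rad_le x

lemma rad_cont (hR : 0 ≤ R) (hu : ContDiffOn ℝ 2 u (Om R)) : ContinuousOn (rad u) (Om R) :=
  cont_radial hR (hu.of_le (by norm_num))

lemma qr_cont (hR : 0 ≤ R) (hQ : ContDiff ℝ 1 Q) : ContinuousOn (qr Q) (Om R) := by
  unfold qr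
  exact continuousOn_finsetSum _ fun i _ => (contDiff_normx hR i).continuousOn.mul (Q_cd hQ i).continuous.continuousOn

lemma rdiv_cont (hQ : ContDiff ℝ 1 Q) : Continuous (rdiv Q) := by
  unfold rdiv
  exact continuous_finsetSum _ fun i _ => ((Q_cd hQ i).continuous_fderiv (by norm_num)).clm_apply continuous_const

lemma fg2_cont (hQ : ContDiff ℝ 1 Q) (hu : ContDiffOn ℝ 2 u (Om R)) : ContinuousOn (fg2 Q u) (Om R) := by
  unfold fg2
  exact continuousOn_finsetSum _ fun i _ => (Q_cd hQ i).continuous.continuousOn.smul (dd_cd hu i).continuousOn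

lemma conj_cont (hu : ContinuousOn u (Om R)) : ContinuousOn (fun x => (starRingEnd ℂ) (u x)) (Om R) :=
  Complex.continuous_conj.comp_continuousOn hu

lemma fg1_cont (hQ : ContDiff ℝ 1 Q) (hu : ContDiffOn ℝ 2 u (Om R)) : ContinuousOn (fg1 Q u) (Om R) :=
  continuousOn_const.mul (Complex.continuous_re.comp_continuousOn ((conj_cont hu.continuousOn).mul (fg2_cont hQ hu)))

/-- the equation, solved for the Laplacian -/
def PDE (R : ℝ) (Q : E3 → E3) (k : ℂ) (u : E3 → ℂ) : Prop := ∀ x : E3, R < ‖x‖ →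
  -(lap u x) - 2 * (Complex.I * k - ((‖x‖⁻¹ : ℝ) : ℂ)) * rad u x + (rdiv Q x : ℂ) * u x = 0

noncomputable def smN (u : E3 → ℂ) : ℝ → ℂ := sm (fun x => (starRingEnd ℂ) (u x) * rad u x)
noncomputable def smn (u : E3 → ℂ) : ℝ → ℂ := sm (rad u)
noncomputable def smm (u : E3 → ℂ) : ℝ → ℝ := sm (fun x => ‖u x‖ ^ 2)
noncomputable def sma (u : E3 → ℂ) : ℝ → ℝ := sm (hs u)
noncomputable def smv (Q : E3 → E3) (u : E3 → ℂ) : ℝ → ℝ := sm (fun x => rdiv Q x * ‖u x‖ ^ 2)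
noncomputable def smuV (Q : E3 → E3) (u : E3 → ℂ) : ℝ → ℂ := sm (fun x => (rdiv Q x : ℂ) * u x)
noncomputable def smB (Q : E3 → E3) (u : E3 → ℂ) : ℝ → ℝ := sm (fun x => qr Q x * ‖u x‖ ^ 2)
noncomputable def smD (Q : E3 → E3) (u : E3 → ℂ) : ℝ → ℂ := sm (fun x => (qr Q x : ℂ) * u x)
noncomputable def sme (Q : E3 → E3) (u : E3 → ℂ) : ℝ → ℝ := sm (fun x => ‖Q x‖ ^ 2 * ‖u x‖ ^ 2)
noncomputable def smp (u : E3 → ℂ) (c : ℂ) : ℝ → ℝ := sm (fun x => ‖u x - c‖ ^ 2)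

lemma ofReal_contOn {g : E3 → ℝ} (h : ContinuousOn g (Om R)) : ContinuousOn (fun x => (g x : ℂ)) (Om R) :=
  Complex.continuous_ofReal.comp_continuousOn h

lemma lap_eq (hpde : PDE R Q k u) {x : E3} (hx : x ∈ Om R) :
    lap u x = (rdiv Q x : ℂ) * u x - 2 * Complex.I * k * rad u x + ((2 / ‖x‖ : ℝ) : ℂ) * rad u x := by
  have := hpde x hx
  push_cast at this ⊢
  linear_combination (-1 : ℂ) * this

lemma smN_d (hR : 0 ≤ R) (hu : ContDiffOn ℝ 2 u (Om R)) (hQ : ContDiff ℝ 1 Q) (hpde : PDE R Q k u) {ρ : ℝ} (hρ : R < ρ) :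
    HasDerivAt (smN u) ((sma u ρ : ℂ) + (smv Q u ρ : ℂ) - 2 * Complex.I * k * smN u ρ) ρ := by
  have hρ0 : 0 ≤ ρ := hR.trans hρ.le
  have h := sm_div hR (GN_cd hu) hρ
  have e0 : rc (GN u) = fun x => (starRingEnd ℂ) (u x) * rad u x := funext rc_GN
  rw [e0] at h
  refine h.congr_deriv ?_
  have cN : ContinuousOn (fun x => (starRingEnd ℂ) (u x) * rad u x) (Om R) := (conj_cont hu.continuousOn).mul (rad_cont hR hu)
  have cv : ContinuousOn (fun x => rdiv Q x * ‖u x‖ ^ 2) (Om R) := (rdiv_cont hQ).continuousOn.mul (hu.continuousOn.norm.pow 2)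
  have e1 : sm (dv (GN u)) ρ = sm (fun x => (((hs u x : ℝ) : ℂ) + ((rdiv Q x * ‖u x‖ ^ 2 : ℝ) : ℂ)) +
      (((2 / ρ : ℝ) : ℂ) - 2 * Complex.I * k) * ((starRingEnd ℂ) (u x) * rad u x)) ρ := by
    refine sm_congr hρ0 fun x hx => ?_
    have hx' : x ∈ Om R := by change R < ‖x‖; rw [hx]; exact hρ
    rw [dv_GN hu hx', lap_eq hpde hx', hx]
    have : (starRingEnd ℂ) (u x) * u x = ((‖u x‖ ^ 2 : ℝ) : ℂ) := by
      rw [mul_comm, Complex.mul_conj, Complex.normSq_eq_norm_sq]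
    push_cast at this ⊢
    linear_combination ((rdiv Q x : ℝ) : ℂ) * this
  have c1 : ContinuousOn (fun x => ((hs u x : ℝ) : ℂ) + ((rdiv Q x * ‖u x‖ ^ 2 : ℝ) : ℂ)) (Om R) :=
    (ofReal_contOn (hs_cont hu)).add (ofReal_contOn cv)
  have c2 : ContinuousOn (fun x => (((2 / ρ : ℝ) : ℂ) - 2 * Complex.I * k) * ((starRingEnd ℂ) (u x) * rad u x)) (Om R) :=
    continuousOn_const.mul cN
  rw [e1, sm_add hR hρ c1 c2,
    sm_add hR hρ (ofReal_contOn (hs_cont hu)) (ofReal_contOn cv), sm_ofReal, sm_ofReal, sm_mulc, Complex.real_smul]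
  unfold sma smv smN
  ring

lemma smn_d (hR : 0 ≤ R) (hu : ContDiffOn ℝ 2 u (Om R)) (hQ : ContDiff ℝ 1 Q) (hpde : PDE R Q k u) {ρ : ℝ} (hρ : R < ρ) :
    HasDerivAt (smn u) (smuV Q u ρ - 2 * Complex.I * k * smn u ρ) ρ := by
  have hρ0 : 0 ≤ ρ := hR.trans hρ.le
  have h := sm_div hR (dd_cd hu) hρ
  rw [← rad_eq] at h
  refine h.congr_deriv ?_
  have cv : ContinuousOn (fun x => (rdiv Q x : ℂ) * u x) (Om R) := (ofReal_contOn (rdiv_cont hQ).continuousOn).mul hu.continuousOn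
  have e1 : sm (dv (dd u)) ρ = sm (fun x => (rdiv Q x : ℂ) * u x + (((2 / ρ : ℝ) : ℂ) - 2 * Complex.I * k) * rad u x) ρ := by
    refine sm_congr hρ0 fun x hx => ?_
    have hx' : x ∈ Om R := by change R < ‖x‖; rw [hx]; exact hρ
    rw [dv_dd, lap_eq hpde hx', hx]
    ring
  have c2 : ContinuousOn (fun x => (((2 / ρ : ℝ) : ℂ) - 2 * Complex.I * k) * rad u x) (Om R) :=
    continuousOn_const.mul (rad_cont hR hu)
  rw [e1, sm_add hR hρ cv c2, sm_mulc, Complex.real_smul]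
  unfold smuV smn
  ring

lemma smm_d (hR : 0 ≤ R) (hu : ContDiffOn ℝ 2 u (Om R)) {ρ : ℝ} (hρ : R < ρ) :
    HasDerivAt (smm u) (2 * (smN u ρ).re) ρ := by
  have hρ0 : 0 ≤ ρ := hR.trans hρ.le
  have hu1 : ContDiffOn ℝ 1 u (Om R) := hu.of_le (by norm_num)
  have h := sm_deriv hR (hu1.norm_sq ℝ) hρ
  refine h.congr_deriv ?_
  have cN : ContinuousOn (fun x => (starRingEnd ℂ) (u x) * rad u x) (Om R) := (conj_cont hu.continuousOn).mul (rad_cont hR hu)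
  rw [smN, ← sm_re hR hρ cN, ← sm_mulr]
  refine sm_congr hρ0 fun x hx => ?_
  have hx' : x ∈ Om R := by change R < ‖x‖; rw [hx]; exact hρ
  rw [normsq_fd (diffAt hu1 hx').hasFDerivAt]
  rfl

lemma smU_d (hR : 0 ≤ R) (hu : ContDiffOn ℝ 2 u (Om R)) {ρ : ℝ} (hρ : R < ρ) : HasDerivAt (sm u) (smn u ρ) ρ :=
  sm_deriv hR (hu.of_le (by norm_num)) hρ

lemma smB_d (hR : 0 ≤ R) (hu : ContDiffOn ℝ 2 u (Om R)) (hQ : ContDiff ℝ 1 Q) {ρ : ℝ} (hρ : R < ρ) :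
    HasDerivAt (smB Q u) (smv Q u ρ + sm (fg1 Q u) ρ - 2 / ρ * smB Q u ρ) ρ := by
  have hρ0 : 0 ≤ ρ := hR.trans hρ.le
  have hu1 : ContDiffOn ℝ 1 u (Om R) := hu.of_le (by norm_num)
  have h := sm_div hR (GB_cd hQ hu1) hρ
  have e0 : rc (GB Q u) = fun x => qr Q x * ‖u x‖ ^ 2 := funext rc_GB
  rw [e0] at h
  refine h.congr_deriv ?_
  have cv : ContinuousOn (fun x => rdiv Q x * ‖u x‖ ^ 2) (Om R) := (rdiv_cont hQ).continuousOn.mul (hu.continuousOn.norm.pow 2)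
  rw [sm_congr hρ0 (fun x hx => dv_GB hQ hu1 (show x ∈ Om R by change R < ‖x‖; rw [hx]; exact hρ)), sm_add hR hρ cv (fg1_cont hQ hu), smul_eq_mul]
  rfl

lemma smD_d (hR : 0 ≤ R) (hu : ContDiffOn ℝ 2 u (Om R)) (hQ : ContDiff ℝ 1 Q) {ρ : ℝ} (hρ : R < ρ) :
    HasDerivAt (smD Q u) (smuV Q u ρ + sm (fg2 Q u) ρ - ((2 / ρ : ℝ) : ℂ) * smD Q u ρ) ρ := by
  have hρ0 : 0 ≤ ρ := hR.trans hρ.le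
  have hu1 : ContDiffOn ℝ 1 u (Om R) := hu.of_le (by norm_num)
  have h := sm_div hR (GD_cd hQ hu1) hρ
  have e0 : rc (GD Q u) = fun x => (qr Q x : ℂ) * u x := funext rc_GD
  rw [e0] at h
  refine h.congr_deriv ?_
  have cv : ContinuousOn (fun x => (rdiv Q x : ℂ) * u x) (Om R) := (ofReal_contOn (rdiv_cont hQ).continuousOn).mul hu.continuousOn
  rw [sm_congr hρ0 (fun x hx => dv_GD hQ hu1 (show x ∈ Om R by change R < ‖x‖; rw [hx]; exact hρ)), sm_add hR hρ cv (fg2_cont hQ hu), Complex.real_smul]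
  rfl

end

end PartB7

section PartB8
open scoped ENNReal Topology Pointwise

section
variable {R : ℝ} {u : E3 → ℂ} {Q : E3 → E3} {k : ℂ} {ρ : ℝ}

lemma sm_nn {g : E3 → ℝ} (h : ∀ x, 0 ≤ g x) (ρ : ℝ) : 0 ≤ sm g ρ := integral_nonneg fun _ => h _

lemma cu2 (hu : ContDiffOn ℝ 2 u (Om R)) : ContinuousOn (fun x => ‖u x‖ ^ 2) (Om R) := hu.continuousOn.norm.pow 2
lemma crad2 (hR : 0 ≤ R) (hu : ContDiffOn ℝ 2 u (Om R)) : ContinuousOn (fun x => ‖rad u x‖ ^ 2) (Om R) := (rad_cont hR hu).norm.pow 2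
lemma cN (hR : 0 ≤ R) (hu : ContDiffOn ℝ 2 u (Om R)) : ContinuousOn (fun x => (starRingEnd ℂ) (u x) * rad u x) (Om R) :=
  (conj_cont hu.continuousOn).mul (rad_cont hR hu)
lemma ce (hQ : ContDiff ℝ 1 Q) (hu : ContDiffOn ℝ 2 u (Om R)) : ContinuousOn (fun x => ‖Q x‖ ^ 2 * ‖u x‖ ^ 2) (Om R) :=
  (hQ.continuous.norm.pow 2).continuousOn.mul (cu2 hu)
lemma cp (hu : ContDiffOn ℝ 2 u (Om R)) (c : ℂ) : ContinuousOn (fun x => ‖u x - c‖ ^ 2) (Om R) :=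
  (hu.continuousOn.sub continuousOn_const).norm.pow 2
lemma cB (hR : 0 ≤ R) (hQ : ContDiff ℝ 1 Q) (hu : ContDiffOn ℝ 2 u (Om R)) : ContinuousOn (fun x => qr Q x * ‖u x‖ ^ 2) (Om R) :=
  (qr_cont hR hQ).mul (cu2 hu)
lemma cD (hR : 0 ≤ R) (hQ : ContDiff ℝ 1 Q) (hu : ContDiffOn ℝ 2 u (Om R)) : ContinuousOn (fun x => (qr Q x : ℂ) * u x) (Om R) :=
  (ofReal_contOn (qr_cont hR hQ)).mul hu.continuousOn

lemma bN (hR : 0 ≤ R) (hu : ContDiffOn ℝ 2 u (Om R)) (hρ : R < ρ) : ‖smN u ρ‖ ^ 2 ≤ smm u ρ * sma u ρ :=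
  sm_cs hR hρ (cN hR hu) (cu2 hu) (hs_cont hu) (fun _ _ => by positivity) (fun x _ => hs_nn u x) fun x _ => by
    rw [norm_mul, RCLike.norm_conj, mul_pow]
    gcongr; exact rad_sq x

lemma bN1 (hR : 0 ≤ R) (hu : ContDiffOn ℝ 2 u (Om R)) (hρ : R < ρ) : ‖smN u ρ‖ ^ 2 ≤ smm u ρ * sm (fun x => ‖rad u x‖ ^ 2) ρ :=
  sm_cs hR hρ (cN hR hu) (cu2 hu) (crad2 hR hu) (fun _ _ => by positivity) (fun x _ => by positivity) fun x _ => by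
    rw [norm_mul, RCLike.norm_conj, mul_pow]

lemma sm_cs1 {F : Type*} [NormedAddCommGroup F] [NormedSpace ℝ F] {R ρ : ℝ} (hR : 0 ≤ R) (hρ : R < ρ) {f : E3 → F} {h : E3 → ℝ}
    (cf : ContinuousOn f (Om R)) (ch : ContinuousOn h (Om R)) (hh : ∀ x ∈ Om R, 0 ≤ h x)
    (hf : ∀ x, ‖x‖ = ρ → ‖f x‖ ^ 2 ≤ h x) : ‖sm f ρ‖ ^ 2 ≤ s0 * sm h ρ := by
  have := sm_cs (g := fun _ => 1) hR hρ cf continuousOn_const ch (fun _ _ => by norm_num) hh (fun x hx => by rw [one_mul]; exact hf x hx)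
  rwa [sm_const, mul_one] at this

lemma bn (hR : 0 ≤ R) (hu : ContDiffOn ℝ 2 u (Om R)) (hρ : R < ρ) : ‖smn u ρ‖ ^ 2 ≤ s0 * sma u ρ :=
  sm_cs1 hR hρ (rad_cont hR hu) (hs_cont hu) (fun x _ => hs_nn u x) fun x _ => rad_sq x

lemma bn1 (hR : 0 ≤ R) (hu : ContDiffOn ℝ 2 u (Om R)) (hρ : R < ρ) : ‖smn u ρ‖ ^ 2 ≤ s0 * sm (fun x => ‖rad u x‖ ^ 2) ρ :=
  sm_cs1 hR hρ (rad_cont hR hu) (crad2 hR hu) (fun x _ => by positivity) fun x _ => le_rfl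

lemma bU (hR : 0 ≤ R) (hu : ContDiffOn ℝ 2 u (Om R)) (hρ : R < ρ) : ‖sm u ρ‖ ^ 2 ≤ s0 * smm u ρ :=
  sm_cs1 hR hρ hu.continuousOn (cu2 hu) (fun x _ => by positivity) fun x _ => le_rfl

lemma qr_sq (x : E3) : qr Q x ^ 2 ≤ ‖Q x‖ ^ 2 := by
  rw [← sq_abs]; gcongr; exact qr_le x

lemma bB (hR : 0 ≤ R) (hu : ContDiffOn ℝ 2 u (Om R)) (hQ : ContDiff ℝ 1 Q) (hρ : R < ρ) : smB Q u ρ ^ 2 ≤ sme Q u ρ * smm u ρ := by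
  rw [← sq_abs, ← Real.norm_eq_abs]
  refine sm_cs hR hρ (cB hR hQ hu) (ce hQ hu) (cu2 hu) (fun x _ => by positivity) (fun x _ => by positivity) fun x _ => ?_
  rw [Real.norm_eq_abs, sq_abs, mul_pow]
  calc qr Q x ^ 2 * (‖u x‖ ^ 2) ^ 2 ≤ ‖Q x‖ ^ 2 * (‖u x‖ ^ 2) ^ 2 := mul_le_mul_of_nonneg_right (qr_sq x) (by positivity)
    _ = _ := by ring

lemma bD (hR : 0 ≤ R) (hu : ContDiffOn ℝ 2 u (Om R)) (hQ : ContDiff ℝ 1 Q) (hρ : R < ρ) : ‖smD Q u ρ‖ ^ 2 ≤ s0 * sme Q u ρ := by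
  refine sm_cs1 hR hρ (cD hR hQ hu) (ce hQ hu) (fun x _ => by positivity) fun x _ => ?_
  rw [norm_mul, mul_pow, Complex.norm_real, Real.norm_eq_abs, sq_abs]
  gcongr ?_ * _
  exact qr_sq x

lemma be {q : ℝ} (hR : 0 ≤ R) (hu : ContDiffOn ℝ 2 u (Om R)) (hQ : ContDiff ℝ 1 Q) (hρ : R < ρ) (hq : ∀ x, ‖x‖ = ρ → ‖Q x‖ ≤ q) :
    sme Q u ρ ≤ q ^ 2 * smm u ρ := by
  rw [smm, ← sm_mulr]
  refine sm_mono hR hρ (ce hQ hu) (continuousOn_const.mul (cu2 hu)) fun x hx => ?_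
  have := hq x hx
  gcongr

lemma fg2_le (x : E3) : ‖fg2 Q u x‖ ^ 2 ≤ ‖Q x‖ ^ 2 * hs u x := lin_le u x (Q x)

lemma bg1 (hR : 0 ≤ R) (hu : ContDiffOn ℝ 2 u (Om R)) (hQ : ContDiff ℝ 1 Q) (hρ : R < ρ) :
    sm (fg1 Q u) ρ ^ 2 ≤ 4 * (sme Q u ρ * sma u ρ) := by
  have h := sm_cs (f := fg1 Q u) (g := fun x => ‖Q x‖ ^ 2 * ‖u x‖ ^ 2) (h := fun x => 4 * hs u x) hR hρ (fg1_cont hQ hu) (ce hQ hu)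
    (continuousOn_const.mul (hs_cont hu)) (fun x _ => by positivity) (fun x _ => by have := hs_nn u x; positivity) fun x _ => by
      have h1 : |fg1 Q u x| ≤ 2 * (‖u x‖ * ‖fg2 Q u x‖) := by
        unfold fg1
        rw [abs_mul, abs_two]
        gcongr
        refine (Complex.abs_re_le_norm _).trans ?_
        rw [norm_mul, RCLike.norm_conj]; rfl
      rw [Real.norm_eq_abs]
      calc |fg1 Q u x| ^ 2 ≤ (2 * (‖u x‖ * ‖fg2 Q u x‖)) ^ 2 := by gcongr
        _ = 4 * ‖u x‖ ^ 2 * ‖fg2 Q u x‖ ^ 2 := by ring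
        _ ≤ 4 * ‖u x‖ ^ 2 * (‖Q x‖ ^ 2 * hs u x) := by gcongr; exact fg2_le x
        _ = _ := by ring
  rw [sm_mulr, Real.norm_eq_abs, sq_abs] at h
  unfold sme sma
  linarith

lemma bg2 {q : ℝ} (hR : 0 ≤ R) (hu : ContDiffOn ℝ 2 u (Om R)) (hQ : ContDiff ℝ 1 Q) (hρ : R < ρ) (hq : ∀ x, ‖x‖ = ρ → ‖Q x‖ ≤ q) :
    ‖sm (fg2 Q u) ρ‖ ^ 2 ≤ q ^ 2 * s0 * sma u ρ := by
  have h := sm_cs1 (h := fun x => q ^ 2 * hs u x) hR hρ (fg2_cont hQ hu) (continuousOn_const.mul (hs_cont hu))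
    (fun x _ => by have := hs_nn u x; positivity) (fun x hx => by
      refine (fg2_le x).trans ?_
      have := hq x hx
      have := hs_nn u x
      gcongr)
  rw [sm_mulr] at h
  unfold sma
  linarith

lemma bc (hR : 0 ≤ R) (hu : ContDiffOn ℝ 2 u (Om R)) (hρ : R < ρ) : ‖s0⁻¹ • sm u ρ‖ ^ 2 * s0 ≤ smm u ρ := by
  have h := bU hR hu hρ
  have hs := s0_pos
  rw [norm_smul, mul_pow, norm_inv, Real.norm_eq_abs, abs_of_pos hs, inv_pow]
  calc (s0 ^ 2)⁻¹ * ‖sm u ρ‖ ^ 2 * s0 ≤ (s0 ^ 2)⁻¹ * (s0 * smm u ρ) * s0 := by gcongr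
    _ = _ := by field_simp

lemma bG {q : ℝ} (hR : 0 ≤ R) (hu : ContDiffOn ℝ 2 u (Om R)) (hQ : ContDiff ℝ 1 Q) (hρ : R < ρ) (hq : ∀ x, ‖x‖ = ρ → ‖Q x‖ ≤ q)
    (hq0 : 0 ≤ q) (c : ℂ) (w : ℝ) (hw0 : 0 ≤ w) (hw1 : w ≤ 1) :
    |smB Q u ρ - w * ((starRingEnd ℂ) c * smD Q u ρ).re| ≤
      √(sme Q u ρ) * √(smp u c ρ) + ‖c‖ * q * √s0 * √(smp u c ρ) + (1 - w) * s0 * q * ‖c‖ ^ 2 := by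
  have cB' := cB hR hQ hu
  have cD' := cD hR hQ hu
  have cd : ContinuousOn (fun x => ‖u x - c‖) (Om R) := (hu.continuousOn.sub continuousOn_const).norm
  have cE : ContinuousOn (fun x => w * ((starRingEnd ℂ) c * ((qr Q x : ℂ) * u x)).re) (Om R) :=
    continuousOn_const.mul (Complex.continuous_re.comp_continuousOn (continuousOn_const.mul cD'))
  have cE2 : ContinuousOn (fun x => ((starRingEnd ℂ) c * ((qr Q x : ℂ) * u x))) (Om R) := continuousOn_const.mul cD'
  have e1 : smB Q u ρ - w * ((starRingEnd ℂ) c * smD Q u ρ).re = sm (fun x => qr Q x * ‖u x‖ ^ 2 - w * ((starRingEnd ℂ) c * ((qr Q x : ℂ) * u x)).re) ρ := by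
    rw [sm_sub hR hρ cB' cE, sm_mulr, sm_re hR hρ cE2, sm_mulc]; rfl
  have c1 : ContinuousOn (fun x => ‖Q x‖ * ‖u x‖ * ‖u x - c‖) (Om R) := (hQ.continuous.norm.continuousOn.mul hu.continuousOn.norm).mul cd
  have c2 : ContinuousOn (fun x => ‖c‖ * q * ‖u x - c‖) (Om R) := continuousOn_const.mul cd
  have c3 : ContinuousOn (fun _ : E3 => (1 - w) * q * ‖c‖ ^ 2) (Om R) := continuousOn_const
  have c12 : ContinuousOn (fun x => ‖Q x‖ * ‖u x‖ * ‖u x - c‖ + ‖c‖ * q * ‖u x - c‖) (Om R) := c1.add c2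
  have h1 : |sm (fun x => qr Q x * ‖u x‖ ^ 2 - w * ((starRingEnd ℂ) c * ((qr Q x : ℂ) * u x)).re) ρ| ≤
      sm (fun x => (‖Q x‖ * ‖u x‖ * ‖u x - c‖ + ‖c‖ * q * ‖u x - c‖) + (1 - w) * q * ‖c‖ ^ 2) ρ := by
    rw [← Real.norm_eq_abs]
    have nn : ∀ F : E3 → ℝ, ‖sm F ρ‖ ≤ sm (fun x => ‖F x‖) ρ := fun F => norm_integral_le_integral_norm _
    refine (nn _).trans ?_
    refine sm_mono (g := fun x => ‖qr Q x * ‖u x‖ ^ 2 - w * ((starRingEnd ℂ) c * ((qr Q x : ℂ) * u x)).re‖) hR hρ (cB'.sub cE).norm (c12.add c3) fun x hx => ?_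
    have hqx := hq x hx
    have hqr := qr_le (Q := Q) x
    have k1 : qr Q x * ‖u x‖ ^ 2 - w * ((starRingEnd ℂ) c * ((qr Q x : ℂ) * u x)).re =
      qr Q x * (((starRingEnd ℂ) (u x) * (u x - c)).re + (1 - w) * (((starRingEnd ℂ) c * (u x - c)).re + ‖c‖ ^ 2)) := by
      rw [← Complex.normSq_eq_norm_sq, ← Complex.normSq_eq_norm_sq, Complex.normSq_apply, Complex.normSq_apply]
      simp only [Complex.mul_re, Complex.mul_im, Complex.conj_re, Complex.conj_im, Complex.sub_re, Complex.sub_im, Complex.ofReal_re, Complex.ofReal_im]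
      ring
    have k2 : |((starRingEnd ℂ) (u x) * (u x - c)).re| ≤ ‖u x‖ * ‖u x - c‖ := re_bd _ _
    have k3 : |((starRingEnd ℂ) c * (u x - c)).re| ≤ ‖c‖ * ‖u x - c‖ := re_bd _ _
    rw [Real.norm_eq_abs, k1, abs_mul]
    have hw : 0 ≤ 1 - w := by linarith
    calc _ ≤ |qr Q x| * (‖u x‖ * ‖u x - c‖ + (1 - w) * (‖c‖ * ‖u x - c‖ + ‖c‖ ^ 2)) := by
          gcongr
          refine (abs_add_le _ _).trans (add_le_add k2 ?_)
          rw [abs_mul, abs_of_nonneg hw]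
          gcongr
          refine (abs_add_le _ _).trans (add_le_add k3 ?_)
          rw [abs_of_nonneg (by positivity)]
      _ = |qr Q x| * (‖u x‖ * ‖u x - c‖) + |qr Q x| * ((1 - w) * (‖c‖ * ‖u x - c‖)) + |qr Q x| * ((1 - w) * ‖c‖ ^ 2) := by ring
      _ ≤ ‖Q x‖ * (‖u x‖ * ‖u x - c‖) + q * (1 * (‖c‖ * ‖u x - c‖)) + q * ((1 - w) * ‖c‖ ^ 2) := by
          have := hqr.trans hqx
          gcongr
          linarith
      _ = _ := by ring
  rw [sm_add hR hρ c12 c3, sm_add hR hρ c1 c2, sm_const, sm_mulr] at h1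
  have h2 : sm (fun x => ‖Q x‖ * ‖u x‖ * ‖u x - c‖) ρ ≤ √(sme Q u ρ) * √(smp u c ρ) := by
    have := sm_cs hR hρ c1 (ce hQ hu) (cp hu c) (fun x _ => by positivity) (fun x _ => by positivity) fun x _ => by
      rw [Real.norm_eq_abs, sq_abs, mul_pow, mul_pow]
    rw [← Real.sqrt_mul (show 0 ≤ sme Q u ρ from sm_nn (fun x => by positivity) ρ)]
    exact (le_abs_self _).trans (Real.le_sqrt_of_sq_le this)
  have h3 : sm (fun x => ‖u x - c‖) ρ ≤ √s0 * √(smp u c ρ) := by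
    have := sm_cs1 hR hρ cd (cp hu c) (fun x _ => by positivity) fun x _ => by
      rw [Real.norm_eq_abs, sq_abs]
    rw [← Real.sqrt_mul s0_pos.le]
    exact (le_abs_self _).trans (Real.le_sqrt_of_sq_le this)
  have h4 : ‖c‖ * q * sm (fun x => ‖u x - c‖) ρ ≤ ‖c‖ * q * (√s0 * √(smp u c ρ)) := by gcongr
  rw [e1]
  linarith

lemma bp (hR : 0 ≤ R) (hu : ContDiffOn ℝ 2 u (Om R)) (hρ : R < ρ) (c : ℂ) :
    smp u c ρ ≤ 2 * (s0⁻¹ * CP0) * (ρ ^ 2 * sma u ρ) + 2 * s0 * ‖s0⁻¹ • sm u ρ - c‖ ^ 2 := by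
  have hu1 : ContDiffOn ℝ 1 u (Om R) := hu.of_le (by norm_num)
  have h := poinc hR hu1 hρ
  set b := s0⁻¹ • sm u ρ
  have c3 : ContinuousOn (fun _ : E3 => 2 * ‖b - c‖ ^ 2) (Om R) := continuousOn_const
  have c4 : ContinuousOn (fun x : E3 => 2 * ‖u x - b‖ ^ 2) (Om R) := continuousOn_const.mul (cp hu b)
  have h1 : smp u c ρ ≤ sm (fun x => 2 * ‖u x - b‖ ^ 2 + 2 * ‖b - c‖ ^ 2) ρ := by
    refine sm_mono hR hρ (cp hu c) (c4.add c3) fun x _ => ?_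
    have : ‖u x - c‖ ≤ ‖u x - b‖ + ‖b - c‖ := by
      have := norm_add_le (u x - b) (b - c); simpa using this
    calc ‖u x - c‖ ^ 2 ≤ (‖u x - b‖ + ‖b - c‖) ^ 2 := by gcongr
      _ ≤ _ := by nlinarith [sq_nonneg (‖u x - b‖ - ‖b - c‖)]
  rw [sm_add hR hρ c4 c3, sm_const, sm_mulr] at h1
  have h2 : sm (fun x => ‖fderiv ℝ u x‖ ^ 2) ρ ≤ sma u ρ := by
    refine sm_mono hR hρ ((fd_cont hu1).norm.pow 2) (hs_cont hu) fun x _ => op_le_hs u x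
  have h3 : sm (fun x => ‖u x - b‖ ^ 2) ρ ≤ s0⁻¹ * CP0 * (ρ ^ 2 * sma u ρ) := by
    refine h.trans ?_
    have := s0_pos
    have := CP0_pos
    gcongr
  linarith

end

end PartB8

section PartB9
open scoped ENNReal Topology Pointwise

section
variable {R r : ℝ} {u : E3 → ℂ} {Q : E3 → E3} {k : ℂ} {ρ : ℝ}

lemma annSupV_nn (n : ℕ) : 0 ≤ annSupV Q n := by
  refine Real.sSup_nonneg ?_
  rintro _ ⟨x, _, rfl⟩
  exact norm_nonneg _

lemma Q_open (hQ : Continuous Q) {n : ℕ} {x : E3} (h1 : (n : ℝ) < ‖x‖) (h2 : ‖x‖ < (n : ℝ) + 1) : ‖Q x‖ ≤ annSupV Q n := by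
  refine le_csSup ?_ ⟨x, ⟨h1, h2⟩, rfl⟩
  have hb := (isCompact_closedBall (0 : E3) ((n : ℝ) + 1)).bddAbove_image hQ.norm.continuousOn
  refine hb.mono (Set.image_mono ?_)
  rintro y ⟨_, hy⟩
  simpa using hy.le

lemma Q_closed (hQ : Continuous Q) {n : ℕ} {x : E3} (hx : 0 < ‖x‖) (h1 : (n : ℝ) ≤ ‖x‖) (h2 : ‖x‖ ≤ (n : ℝ) + 1) :
    ‖Q x‖ ≤ annSupV Q n := by
  set w := ‖x‖⁻¹ • x with hw
  have hw1 : ‖w‖ = 1 := by rw [hw, norm_smul, norm_inv, norm_norm]; exact inv_mul_cancel₀ hx.ne'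
  have hc : IsClosed {t : ℝ | ‖Q (t • w)‖ ≤ annSupV Q n} :=
    isClosed_le ((hQ.comp (continuous_id.smul continuous_const)).norm) continuous_const
  have hs : Set.Ioo (n : ℝ) (n + 1) ⊆ {t : ℝ | ‖Q (t • w)‖ ≤ annSupV Q n} := by
    rintro t ⟨ht1, ht2⟩
    have ht0 : 0 ≤ t := (Nat.cast_nonneg n).trans ht1.le
    have hn : ‖t • w‖ = t := by rw [norm_smul, hw1, mul_one, Real.norm_of_nonneg ht0]
    exact Q_open hQ (by rw [hn]; exact ht1) (by rw [hn]; exact ht2)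
  have h3 := closure_minimal hs hc
  rw [closure_Ioo (by linarith)] at h3
  have h4 : ‖Q (‖x‖ • w)‖ ≤ annSupV Q n := h3 ⟨h1, h2⟩
  rwa [hw, smul_smul, mul_inv_cancel₀ hx.ne', one_smul] at h4

lemma tail_summ (hs : Summable fun n => (annSupV Q n) ^ 2) (N : ℕ) : Summable fun n => (annSupV Q (N + n)) ^ 2 := by
  have := (summable_nat_add_iff N).2 hs
  refine this.congr fun n => ?_
  rw [add_comm]

lemma tail_nn : 0 ≤ l2LinfTail Q r := Real.sqrt_nonneg _

lemma tail_sq : l2LinfTail Q r ^ 2 = ∑' n : ℕ, (annSupV Q (Nat.floor r + n)) ^ 2 :=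
  Real.sq_sqrt (tsum_nonneg fun _ => by positivity)

lemma Q_le_q (hQ : Continuous Q) (hs : Summable fun n => (annSupV Q n) ^ 2) {x : E3} (hx : 0 < ‖x‖) (h : r ≤ ‖x‖) :
    ‖Q x‖ ≤ l2LinfTail Q r := by
  have h1 : ‖Q x‖ ≤ annSupV Q ⌊‖x‖⌋₊ := Q_closed hQ hx (Nat.floor_le hx.le) (Nat.lt_floor_add_one _).le
  refine h1.trans ?_
  refine Real.le_sqrt_of_sq_le ?_
  have h2 : ⌊r⌋₊ ≤ ⌊‖x‖⌋₊ := Nat.floor_mono h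
  obtain ⟨j, hj⟩ := Nat.exists_eq_add_of_le h2
  rw [hj]
  exact (tail_summ hs _).le_tsum j fun _ _ => by positivity

lemma Q_lim (hQ : Continuous Q) (hs : Summable fun n => (annSupV Q n) ^ 2) : Tendsto Q (cocompact E3) (𝓝 0) := by
  have h1 : Tendsto (fun n => annSupV Q n) atTop (𝓝 0) := by
    have := (hs.tendsto_atTop_zero).sqrt
    simpa [Real.sqrt_sq (annSupV_nn _)] using this
  have h2 : Tendsto (fun x : E3 => annSupV Q ⌊‖x‖⌋₊) (cocompact E3) (𝓝 0) :=
    h1.comp (tendsto_nat_floor_atTop.comp (tendsto_norm_cocompact_atTop (E := E3)))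
  refine squeeze_zero_norm' ?_ h2
  filter_upwards [(tendsto_norm_cocompact_atTop (E := E3)).eventually_gt_atTop 0] with x hx
  exact Q_closed hQ hx (Nat.floor_le hx.le) (Nat.lt_floor_add_one _).le

lemma Ie_gen {e m : ℝ → ℝ} {q M : ℝ} {N : ℕ} {S : ℕ → ℝ} (hN : (N : ℝ) ≤ r) (hN1 : r < N + 1) (ce : ContinuousOn e (Set.Ici r))
    (cm : ContinuousOn m (Set.Ici r)) (e0 : ∀ x, r ≤ x → 0 ≤ e x) (m0 : ∀ x, r ≤ x → 0 ≤ m x)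
    (hM : ∀ t, r ≤ t → ∫ x in t..(t+1), m x ≤ M) (hM0 : 0 ≤ M) (hS : Summable fun n => S n ^ 2) (hq : ∑' n, S n ^ 2 ≤ q ^ 2)
    (he : ∀ (j : ℕ) x, r ≤ x → (N : ℝ) + j ≤ x → x ≤ N + j + 1 → e x ≤ S j ^ 2 * m x) {t : ℝ} (ht : r ≤ t) :
    ∫ x in r..t, e x ≤ q ^ 2 * M := by
  have key : ∀ j : ℕ, ∫ x in r..(max r (N + j)), e x ≤ (∑ i ∈ Finset.range j, S i ^ 2) * M := by
    intro j
    induction j with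
    | zero => simp [hN]
    | succ j ih =>
      set a := max r ((N : ℝ) + j) with ha
      have hb : max r ((N : ℝ) + ((j + 1 : ℕ) : ℝ)) = N + j + 1 := by
        rw [max_eq_right]
        · push_cast; ring
        · push_cast; have : (0 : ℝ) ≤ j := Nat.cast_nonneg j
          linarith
      rw [hb]
      have hra : r ≤ a := le_max_left _ _
      have hNa : (N : ℝ) + j ≤ a := le_max_right _ _
      have hab : a ≤ N + j + 1 := by
        refine max_le ?_ (by linarith)
        have : (0 : ℝ) ≤ j := Nat.cast_nonneg j
        linarith
      rw [← intervalIntegral.integral_add_adjacent_intervals (iiI ce le_rfl hra) (iiI ce hra hab), Finset.sum_range_succ, add_mul]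
      refine add_le_add ih ?_
      calc ∫ x in a..(N + j + 1), e x ≤ ∫ x in a..(N + j + 1), S j ^ 2 * m x := by
            refine intervalIntegral.integral_mono_on hab (iiI ce hra hab) ((iiI cm hra hab).const_mul _) fun x hx => ?_
            exact he j x (hra.trans hx.1) (hNa.trans hx.1) hx.2
        _ = S j ^ 2 * ∫ x in a..(N + j + 1), m x := intervalIntegral.integral_const_mul _ _
        _ ≤ S j ^ 2 * M := by
            refine mul_le_mul_of_nonneg_left ?_ (by positivity)
            refine le_trans ?_ (hM a hra)
            have h1 : (N : ℝ) + j + 1 ≤ a + 1 := by linarith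
            rw [← intervalIntegral.integral_add_adjacent_intervals (iiI cm hra hab) (iiI cm (hra.trans hab) h1)]
            have : 0 ≤ ∫ x in (N : ℝ) + j + 1..(a + 1), m x :=
              intervalIntegral.integral_nonneg h1 fun x hx => m0 x ((hra.trans hab).trans hx.1)
            linarith
  obtain ⟨j, hj⟩ := exists_nat_ge t
  have h1 : t ≤ max r (N + j) := le_max_of_le_right (by have : (0 : ℝ) ≤ N := Nat.cast_nonneg N; linarith)
  have h2 : ∫ x in r..t, e x ≤ ∫ x in r..(max r (N + j)), e x := by
    rw [← intervalIntegral.integral_add_adjacent_intervals (iiI ce le_rfl ht) (iiI ce ht h1)]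
    have : 0 ≤ ∫ x in t..(max r (N + j)), e x :=
      intervalIntegral.integral_nonneg h1 fun x hx => e0 x (ht.trans hx.1)
    linarith
  have h3 : ∑ i ∈ Finset.range j, S i ^ 2 ≤ q ^ 2 := (hS.sum_le_tsum _ fun _ _ => by positivity).trans hq
  exact h2.trans ((key j).trans (by gcongr))

lemma Im_gen {m : ℝ → ℝ} {M : ℝ} (cm : ContinuousOn m (Set.Ici r)) (m0 : ∀ x, r ≤ x → 0 ≤ m x)
    (hM : ∀ t, r < t → ∫ x in t..(t+1), m x ≤ M) {t : ℝ} (ht : r ≤ t) : ∫ x in t..(t+1), m x ≤ M := by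
  rcases ht.lt_or_eq with h | rfl
  · exact hM t h
  obtain ⟨K, hK⟩ := (isCompact_Icc (a := r) (b := r + 1)).exists_bound_of_continuousOn (cm.mono Set.Icc_subset_Ici_self)
  have hK0 : 0 ≤ K := (norm_nonneg _).trans (hK r ⟨le_rfl, by linarith⟩)
  refine le_of_forall_pos_le_add fun δ hδ => ?_
  set ε := min 1 (δ / (K + 1)) with hε
  have hε0 : 0 < ε := lt_min one_pos (by positivity)
  have hε1 : ε ≤ 1 := min_le_left _ _
  have hεK : ε * K ≤ δ := by
    have : ε ≤ δ / (K + 1) := min_le_right _ _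
    calc ε * K ≤ δ / (K + 1) * (K + 1) := by gcongr; linarith
      _ = δ := by field_simp
  have h1 : r ≤ r + ε := by linarith
  have h2 : r + ε ≤ r + 1 := by linarith
  have h3 : r + 1 ≤ r + ε + 1 := by linarith
  rw [← intervalIntegral.integral_add_adjacent_intervals (iiI cm le_rfl h1) (iiI cm h1 h2)]
  have h4 := hM (r + ε) (by linarith)
  rw [← intervalIntegral.integral_add_adjacent_intervals (iiI cm h1 h2) (iiI cm (h1.trans h2) h3)] at h4
  have h5 : 0 ≤ ∫ x in r + 1..(r + ε + 1), m x := intervalIntegral.integral_nonneg h3 fun x hx => m0 x ((h1.trans h2).trans hx.1)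
  have h6 : ∫ x in r..(r + ε), m x ≤ ε * K := by
    have := intervalIntegral.integral_mono_on h1 (iiI cm le_rfl h1) (intervalIntegrable_const (c := K)) fun x hx =>
      (le_abs_self _).trans (hK x ⟨hx.1, hx.2.trans h2⟩)
    simpa using this
  linarith

lemma sm_tend {F : Type*} [NormedAddCommGroup F] [NormedSpace ℝ F] {f : E3 → F} (h : Tendsto f (cocompact E3) (𝓝 0)) :
    Tendsto (sm f) atTop (𝓝 0) := by
  rw [Metric.tendsto_nhds]
  intro ε hε
  have hs := s0_pos
  have h1 : ∀ᶠ x in cocompact E3, ‖f x‖ < ε / (2 * s0) := by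
    have := Metric.tendsto_nhds.1 h (ε / (2 * s0)) (by positivity)
    simpa using this
  rw [← Metric.cobounded_eq_cocompact, (hasBasis_cobounded_norm (E := E3)).eventually_iff] at h1
  obtain ⟨T, _, hT⟩ := h1
  filter_upwards [eventually_ge_atTop (max T 0)] with ρ hρ
  rw [dist_zero_right]
  have h2 : ‖sm f ρ‖ ≤ sm (fun _ => ε / (2 * s0)) ρ := by
    refine norm_integral_le_of_norm_le (integrable_const _) (Eventually.of_forall fun ω => ?_)
    refine (hT ?_).le
    simp only [Set.mem_ofPred_eq]
    rw [norm_smul_S2 ((le_max_right _ _).trans hρ)]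
    exact (le_max_left _ _).trans hρ
  rw [sm_const] at h2
  have : s0 * (ε / (2 * s0)) = ε / 2 := by field_simp
  linarith

lemma lN_gen {B : ℝ} (hB : ∀ x : E3, R < ‖x‖ → ‖u x‖ ≤ B) (hd : Tendsto (fun x => fderiv ℝ u x) (cocompact E3) (𝓝 0)) :
    Tendsto (smN u) atTop (𝓝 0) := by
  refine sm_tend ?_
  have h1 : Tendsto (fun x => B * ‖fderiv ℝ u x‖) (cocompact E3) (𝓝 0) := by
    simpa using hd.norm.const_mul B
  refine squeeze_zero_norm' ?_ h1
  filter_upwards [(tendsto_norm_cocompact_atTop (E := E3)).eventually_gt_atTop R] with x hx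
  rw [norm_mul, RCLike.norm_conj]
  have := hB x hx
  have := (norm_nonneg _).trans this
  gcongr
  exact rad_le x

lemma lB_gen {B : ℝ} (hB : ∀ x : E3, R < ‖x‖ → ‖u x‖ ≤ B) (hd : Tendsto Q (cocompact E3) (𝓝 0)) :
    Tendsto (smB Q u) atTop (𝓝 0) := by
  refine sm_tend ?_
  have h1 : Tendsto (fun x => ‖Q x‖ * B ^ 2) (cocompact E3) (𝓝 0) := by
    simpa using hd.norm.mul_const (B ^ 2)
  refine squeeze_zero_norm' ?_ h1
  filter_upwards [(tendsto_norm_cocompact_atTop (E := E3)).eventually_gt_atTop R] with x hx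
  rw [norm_mul, Real.norm_eq_abs, norm_pow, norm_norm]
  have := hB x hx
  have := qr_le (Q := Q) x
  gcongr

end

end PartB9

section PartC1
open scoped ENNReal Topology Pointwise

section
variable {R r : ℝ} {u : E3 → ℂ} {Q : E3 → E3} {k : ℂ} {ρ : ℝ}

lemma hsw_int (hR : 0 ≤ R) (hr : R < r) (hu : ContDiffOn ℝ 2 u (Om R))
    (hI : IntegrableOn (fun x : E3 => ‖fderiv ℝ u x‖ ^ 2 / ‖x‖ ^ 2) (Om r)) :
    IntegrableOn (fun x : E3 => hs u x / ‖x‖ ^ 2) (Om r) := by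
  have hsub : Om r ⊆ Om R := fun x hx => hr.trans hx
  have hc : ContinuousOn (fun x : E3 => hs u x / ‖x‖ ^ 2) (Om r) :=
    ((hs_cont hu).mono hsub).div (continuous_norm.pow 2).continuousOn fun x hx => by
      have : 0 < ‖x‖ := (hR.trans_lt hr).trans hx
      positivity
  refine Integrable.mono' (hI.const_mul 3) (hc.aestronglyMeasurable (isOpen_Om r).measurableSet) (Eventually.of_forall fun x => ?_)
  rw [Real.norm_of_nonneg (div_nonneg (hs_nn u x) (by positivity)), ← mul_div_assoc]
  have := hs_le_op u x
  gcongr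

lemma pol_set (hR : 0 ≤ R) (hr : R < r) {S : Set ℝ} (hS : MeasurableSet S) (hSr : S ⊆ Set.Ioi r)
    (hI : IntegrableOn (fun x : E3 => hs u x / ‖x‖ ^ 2) (Om r)) :
    ∫ x in {x : E3 | ‖x‖ ∈ S}, hs u x / ‖x‖ ^ 2 = ∫ ρ in S, sma u ρ := by
  have hm : MeasurableSet {x : E3 | ‖x‖ ∈ S} := measurable_norm hS
  have hsub : {x : E3 | ‖x‖ ∈ S} ⊆ Om r := fun x hx => hSr hx
  have hintg : Integrable (Set.indicator {x : E3 | ‖x‖ ∈ S} fun x : E3 => hs u x / ‖x‖ ^ 2) :=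
    (hI.mono_set hsub).integrable_indicator hm
  have hS0 : S ⊆ Set.Ioi 0 := fun x hx => (hR.trans_lt hr).trans (hSr hx)
  rw [← integral_indicator hm, integral_polar _ hintg]
  have e1 : ∀ ρ ∈ Set.Ioi (0:ℝ), ρ ^ 2 • sm (Set.indicator {x : E3 | ‖x‖ ∈ S} fun x : E3 => hs u x / ‖x‖ ^ 2) ρ
      = S.indicator (sma u) ρ := by
    intro ρ hρ
    have hρ0 : 0 < ρ := hρ
    by_cases h : ρ ∈ S
    · rw [Set.indicator_of_mem h, smul_eq_mul, sma, ← sm_mulr]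
      refine sm_congr hρ0.le fun x hx => ?_
      rw [Set.indicator_of_mem (show x ∈ {x : E3 | ‖x‖ ∈ S} by simp only [Set.mem_ofPred_eq]; rwa [hx]), hx]
      field_simp
    · rw [Set.indicator_of_notMem h, smul_eq_mul]
      have : sm (Set.indicator {x : E3 | ‖x‖ ∈ S} fun x : E3 => hs u x / ‖x‖ ^ 2) ρ = sm (fun _ => (0:ℝ)) ρ := by
        refine sm_congr hρ0.le fun x hx => ?_
        rw [Set.indicator_of_notMem]
        simp only [Set.mem_ofPred_eq]; rwa [hx]
      rw [this, sm_const]; simp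
  rw [setIntegral_congr_fun measurableSet_Ioi e1, setIntegral_indicator hS, Set.inter_eq_right.2 hS0]

lemma sma_nn (ρ : ℝ) : 0 ≤ sma u ρ := sm_nn (hs_nn u) ρ

lemma Ia_gen (hR : 0 ≤ R) (hr : R < r) (hI : IntegrableOn (fun x : E3 => hs u x / ‖x‖ ^ 2) (Om r)) {t : ℝ} (ht : r ≤ t) :
    ∫ ρ in r..t, sma u ρ ≤ ∫ x in Om r, hs u x / ‖x‖ ^ 2 := by
  rw [intervalIntegral.integral_of_le ht, ← pol_set hR hr measurableSet_Ioc (fun x hx => hx.1) hI]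
  refine setIntegral_mono_set hI (Eventually.of_forall fun x => ?_) (Eventually.of_forall fun x hx => hx.1)
  exact div_nonneg (hs_nn u x) (by positivity)

lemma sma_cont (hR : 0 ≤ R) (hr : R < r) (hu : ContDiffOn ℝ 2 u (Om R)) : ContinuousOn (sma u) (Set.Ici r) :=
  (sm_cont hR (hs_cont hu)).mono fun _ hx => hr.trans_le hx

lemma supA_gen (hR : 0 ≤ R) (hr : R < r) (hu : ContDiffOn ℝ 2 u (Om R))
    (hI : IntegrableOn (fun x : E3 => hs u x / ‖x‖ ^ 2) (Om r)) {X : ℝ}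
    (hX : ∀ᶠ t in atTop, ∫ ρ in r..t, sma u ρ ≤ X) : ∫ x in Om r, hs u x / ‖x‖ ^ 2 ≤ X := by
  have e : ∫ x in Om r, hs u x / ‖x‖ ^ 2 = ∫ ρ in Set.Ioi r, sma u ρ := pol_set hR hr measurableSet_Ioi (fun x hx => hx) hI
  have hi : IntegrableOn (sma u) (Set.Ioi r) := by
    refine integrableOn_Ioi_of_intervalIntegral_norm_bounded (l := atTop) (b := fun t => t) (∫ x in Om r, hs u x / ‖x‖ ^ 2) r ?_ tendsto_id ?_
    · intro t
      exact (((sma_cont hR hr hu).mono Set.Icc_subset_Ici_self).integrableOn_Icc).mono_set Set.Ioc_subset_Icc_self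
    · filter_upwards [eventually_ge_atTop r] with t ht
      simp only [Real.norm_of_nonneg (sma_nn _)]
      exact Ia_gen hR hr hI ht
  rw [e]
  exact le_of_tendsto (intervalIntegral_tendsto_integral_Ioi r hi tendsto_id) hX

set_option maxHeartbeats 1600000 in
lemma Ip_gen (hR : 0 ≤ R) (hr : R < r) (hu : ContDiffOn ℝ 2 u (Om R)) {A : ℝ}
    (hA : ∀ t, r ≤ t → ∫ ρ in r..t, sma u ρ ≤ A) {t : ℝ} (ht : r ≤ t) :
    ∫ x in r..t, smp u (s0⁻¹ • sm u r) x / x ^ 2 ≤ (2 * s0⁻¹ * CP0 + 8) * A := by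
  have hr0 : 0 < r := hR.trans_lt hr
  set c := s0⁻¹ • sm u r with hc
  have hI : Set.Ici r ⊆ Set.Ioi R := fun x hx => hr.trans_le hx
  have hs0 := s0_pos
  have hx0 : ∀ x ∈ Set.Ici r, x ^ 2 ≠ 0 := fun x hx => pow_ne_zero 2 (hr0.trans_le hx).ne'
  have cs : ContinuousOn (sma u) (Set.Ici r) := sma_cont hR hr hu
  have cn : ContinuousOn (smn u) (Set.Ici r) := (sm_cont hR (rad_cont hR hu)).mono hI
  have cU : ContinuousOn (sm u) (Set.Ici r) := (sm_cont hR hu.continuousOn).mono hI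
  have cpp : ContinuousOn (smp u c) (Set.Ici r) := (sm_cont hR (cp hu c)).mono hI
  have cg : ContinuousOn (fun x => s0⁻¹ • sm u x - c) (Set.Ici r) := (cU.const_smul s0⁻¹).sub (continuousOn_const (c := c))
  have cg' : ContinuousOn (fun x => s0⁻¹ • smn u x) (Set.Ici r) := cn.const_smul s0⁻¹
  have ch : ContinuousOn (fun x => ‖s0⁻¹ • sm u x - c‖ ^ 2 / x ^ 2) (Set.Ici r) := (cg.norm.pow 2).div (continuousOn_id.pow 2) hx0
  have cl : ContinuousOn (fun x => smp u c x / x ^ 2) (Set.Ici r) := cpp.div (continuousOn_id.pow 2) hx0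
  have hh := hardy (g := fun x => s0⁻¹ • sm u x - c) (g' := fun x => s0⁻¹ • smn u x) hr0 ht
    (fun x hx => ((smU_d hR hu (hr.trans_le hx)).const_smul s0⁻¹).sub_const c) cg' (by simp [hc])
  have h1 : ∫ x in r..t, ‖s0⁻¹ • smn u x‖ ^ 2 ≤ s0⁻¹ * ∫ x in r..t, sma u x := by
    rw [← intervalIntegral.integral_const_mul]
    refine intervalIntegral.integral_mono_on ht (iiI (cg'.norm.pow 2) le_rfl ht) ((iiI cs le_rfl ht).const_mul _) fun x hx => ?_
    have := bn hR hu (hr.trans_le hx.1)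
    rw [norm_smul, mul_pow, norm_inv, Real.norm_eq_abs, abs_of_pos hs0, inv_pow]
    calc (s0 ^ 2)⁻¹ * ‖smn u x‖ ^ 2 ≤ (s0 ^ 2)⁻¹ * (s0 * sma u x) := by gcongr
      _ = _ := by field_simp
  have h2 : ∫ x in r..t, smp u c x / x ^ 2 ≤
      ∫ x in r..t, (2 * (s0⁻¹ * CP0) * sma u x + 2 * s0 * (‖s0⁻¹ • sm u x - c‖ ^ 2 / x ^ 2)) := by
    refine intervalIntegral.integral_mono_on ht (iiI cl le_rfl ht)
      (((iiI cs le_rfl ht).const_mul _).add ((iiI ch le_rfl ht).const_mul _)) fun x hx => ?_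
    have hxp : 0 < x := hr0.trans_le hx.1
    have := bp hR hu (hr.trans_le hx.1) c
    rw [div_le_iff₀ (by positivity)]
    refine this.trans (le_of_eq ?_)
    field_simp
  rw [intervalIntegral.integral_add ((iiI cs le_rfl ht).const_mul _) ((iiI ch le_rfl ht).const_mul _),
    intervalIntegral.integral_const_mul, intervalIntegral.integral_const_mul] at h2
  have h3 := hA t ht
  have hcp := CP0_pos
  calc _ ≤ _ := h2
    _ ≤ 2 * (s0⁻¹ * CP0) * A + 2 * s0 * (4 * (s0⁻¹ * A)) := by
      gcongr
      exact hh.trans (by gcongr; exact h1.trans (by gcongr))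
    _ = _ := by field_simp; ring

end

end PartC1

section PartC2
open scoped ENNReal Topology Pointwise

section
variable {R r : ℝ} {u : E3 → ℂ} {Q : E3 → E3} {k : ℂ} {ρ : ℝ}

lemma mkD1 (hQ : ContDiff ℝ 1 Q) (hsQ : Summable fun n => (annSupV Q n) ^ 2) (hk : 0 < k.im) (hR : 0 ≤ R) (hr : R < r)
    (hu : ContDiffOn ℝ 2 u (Om R)) {b : ℝ} (hb : ∀ x : E3, R < ‖x‖ → ‖u x‖ ≤ b) (hpde : PDE R Q k u)
    (hd : Tendsto (fun x => fderiv ℝ u x) (cocompact E3) (𝓝 0))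
    (hI : IntegrableOn (fun x : E3 => ‖fderiv ℝ u x‖ ^ 2 / ‖x‖ ^ 2) (Om r)) {M : ℝ} (hM0 : 0 ≤ M)
    (hM : ∀ t, r < t → ∫ x in t..(t+1), smm u x ≤ M)
    (supM : ∀ X, (∀ t, r < t → ∫ x in t..(t+1), smm u x ≤ X) → M ≤ X) :
    D1 k r (l2LinfTail Q r) M (∫ x in Om r, hs u x / ‖x‖ ^ 2) s0 (2 * s0⁻¹ * CP0 + 8) (sm (fun x => ‖rad u x‖ ^ 2) r)
      (s0⁻¹ • sm u r) (smm u) (sma u) (sme Q u) (smp u (s0⁻¹ • sm u r)) (smv Q u) (smB Q u) (sm (fg1 Q u))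
      (smN u) (smn u) (sm u) (smuV Q u) (smD Q u) (sm (fg2 Q u)) := by
  have hr0 : 0 < r := hR.trans_lt hr
  have hI2 := hsw_int hR hr hu hI
  have hs0 := s0_pos
  have hcp := CP0_pos
  have hIr : Set.Ici r ⊆ Set.Ioi R := fun x hx => hr.trans_le hx
  have hqx : ∀ ρ, r ≤ ρ → ∀ x : E3, ‖x‖ = ρ → ‖Q x‖ ≤ l2LinfTail Q r := fun ρ hρ x hx =>
    Q_le_q hQ.continuous hsQ (by rw [hx]; exact hr0.trans_le hρ) (by rw [hx]; exact hρ)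
  have cm : ContinuousOn (smm u) (Set.Ici r) := (sm_cont hR (cu2 hu)).mono hIr
  have m0 : ∀ x, r ≤ x → 0 ≤ smm u x := fun x _ => sm_nn (fun x => by positivity) x
  have e0 : ∀ x, r ≤ x → 0 ≤ sme Q u x := fun x _ => sm_nn (fun x => by positivity) x
  have cee : ContinuousOn (sme Q u) (Set.Ici r) := (sm_cont hR (ce hQ hu)).mono hIr
  have hIm : ∀ t, r ≤ t → ∫ x in t..(t+1), smm u x ≤ M := fun t ht => Im_gen cm m0 hM ht
  have hIa : ∀ t, r ≤ t → ∫ x in r..t, sma u x ≤ ∫ x in Om r, hs u x / ‖x‖ ^ 2 := fun t ht => Ia_gen hR hr hI2 ht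
  have hIe : ∀ t, r ≤ t → ∫ x in r..t, sme Q u x ≤ l2LinfTail Q r ^ 2 * M := fun t ht => by
    refine Ie_gen (N := ⌊r⌋₊) (S := fun j => annSupV Q (⌊r⌋₊ + j)) (Nat.floor_le hr0.le) (Nat.lt_floor_add_one r) cee cm e0 m0 hIm hM0
      (tail_summ hsQ _) tail_sq.ge (fun j x hx h1 h2 => ?_) ht
    refine be hR hu hQ (hr.trans_le hx) fun y hy => ?_
    refine Q_closed hQ.continuous (by rw [hy]; exact hr0.trans_le hx) ?_ ?_
    · rw [hy]; push_cast; exact h1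
    · rw [hy]; push_cast; exact h2
  exact
  { hk := hk
    hr := hr0
    hq := tail_nn
    hM := hM0
    hA := integral_nonneg fun x => div_nonneg (hs_nn u x) (by positivity)
    hs := hs0
    hCH := by positivity
    hm1 := sm_nn (fun x => by positivity) r
    m_nn := m0
    a_nn := fun x _ => sma_nn x
    e_nn := e0
    p_nn := fun x _ => sm_nn (fun x => by positivity) x
    ca := sma_cont hR hr hu
    ce := cee
    cp := (sm_cont hR (cp hu _)).mono hIr
    cv := (sm_cont hR ((rdiv_cont hQ).continuousOn.mul (cu2 hu))).mono hIr
    cg1 := (sm_cont hR (fg1_cont hQ hu)).mono hIr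
    cg2 := (sm_cont hR (fg2_cont hQ hu)).mono hIr
    dN := fun x hx => smN_d hR hu hQ hpde (hr.trans_le hx)
    dn := fun x hx => smn_d hR hu hQ hpde (hr.trans_le hx)
    dm := fun x hx => smm_d hR hu (hr.trans_le hx)
    dU := fun x hx => smU_d hR hu (hr.trans_le hx)
    dB := fun x hx => smB_d hR hu hQ (hr.trans_le hx)
    dD := fun x hx => smD_d hR hu hQ (hr.trans_le hx)
    bN := fun x hx => bN hR hu (hr.trans_le hx)
    bN1 := bN1 hR hu hr
    bn := fun x hx => bn hR hu (hr.trans_le hx)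
    bn1 := bn1 hR hu hr
    bU := fun x hx => bU hR hu (hr.trans_le hx)
    bB := fun x hx => bB hR hu hQ (hr.trans_le hx)
    bD := fun x hx => bD hR hu hQ (hr.trans_le hx)
    be := fun x hx => be hR hu hQ (hr.trans_le hx) (hqx x hx)
    bg1 := fun x hx => bg1 hR hu hQ (hr.trans_le hx)
    bg2 := fun x hx => bg2 hR hu hQ (hr.trans_le hx) (hqx x hx)
    bc := bc hR hu hr
    bG := fun x hx w hw0 hw1 => bG hR hu hQ (hr.trans_le hx) (hqx x hx) tail_nn _ w hw0 hw1
    Ia := hIa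
    Ip := fun t ht => Ip_gen hR hr hu hIa ht
    Ie := hIe
    Im := hIm
    lN := lN_gen hb hd
    lB := lB_gen hb (Q_lim hQ.continuous hsQ)
    supA := fun X hX => supA_gen hR hr hu hI2 hX
    supM := supM }

lemma A_le (hR : 0 ≤ R) (hr : R < r) (hu : ContDiffOn ℝ 2 u (Om R))
    (hI : IntegrableOn (fun x : E3 => ‖fderiv ℝ u x‖ ^ 2 / ‖x‖ ^ 2) (Om r)) :
    Aint u r ≤ ∫ x in Om r, hs u x / ‖x‖ ^ 2 := by
  refine setIntegral_mono hI (hsw_int hR hr hu hI) fun x => ?_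
  have := op_le_hs u x
  dsimp only
  gcongr

lemma le_A (hR : 0 ≤ R) (hr : R < r) (hu : ContDiffOn ℝ 2 u (Om R))
    (hI : IntegrableOn (fun x : E3 => ‖fderiv ℝ u x‖ ^ 2 / ‖x‖ ^ 2) (Om r)) :
    ∫ x in Om r, hs u x / ‖x‖ ^ 2 ≤ 3 * Aint u r := by
  unfold Aint
  rw [← integral_const_mul]
  refine setIntegral_mono (hsw_int hR hr hu hI) (hI.const_mul 3) fun x => ?_
  have := hs_le_op u x
  dsimp only
  rw [← mul_div_assoc]
  gcongr

lemma X1_scale {K κ q M g m m1 c : ℝ} (hc : 0 < c) (hm : 0 ≤ m) :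
    X1 K κ q (c * M) g (√(c * m)) (√(c * m1)) = c * (M * q ^ 2 + M * q * g + m * q + K ^ 2 / κ * (m + √(m * m1) / K)) := by
  unfold X1
  rw [Real.sq_sqrt (by positivity), ← Real.sqrt_mul (by positivity), show c * m * (c * m1) = c ^ 2 * (m * m1) by ring,
    Real.sqrt_mul (by positivity), Real.sqrt_sq hc.le]
  ring

lemma X2_scale {K κ q M g m m1 c A A3 : ℝ} (hc : 0 < c) (hm : 0 ≤ m) (hM : 0 ≤ M) (hA : 0 ≤ A) (hA3 : A3 ≤ 3 * A)
    (hK : 0 < K) (hκ : 0 < κ) (hq : 0 ≤ q) (hg : 0 ≤ g) :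
    X2 K κ q g (√(c * m)) (√(c * m1)) (√(c * M)) (√A3) ≤
      (2 * √c + c) * (κ / K ^ 2 * (√(A * M) * q + m * q + M * q * g) + m + √(m * m1) / K + √(M * A) / K) := by
  have h1 : √(c * M) * √A3 ≤ 2 * √c * √(M * A) := by
    have h3 : √A3 ≤ 2 * √A := by
      refine Real.sqrt_le_iff.2 ⟨by positivity, ?_⟩
      rw [mul_pow, Real.sq_sqrt hA]; linarith
    rw [Real.sqrt_mul hc.le, Real.sqrt_mul hM]
    calc √c * √M * √A3 ≤ √c * √M * (2 * √A) := by gcongr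
      _ = _ := by ring
  have h2 : √(c * m) * √(c * m1) = c * √(m * m1) := by
    rw [← Real.sqrt_mul (by positivity), show c * m * (c * m1) = c ^ 2 * (m * m1) by ring,
      Real.sqrt_mul (by positivity), Real.sqrt_sq hc.le]
  unfold X2
  rw [h2, Real.sq_sqrt (by positivity), Real.sq_sqrt (by positivity), mul_comm A M, mul_comm (√A3)]
  have hw := Real.sqrt_nonneg (M * A)
  have hv := Real.sqrt_nonneg (m * m1)
  set w := √(M * A)
  set v := √(m * m1)
  have hsc := Real.sqrt_nonneg c
  set d := √c
  calc _ ≤ κ / K ^ 2 * (2 * d * w * q + c * m * q + c * M * q * g) + c * m + c * v / K + 2 * d * w / K := by gcongr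
    _ ≤ κ / K ^ 2 * ((2 * d + c) * w * q + (2 * d + c) * m * q + (2 * d + c) * M * q * g) + (2 * d + c) * m + (2 * d + c) * v / K
        + (2 * d + c) * w / K := by gcongr <;> linarith
    _ = _ := by ring

lemma sphAvg_eq {c : ℝ} (hc : ∀ r : ℝ, 0 < r → ∀ f : E3 → ℝ, ∫ x in sphere (0 : E3) r, f x ∂μH[2]
      = c * r^2 * ∫ ω : S2, f (r • (ω : E3)) ∂(volume : Measure E3).toSphere) (hr : 0 < r) :
    sphAvg u r = c * smm u r := by
  unfold sphAvg
  rw [hc r hr (fun x => ‖u x‖ ^ 2)]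
  change _ = c * (∫ ω : S2, ‖u (r • (ω : E3))‖ ^ 2 ∂(volume : Measure E3).toSphere)
  field_simp

lemma sphAvg1_eq {c : ℝ} (hc : ∀ r : ℝ, 0 < r → ∀ f : E3 → ℝ, ∫ x in sphere (0 : E3) r, f x ∂μH[2]
      = c * r^2 * ∫ ω : S2, f (r • (ω : E3)) ∂(volume : Measure E3).toSphere) (hr : 0 < r) :
    sphAvg1 u r = c * sm (fun x => ‖rad u x‖ ^ 2) r := by
  unfold sphAvg1
  rw [hc r hr (fun x => ‖rad u x‖ ^ 2)]
  change _ = c * (∫ ω : S2, ‖rad u (r • (ω : E3))‖ ^ 2 ∂(volume : Measure E3).toSphere)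
  field_simp

end

end PartC2

/-- A-priori bounds on `A(r)` and `M(r)` for bounded `C²` solutions of
`−Δμ − 2(ik − 1/|x|)∂_rμ + (div Q)μ = 0` on `{|x| > R}` with `∇μ → 0` at infinity, where
`Q ∈ C¹` with `‖div Q‖_{ℓ²(ℤ⁺),L∞} + ‖Q‖_{ℓ²(ℤ⁺),L∞} < ∞`, with an absolute constant `C`
and `q(r) = ‖Q‖_{ℓ²([r],∞),L∞}`. -/
theorem stmt_14 :
    ∃ C : ℝ, 0 < C ∧
      ∀ Q : EuclideanSpace ℝ (Fin 3) → EuclideanSpace ℝ (Fin 3),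
        ContDiff ℝ 1 Q →
        Summable (fun n => (annSup (rdiv Q) n) ^ 2) →
        Summable (fun n => (annSupV Q n) ^ 2) →
        ∀ k : ℂ, 0 < k.im →
          ∀ R : ℝ, 0 ≤ R →
            ∀ μ : EuclideanSpace ℝ (Fin 3) → ℂ,
              ContDiffOn ℝ 2 μ {x : EuclideanSpace ℝ (Fin 3) | R < ‖x‖} →
              (∃ B : ℝ, ∀ x : EuclideanSpace ℝ (Fin 3), R < ‖x‖ → ‖μ x‖ ≤ B) →
              (∀ x : EuclideanSpace ℝ (Fin 3), R < ‖x‖ →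
                -(lap μ x) - 2 * (Complex.I * k - ((‖x‖⁻¹ : ℝ) : ℂ)) * rad μ x
                  + (rdiv Q x : ℂ) * μ x = 0) →
              Tendsto (fun x : EuclideanSpace ℝ (Fin 3) => fderiv ℝ μ x)
                (cocompact (EuclideanSpace ℝ (Fin 3))) (nhds 0) →
              ∀ r : ℝ, R < r →
                IntegrableOn (fun x : EuclideanSpace ℝ (Fin 3) => ‖fderiv ℝ μ x‖ ^ 2 / ‖x‖ ^ 2)
                  {x : EuclideanSpace ℝ (Fin 3) | r < ‖x‖} →
                BddAbove (Mset μ r) →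
                (Aint μ r ≤ C *
                    (Msup μ r * (l2LinfTail Q r) ^ 2
                      + Msup μ r * l2LinfTail Q r * (Real.sqrt (r + 1))⁻¹
                      + sphAvg μ r * l2LinfTail Q r
                      + (‖k‖ ^ 2 / k.im) *
                        (sphAvg μ r + Real.sqrt (sphAvg μ r * sphAvg1 μ r) / ‖k‖)))
                ∧
                (Msup μ r ≤ C *
                    ((k.im / ‖k‖ ^ 2) *
                        (Real.sqrt (Aint μ r * Msup μ r) * l2LinfTail Q r
                          + sphAvg μ r * l2LinfTail Q r
                          + Msup μ r * l2LinfTail Q r * (Real.sqrt (r + 1))⁻¹)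
                      + sphAvg μ r
                      + Real.sqrt (sphAvg μ r * sphAvg1 μ r) / ‖k‖
                      + Real.sqrt (Msup μ r * Aint μ r) / ‖k‖)) := by
  obtain ⟨c, hc, hκ⟩ := exists_haus_int
  have hs0 := s0_pos
  have hcp := CP0_pos
  set CH : ℝ := 2 * s0⁻¹ * CP0 + 8 with hCH
  set C1 : ℝ := 2*((2*√CH+2)^2+(2*√CH+6)^2+17) with hC1
  set C2 : ℝ := 16*√CH+168 with hC2
  have hC1p : 0 < C1 := by positivity
  have hC2p : 0 < C2 := by positivity
  refine ⟨C1 * c⁻¹ + c * C2 * (2 * √c⁻¹ + c⁻¹), by positivity, ?_⟩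
  intro Q hQ _ hsQ k hk R hR u hu hb hpde hd r hr hI hbdd
  obtain ⟨b, hb⟩ := hb
  have hr0 : 0 < r := hR.trans_lt hr
  have hwin : ∀ t, r < t → ∫ x in t..(t+1), sphAvg u x = c * ∫ x in t..(t+1), smm u x := by
    intro t ht
    rw [← intervalIntegral.integral_const_mul]
    refine intervalIntegral.integral_congr fun x hx => ?_
    rw [Set.uIcc_of_le (by linarith)] at hx
    exact sphAvg_eq hκ (hr0.trans (ht.trans_le hx.1))
  have hmnn : ∀ t, 0 ≤ smm u t := fun t => sm_nn (fun x => by positivity) t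
  have hM : ∀ t, r < t → c * ∫ x in t..(t+1), smm u x ≤ Msup u r := fun t ht => by
    rw [← hwin t ht]
    exact le_csSup hbdd ⟨t, ht, rfl⟩
  have hMs : 0 ≤ Msup u r := by
    refine le_trans ?_ (hM (r + 1) (by linarith))
    have := intervalIntegral.integral_nonneg (μ := volume) (show r + 1 ≤ r + 1 + 1 by linarith) fun x _ => hmnn x
    positivity
  have d := mkD1 (M := c⁻¹ * Msup u r) hQ hsQ hk hR hr hu hb hpde hd hI (by positivity)
    (fun t ht => by
      have := hM t ht
      rw [inv_mul_eq_div, le_div_iff₀ hc]; linarith)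
    (fun X hX => by
      rw [inv_mul_eq_div, div_le_iff₀ hc]
      refine csSup_le ⟨_, r + 1, by linarith, rfl⟩ ?_
      rintro y ⟨t, ht, rfl⟩
      rw [hwin t ht, mul_comm]
      have := hX t ht
      gcongr)
  have p1 := d.part1
  have p2 := d.part2
  have em : smm u r = c⁻¹ * sphAvg u r := by rw [sphAvg_eq hκ hr0]; field_simp
  have em1 : sm (fun x => ‖rad u x‖ ^ 2) r = c⁻¹ * sphAvg1 u r := by rw [sphAvg1_eq hκ hr0]; field_simp
  have hm0 : 0 ≤ sphAvg u r := by rw [sphAvg_eq hκ hr0]; have := hmnn r; positivity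
  have hkn : 0 < ‖k‖ := norm_pos_iff.2 fun h => by simp [h] at hk
  have hq : 0 ≤ l2LinfTail Q r := tail_nn
  have hA0 : 0 ≤ Aint u r := integral_nonneg fun x => by positivity
  have hci : 0 < c⁻¹ := inv_pos.2 hc
  rw [em, em1, X1_scale hci hm0] at p1
  rw [em, em1] at p2
  have p3 := p2.trans (mul_le_mul_of_nonneg_left (X2_scale hci hm0 hMs hA0 (le_A hR hr hu hI) hkn hk hq
    (inv_nonneg.2 (Real.sqrt_nonneg (r + 1)))) hC2p.le)
  have p4 := (A_le hR hr hu hI).trans p1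
  constructor
  · refine p4.trans ?_
    rw [← mul_assoc]
    refine mul_le_mul_of_nonneg_right ?_ (by positivity)
    have : 0 ≤ c * C2 * (2 * √c⁻¹ + c⁻¹) := by positivity
    linarith
  · rw [inv_mul_eq_div, div_le_iff₀ hc] at p3
    refine p3.trans ?_
    rw [mul_comm _ c, ← mul_assoc, ← mul_assoc]
    refine mul_le_mul_of_nonneg_right ?_ (by positivity)
    have : 0 ≤ C1 * c⁻¹ := by positivity
    linarith
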